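/- Let K be a number field. Then the set {(a₁, a₂, a₃) ∈ (Kˣ)³ : the quadratic form a₁x² + a₂y² + a₃z² is anisotropic over K, i.e. a₁x² + a₂y² + a₃z² = 0 has no nonzero solution in K³} is diophantine over K. -/

import Mathlib

/-- A subset `S ⊆ K^ι` is diophantine over `K` if there are `m ∈ ℕ` and a polynomial
`f` in the variables `y_i` (`i : ι`) and `x_1, …, x_m` with coefficients in `K` such that
`a ∈ S` iff `f(a, x) = 0` has a solution `x ∈ K^m`. -/
def IsDiophantine {K : Type*} [Field K] {ι : Type*} [Fintype ι] (S : Set (ι → K)) : Prop :=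
  ∃ (m : ℕ) (f : MvPolynomial (ι ⊕ Fin m) K),
    ∀ a : ι → K, a ∈ S ↔ ∃ x : Fin m → K, MvPolynomial.eval (Sum.elim a x) f = 0

set_option linter.unusedSectionVars false

namespace TAD
open Subgroup

section Nm
variable {K : Type*} [Field K]

/-- norm group of `K(√a)` -/
def Nm (a : Kˣ) : Subgroup Kˣ where
  carrier := {z | ∃ x y : K, (z : K) = x ^ 2 - a * y ^ 2}
  one_mem' := ⟨1, 0, by simp⟩
  mul_mem' := by
    rintro z w ⟨x, y, h⟩ ⟨x', y', h'⟩
    refine ⟨x * x' + a * y * y', x * y' + y * x', ?_⟩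
    push_cast; rw [h, h']; ring
  inv_mem' := by
    rintro z ⟨x, y, h⟩
    refine ⟨x / z, y / z, ?_⟩
    have hz : (z : K) ≠ 0 := z.ne_zero
    rw [Units.val_inv_eq_inv_val]
    field_simp
    rw [h]

lemma mem_Nm {a z : Kˣ} : z ∈ Nm a ↔ ∃ x y : K, (z : K) = x ^ 2 - a * y ^ 2 := Iff.rfl

lemma sq_mem_Nm (a s : Kˣ) : s ^ 2 ∈ Nm a := ⟨s, 0, by simp⟩

lemma neg_mem_Nm (a : Kˣ) : -a ∈ Nm a := ⟨0, 1, by simp⟩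

lemma Nm_symm [NeZero (2 : K)] {a b : Kˣ} (h : b ∈ Nm a) : a ∈ Nm b := by
  obtain ⟨x, y, h⟩ := h
  have h2 : (2 : K) ≠ 0 := NeZero.ne _
  by_cases hy : y = 0
  · have hx : x ≠ 0 := by
      rintro rfl
      apply b.ne_zero; rw [h, hy]; simp
    refine ⟨(a + 1) / 2, (a - 1) / 2 / x, ?_⟩
    rw [h, hy]; field_simp; ring
  · refine ⟨x / y, 1 / y, ?_⟩
    rw [h]; field_simp; ring

lemma Nm_mul_sq (a s : Kˣ) : Nm (a * s ^ 2) = Nm a := by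
  ext z; constructor
  · rintro ⟨x, y, h⟩
    exact ⟨x, s * y, by rw [h]; push_cast; ring⟩
  · rintro ⟨x, y, h⟩
    exact ⟨x, y / s, by rw [h]; push_cast; field_simp⟩

lemma Nm_sq [NeZero (2 : K)] (s : Kˣ) : Nm (s ^ 2) = ⊤ := by
  have : s ^ 2 = 1 * s ^ 2 := by simp
  rw [this, Nm_mul_sq, eq_top_iff]
  intro z _
  have h2 : (2 : K) ≠ 0 := NeZero.ne _
  exact ⟨(z + 1) / 2, (z - 1) / 2, by push_cast; field_simp; ring⟩

/-- squares subgroup -/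
def Sq (K : Type*) [Field K] : Subgroup Kˣ := (powMonoidHom 2 : Kˣ →* Kˣ).range

lemma mem_Sq {x : Kˣ} : x ∈ Sq K ↔ ∃ s : Kˣ, x = s ^ 2 := by
  simp [Sq, MonoidHom.mem_range, eq_comm]

lemma Sq_le_Nm (a : Kˣ) : Sq K ≤ Nm a := by
  intro x hx
  obtain ⟨s, rfl⟩ := mem_Sq.1 hx
  exact sq_mem_Nm a s

end Nm

section counting
variable {G : Type*} [CommGroup G]

/-- independent witnesses give a lower bound of the index -/
lemma two_pow_le_relIndex {ι : Type*} (s : Finset ι) (H : ι → Subgroup G) (U N : Subgroup G) (g : ι → G)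
    (hg : ∀ i ∈ s, g i ∈ U) (h1 : ∀ i ∈ s, g i ∉ H i)
    (h2 : ∀ i ∈ s, ∀ j ∈ s, j ≠ i → g i ∈ H j) (hN : ∀ i ∈ s, ∀ x ∈ U, x ∈ N → x ∈ H i)
    (hfin : N.relIndex U ≠ 0) : 2 ^ s.card ≤ N.relIndex U := by
  classical
  have : Finite (U ⧸ N.subgroupOf U) := by
    have : (N.subgroupOf U).FiniteIndex := ⟨hfin⟩
    infer_instance
  rw [Subgroup.relIndex, Subgroup.index]
  let F : s.powerset → (U ⧸ N.subgroupOf U) := fun T =>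
    QuotientGroup.mk ⟨∏ i ∈ T.1, g i, U.prod_mem fun i hi => hg i (Finset.mem_powerset.1 T.2 hi)⟩
  have hF : Function.Injective F := by
    have key : ∀ T T' : s.powerset, F T = F T' → ∀ i ∈ T.1, i ∈ T'.1 := by
      intro T T' h i hi
      by_contra hi'
      have his : i ∈ s := Finset.mem_powerset.1 T.2 hi
      rw [QuotientGroup.eq, Subgroup.mem_subgroupOf] at h
      have h3 := hN i his _ (SetLike.coe_mem _) h
      simp only [Subgroup.coe_mul, Subgroup.coe_inv] at h3
      have h4 : ∏ j ∈ T'.1, g j ∈ H i := (H i).prod_mem fun j hj =>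
        h2 j (Finset.mem_powerset.1 T'.2 hj) i his (by rintro rfl; exact hi' hj)
      rw [Subgroup.mul_mem_cancel_right _ h4, inv_mem_iff, ← Finset.mul_prod_erase _ _ hi] at h3
      have h5 : ∏ j ∈ T.1.erase i, g j ∈ H i := (H i).prod_mem fun j hj =>
        h2 j (Finset.mem_powerset.1 T.2 (Finset.mem_of_mem_erase hj)) i his
          (Finset.ne_of_mem_erase hj).symm
      rw [Subgroup.mul_mem_cancel_right _ h5] at h3
      exact h1 i his h3
    intro T T' h
    apply Subtype.ext; ext i
    exact ⟨key T T' h i, key T' T h.symm i⟩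
  have := Nat.card_le_card_of_injective F hF
  rwa [Nat.card_eq_fintype_card, Fintype.card_coe, Finset.card_powerset] at this

lemma not_union {H₁ H₂ : Subgroup G} (h1 : H₁ ≠ ⊤) (h2 : H₂ ≠ ⊤) : ∃ x, x ∉ H₁ ∧ x ∉ H₂ := by
  by_contra! h
  obtain ⟨a, ha⟩ : ∃ a, a ∉ H₁ := by
    by_contra! hh; exact h1 (eq_top_iff.2 fun x _ => hh x)
  obtain ⟨b, hb⟩ : ∃ a, a ∉ H₂ := by
    by_contra! hh; exact h2 (eq_top_iff.2 fun x _ => hh x)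
  have ha2 := h a ha
  have hb1 : b ∈ H₁ := by by_contra hb1; exact hb (h b hb1)
  have h3 : a * b ∉ H₁ := by rwa [Subgroup.mul_mem_cancel_right _ hb1]
  have h4 := h _ h3
  rw [Subgroup.mul_mem_cancel_left _ ha2] at h4
  exact hb h4

lemma exists_notMem {H : Subgroup G} (h : H ≠ ⊤) : ∃ x, x ∉ H := by
  obtain ⟨x, hx, _⟩ := not_union h h; exact ⟨x, hx⟩

lemma relIndex_iInf_le {ι : Type*} (s : Finset ι) (H : ι → Subgroup G) (hH : ∀ i ∈ s, (H i).index ≠ 0) :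
    (⨅ i ∈ s, H i).index ≤ ∏ i ∈ s, (H i).index ∧ (⨅ i ∈ s, H i).index ≠ 0 := by
  classical
  induction s using Finset.induction_on with
  | empty => simp
  | insert a s ha ih =>
    have ih := ih fun i hi => hH i (Finset.mem_insert_of_mem hi)
    have h0 := hH a (Finset.mem_insert_self a s)
    rw [Finset.prod_insert ha, Finset.iInf_insert]
    refine ⟨(Subgroup.index_inf_le).trans (Nat.mul_le_mul_left _ ih.1), Subgroup.index_inf_ne_zero h0 ih.2⟩

end counting
end TAD

namespace TAD
open Subgroup WithZero
open scoped WithZero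

section loc
variable {K : Type*} [Field K] [CharZero K] (v : Valuation K ℤᵐ⁰)

lemma v_nat_le (n : ℕ) : v (n : K) ≤ 1 := by
  induction n with
  | zero => simp
  | succ n ih => push_cast; exact (v.map_add _ _).trans (by simp [ih])

lemma v4_le : v (4 : K) ≤ 1 := by exact_mod_cast v_nat_le v 4
lemma v2_le : v (2 : K) ≤ 1 := by exact_mod_cast v_nat_le v 2
lemma v3_le : v (3 : K) ≤ 1 := by exact_mod_cast v_nat_le v 3
lemma v4_ne : v (4 : K) ≠ 0 := by simp
lemma v4_pos : 0 < v (4 : K) := zero_lt_iff.2 (v4_ne v)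
lemma v2_pos : 0 < v (2 : K) := zero_lt_iff.2 (by simp)
lemma v4_eq : v (4 : K) = v 2 * v 2 := by rw [← map_mul]; norm_num

lemma v_one_add {x : K} (h : v x < 1) : v (1 + x) = 1 := by
  have := v.map_add_eq_of_lt_right (x := x) (y := 1) (by simpa using h)
  rw [add_comm]; simpa using this

/-- local squares at a valuation -/
def Dval : Subgroup Kˣ where
  carrier := {x | ∃ s : Kˣ, v (x * s ^ 2 - 1) < v 4}
  one_mem' := ⟨1, by simpa using v4_pos v⟩
  mul_mem' := by
    rintro x y ⟨s, hs⟩ ⟨t, ht⟩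
    refine ⟨s * t, ?_⟩
    have : (((x * y : Kˣ) : K) * ((s * t : Kˣ) : K) ^ 2 - 1) =
      (x * s ^ 2 - 1) * (y * t ^ 2 - 1) + ((x * s ^ 2 - 1) + (y * t ^ 2 - 1)) := by
      push_cast; ring
    rw [this]
    refine v.map_add_lt ?_ (v.map_add_lt hs ht)
    rw [map_mul]
    calc _ ≤ v (x * s ^ 2 - 1 : K) * 1 := by gcongr; exact (ht.le.trans (v4_le v))
      _ < _ := by simpa using hs
  inv_mem' := by
    rintro x ⟨s, hs⟩
    refine ⟨s⁻¹, ?_⟩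
    have h1 : v ((x : K) * s ^ 2) = 1 := by
      have := v_one_add v (hs.trans_le (v4_le v))
      simpa using this
    have : (((x⁻¹ : Kˣ) : K) * ((s⁻¹ : Kˣ) : K) ^ 2 - 1) = - ((x * s ^ 2 - 1)) / (x * s ^ 2) := by
      push_cast; field_simp; ring
    rw [this, map_div₀, h1, Valuation.map_neg]; simpa using hs

variable {v}
lemma mem_Dval {x : Kˣ} : x ∈ Dval v ↔ ∃ s : Kˣ, v (x * s ^ 2 - 1) < v 4 := Iff.rfl

lemma sq_mem_Dval (s : Kˣ) : s ^ 2 ∈ Dval v :=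
  ⟨s⁻¹, by rw [show ((s ^ 2 : Kˣ) : K) * ((s⁻¹ : Kˣ) : K) ^ 2 - 1 = 0 by push_cast; field_simp; ring]
           simpa using v4_pos v⟩

lemma mem_Dval_of_lt {x : Kˣ} (h : v ((x : K) - 1) < v 4) : x ∈ Dval v := ⟨1, by simpa using h⟩

lemma lt_imp_le_mul_exp {x y : ℤᵐ⁰} (h : x < y) : x ≤ y * exp (-1 : ℤ) := by
  have hy : y ≠ 0 := (zero_le.trans_lt h).ne'
  have := lt_mul_exp_iff_le (x := x) (y := y * exp (-1 : ℤ)) (by simp [hy])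
  rw [mul_assoc, ← exp_add] at this
  simp at this
  simpa using this.1 h

lemma newton_aux {x : Kˣ} (h : x ∈ Dval v) (n : ℕ) :
    ∃ s : Kˣ, v (x * s ^ 2 - 1) ≤ v 4 * exp (-(n + 1 : ℤ)) := by
  induction n with
  | zero =>
    obtain ⟨s, hs⟩ := h
    exact ⟨s, by simpa using lt_imp_le_mul_exp hs⟩
  | succ n ih =>
    obtain ⟨s, hs⟩ := ih
    set η : K := x * s ^ 2 - 1 with hη
    have hlt : v η < v 4 := hs.trans_lt (by
      have := v4_pos v
      conv_rhs => rw [← mul_one (v (4 : K))]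
      gcongr
      rw [← exp_zero, exp_lt_exp]; omega)
    have h2 : v (-(η / 2)) < 1 := by
      rw [Valuation.map_neg, map_div₀, div_lt_one₀ (v2_pos v)]
      refine hlt.trans_le ?_
      rw [v4_eq]
      exact mul_le_of_le_one_left' (v2_le v)
    have h3 : (1 - η / 2) ≠ 0 := by
      intro h0
      have := v_one_add v h2
      rw [← sub_eq_add_neg, h0] at this
      simp at this
    refine ⟨s * Units.mk0 _ h3, ?_⟩
    have e : (x : K) * ((s * Units.mk0 _ h3 : Kˣ) : K) ^ 2 - 1 = η * η * (η + -3) / 4 := by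
      push_cast
      rw [Units.val_mk0, mul_pow, ← mul_assoc, show (x : K) * s ^ 2 = 1 + η by rw [hη]; ring]
      ring
    rw [e, map_div₀, map_mul, map_mul, div_le_iff₀ (v4_pos v)]
    have h4 : v (η + -3) ≤ 1 := (v.map_add _ _).trans (by
      rw [Valuation.map_neg]; exact max_le (hlt.le.trans (v4_le v)) (v3_le v))
    calc v η * v η * v (η + -3) ≤ (v 4 * exp (-(n + 1 : ℤ))) * (v 4 * exp (-(n + 1 : ℤ))) * 1 := by
          gcongr
      _ = v 4 * exp (-(n + 1 : ℤ) + -(n + 1 : ℤ)) * v 4 := by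
          rw [exp_add, mul_one]; simp only [mul_comm, mul_left_comm, mul_assoc]
      _ ≤ _ := by
          gcongr
          rw [exp_le_exp]; push_cast; omega

lemma newton {x : Kˣ} (h : x ∈ Dval v) {ε : ℤᵐ⁰} (hε : ε ≠ 0) :
    ∃ s : Kˣ, v (x * s ^ 2 - 1) < ε := by
  obtain ⟨n, hn⟩ := exists_exp_neg_natCast_lt hε
  obtain ⟨s, hs⟩ := newton_aux h n
  refine ⟨s, hs.trans_lt (lt_of_le_of_lt ?_ hn)⟩
  calc v 4 * exp (-(n + 1 : ℤ)) ≤ 1 * exp (-(n : ℤ)) := by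
        gcongr
        · exact v4_le v
        · rw [exp_le_exp]; omega
    _ = _ := by simp

/-- perturbation -/
lemma Dval_of_close {x y : Kˣ} (hy : y ∈ Dval v) (h : v ((x : K) - y) < v 4 * v y) : x ∈ Dval v := by
  have : x = y * (x / y) := by simp
  rw [this]
  refine mul_mem hy (mem_Dval_of_lt ?_)
  have hy0 : 0 < v (y : K) := zero_lt_iff.2 (by simp)
  have : ((x / y : Kˣ) : K) - 1 = (x - y) / y := by push_cast; field_simp
  rw [this, map_div₀, div_lt_iff₀ hy0]; exact h

lemma div_mem_Dval {x y : Kˣ} (h : v ((x : K) - y) < v 4 * v y) : x / y ∈ Dval v := by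
  apply mem_Dval_of_lt
  have hy0 : 0 < v (y : K) := zero_lt_iff.2 (by simp)
  have : ((x / y : Kˣ) : K) - 1 = (x - y) / y := by push_cast; field_simp
  rw [this, map_div₀, div_lt_iff₀ hy0]; exact h

lemma mem_sup_Dval {N D : Subgroup Kˣ} {b : Kˣ} : b ∈ N ⊔ D ↔ ∃ n ∈ N, b / n ∈ D := by
  rw [Subgroup.mem_sup]
  constructor
  · rintro ⟨n, hn, d, hd, rfl⟩; exact ⟨n, hn, by simpa using hd⟩
  · rintro ⟨n, hn, h⟩; exact ⟨n, hn, _, h, by simp⟩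

lemma close_ne_zero {x : K} {y : Kˣ} (h : v (x - y) < v 4 * v y) : x ≠ 0 := by
  rintro rfl
  rw [zero_sub, Valuation.map_neg] at h
  have : v 4 * v (y : K) ≤ v y := mul_le_of_le_one_left' (v4_le v)
  exact absurd (h.trans_le this) (lt_irrefl _)

lemma Dval_symm {a b : Kˣ} (h : b ∈ Nm a ⊔ Dval v) : a ∈ Nm b ⊔ Dval v := by
  obtain ⟨n, ⟨x, y, hn⟩, hd⟩ := mem_sup_Dval.1 h
  have ha0 : v (a : K) ≠ 0 := by simp
  have h40 := v4_ne v
  set d := b / n with hd'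
  have hbn : (b : K) = n * (d : K) := by rw [hd']; push_cast; field_simp
  by_cases hy : y = 0
  · have hb : b ∈ Dval v := by
      have : b = n * d := by simp [hd']
      rw [this]
      refine mul_mem ?_ hd
      have hx : x ≠ 0 := by rintro rfl; apply n.ne_zero; rw [hn, hy]; simp
      have : n = (Units.mk0 x hx) ^ 2 := by ext; simp [hn, hy]
      rw [this]; exact sq_mem_Dval _
    by_cases h1 : (a : K) - 1 = 0
    · have : a = 1 := by ext; simpa using sub_eq_zero.1 h1
      rw [this]; exact one_mem _
    obtain ⟨s, hs⟩ := newton hb (ε := v 4 * v a / v (((a - 1) / 2 : K) ^ 2)) (by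
      simp [h1])
    have hclose : v ((((a + 1) / 2 : K) ^ 2 - b * (s * ((a - 1) / 2)) ^ 2) - a) < v 4 * v a := by
      have : (((a + 1) / 2 : K) ^ 2 - b * (s * ((a - 1) / 2)) ^ 2) - a =
        - ((b * s ^ 2 - 1) * ((a - 1) / 2) ^ 2) := by ring
      rw [this, Valuation.map_neg, map_mul]
      rwa [lt_div_iff₀ (zero_lt_iff.2 (by simp [h1]))] at hs
    have hne := close_ne_zero hclose
    refine mem_sup_Dval.2 ⟨Units.mk0 _ hne, ⟨_, _, rfl⟩, ?_⟩
    rw [← inv_mem_iff, inv_div]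
    exact div_mem_Dval hclose
  · have hdi : d⁻¹ ∈ Dval v := inv_mem hd
    have hy0 : v y ≠ 0 := by simpa using hy
    obtain ⟨s, hs⟩ := newton hd (ε := v 4 * v (a * y ^ 2 / n : K)) (by simp [hy])
    -- d = (1+η)/s^2
    have hX : ((x / y) ^ 2 - b * (s / y) ^ 2 : K) - a
        = - ((d * s ^ 2 - 1) * (n / y ^ 2)) := by
      have h1 : (a : K) = (x / y) ^ 2 - n / y ^ 2 := by
        rw [hn]; field_simp; ring
      rw [h1, hbn]
      field_simp
      ring
    have hclose : v (((x / y) ^ 2 - b * (s / y) ^ 2 : K) - a) < v 4 * v a := by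
      rw [hX, Valuation.map_neg, map_mul]
      have : v 4 * v a = v 4 * v (a * y ^ 2 / n : K) * v (n / y ^ 2 : K) := by
        rw [mul_assoc, ← map_mul v (a * y ^ 2 / n : K)]; congr 2; field_simp
      rw [this]
      have : 0 < v (n / y ^ 2 : K) := zero_lt_iff.2 (by simp [hy])
      gcongr
    have hne := close_ne_zero hclose
    refine mem_sup_Dval.2 ⟨Units.mk0 _ hne, ⟨_, _, rfl⟩, ?_⟩
    rw [← inv_mem_iff, inv_div]
    exact div_mem_Dval hclose

lemma Dval_even {x : Kˣ} (h : x ∈ Dval v) : ∃ s : Kˣ, v (x : K) = v (s : K) ^ 2 := by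
  obtain ⟨s, hs⟩ := h
  refine ⟨s⁻¹, ?_⟩
  have h1 : v ((x : K) * s ^ 2) = 1 := by
    have := v_one_add v (hs.trans_le (v4_le v))
    simpa using this
  rw [map_mul, map_pow] at h1
  rw [Units.val_inv_eq_inv_val, map_inv₀, inv_pow]
  exact eq_inv_of_mul_eq_one_left h1

end loc
end TAD

namespace TAD
open Subgroup WithZero IsDedekindDomain NumberField
open scoped WithZero

section red
variable {K : Type*} [Field K] [NumberField K] (p : HeightOneSpectrum (𝓞 K))

/-- valuation of a finite place -/
noncomputable abbrev vl : Valuation K ℤᵐ⁰ := p.valuation K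

/-- residue field -/
abbrev RF := 𝓞 K ⧸ p.asIdeal

noncomputable instance : Field (RF p) := by
  have := p.isMaximal
  exact Ideal.Quotient.field p.asIdeal

instance : Finite (RF p) := Ideal.finiteQuotientOfFreeOfNeBot _ p.ne_bot

lemma exists_lift {x : K} (h : vl p x ≤ 1) : ∃ r : 𝓞 K, vl p (x - (r : K)) < 1 := by
  obtain ⟨r, hr⟩ := p.exists_valuation_sub_lt_of_integer h (γ := 1)
  exact ⟨r, by rw [Valuation.map_sub_swap]; simpa using hr⟩

open Classical in
/-- reduction -/
noncomputable def red (x : K) : RF p :=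
  if h : vl p x ≤ 1 then Ideal.Quotient.mk _ (exists_lift p h).choose else 0

variable {p}
lemma red_eq_of_close {x : K} {r : 𝓞 K} (hr : vl p (x - (r : K)) < 1) :
    red p x = Ideal.Quotient.mk _ r := by
  have h : vl p x ≤ 1 := by
    have : x = (x - r) + r := by ring
    rw [this]
    exact ((vl p).map_add _ _).trans (max_le hr.le (p.valuation_le_one r))
  rw [red, dif_pos h, Ideal.Quotient.eq, ← p.valuation_lt_one_iff_mem (K := K)]
  have h2 := (exists_lift p h).choose_spec
  set r' := (exists_lift p h).choose
  have : ((r' - r : 𝓞 K) : K) = (x - r) - (x - r') := by push_cast; ring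
  refine lt_of_eq_of_lt (congrArg (vl p) this) ?_
  exact (Valuation.map_sub _ _ _).trans_lt (max_lt hr h2)

lemma red_coe (r : 𝓞 K) : red p (r : K) = Ideal.Quotient.mk _ r :=
  red_eq_of_close (by simp)

lemma red_zero : red p (0 : K) = 0 := by simpa using red_coe (p := p) 0
lemma red_one : red p (1 : K) = 1 := by simpa using red_coe (p := p) 1

lemma red_add {x y : K} (hx : vl p x ≤ 1) (hy : vl p y ≤ 1) : red p (x + y) = red p x + red p y := by
  obtain ⟨r, hr⟩ := exists_lift p hx
  obtain ⟨s, hs⟩ := exists_lift p hy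
  rw [red_eq_of_close hr, red_eq_of_close hs, ← map_add]
  apply red_eq_of_close
  have : x + y - ((r + s : 𝓞 K) : K) = (x - r) + (y - s) := by push_cast; ring
  rw [this]
  exact (vl p).map_add_lt hr hs

lemma red_mul {x y : K} (hx : vl p x ≤ 1) (hy : vl p y ≤ 1) : red p (x * y) = red p x * red p y := by
  obtain ⟨r, hr⟩ := exists_lift p hx
  obtain ⟨s, hs⟩ := exists_lift p hy
  rw [red_eq_of_close hr, red_eq_of_close hs, ← map_mul]
  apply red_eq_of_close
  have : x * y - ((r * s : 𝓞 K) : K) = (x - r) * y + r * (y - s) := by push_cast; ring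
  rw [this]
  refine (vl p).map_add_lt ?_ ?_
  · rw [map_mul]; exact mul_lt_one_of_nonneg_of_lt_one_left zero_le hr hy
  · rw [map_mul]; exact mul_lt_one_of_nonneg_of_lt_one_right (p.valuation_le_one r) zero_le hs

lemma red_neg {x : K} (hx : vl p x ≤ 1) : red p (-x) = - red p x := by
  have := red_add hx (y := -x) (by rwa [Valuation.map_neg])
  rw [add_neg_cancel, red_zero] at this
  exact (neg_eq_of_add_eq_zero_right this.symm).symm

lemma red_sub {x y : K} (hx : vl p x ≤ 1) (hy : vl p y ≤ 1) : red p (x - y) = red p x - red p y := by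
  rw [sub_eq_add_neg, red_add hx (by rwa [Valuation.map_neg]), red_neg hy, sub_eq_add_neg]

lemma red_sq {x : K} (hx : vl p x ≤ 1) : red p (x ^ 2) = red p x ^ 2 := by
  rw [sq, sq, red_mul hx hx]

lemma red_eq_zero {x : K} (hx : vl p x ≤ 1) : red p x = 0 ↔ vl p x < 1 := by
  constructor
  · intro h
    obtain ⟨r, hr⟩ := exists_lift p hx
    rw [red_eq_of_close hr, Ideal.Quotient.eq_zero_iff_mem, ← p.valuation_lt_one_iff_mem (K := K)] at h
    have : x = (x - r) + r := by ring
    rw [this]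
    exact (vl p).map_add_lt hr h
  · intro h
    rw [red_eq_of_close (r := 0) (by simpa using h)]; simp

lemma red_ne_zero {x : K} (hx : vl p x = 1) : red p x ≠ 0 := by
  rw [Ne, red_eq_zero hx.le, hx]; exact lt_irrefl _

lemma vl_eq_one_of_red {x : K} (hx : vl p x ≤ 1) (h : red p x ≠ 0) : vl p x = 1 := by
  rw [Ne, red_eq_zero hx, not_lt] at h
  exact le_antisymm hx h

lemma red_eq_iff {x y : K} (hx : vl p x ≤ 1) (hy : vl p y ≤ 1) :
    red p x = red p y ↔ vl p (x - y) < 1 := by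
  rw [← red_eq_zero ((Valuation.map_sub _ _ _).trans (max_le hx hy)), red_sub hx hy, sub_eq_zero]

variable (p) in
lemma red_surj (z : RF p) : ∃ x : K, vl p x ≤ 1 ∧ red p x = z := by
  obtain ⟨r, rfl⟩ := Ideal.Quotient.mk_surjective z
  exact ⟨r, p.valuation_le_one r, red_coe r⟩

variable (p)
lemma exists_rho : ∃ ρ : K, vl p ρ ≤ 1 ∧ ∀ x, vl p x ≤ 1 → vl p (x ^ 2 + x + ρ) = 1 := by
  have hns : ¬ Function.Surjective (fun z : RF p => z ^ 2 + z) := by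
    intro hs
    have := Finite.injective_iff_surjective.2 hs
    have h01 : (0 : RF p) = -1 := this (by simp)
    exact one_ne_zero (neg_eq_zero.1 h01.symm)
  simp only [Function.Surjective, not_forall, not_exists] at hns
  obtain ⟨z, hz⟩ := hns
  obtain ⟨r, hr, hrz⟩ := red_surj p (-z)
  refine ⟨r, hr, fun x hx => ?_⟩
  have hx2 : vl p (x ^ 2) ≤ 1 := by rw [map_pow]; exact pow_le_one' hx 2
  have hxx : vl p (x ^ 2 + x) ≤ 1 := ((vl p).map_add _ _).trans (max_le hx2 hx)
  apply vl_eq_one_of_red (((vl p).map_add _ _).trans (max_le hxx hr))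
  rw [red_add hxx hr, red_add hx2 hx, red_sq hx, hrz, ← sub_eq_add_neg, Ne, sub_eq_zero]
  exact hz _

lemma exists_unif : ∃ π : Kˣ, vl p (π : K) = exp (-1 : ℤ) := by
  obtain ⟨π, h⟩ := p.valuation_exists_uniformizer K
  refine ⟨Units.mk0 π ?_, h⟩
  rintro rfl
  rw [map_zero] at h
  exact exp_ne_zero h.symm

/-- anisotropic quadratic has even valuation -/
lemma even_of_rho {ρ : K} (hρ : vl p ρ ≤ 1) (h : ∀ x, vl p x ≤ 1 → vl p (x ^ 2 + x + ρ) = 1) (X Y : K) :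
    vl p (X ^ 2 + X * Y + ρ * Y ^ 2) = max (vl p X) (vl p Y) ^ 2 := by
  by_cases hY : Y = 0
  · simp [hY]
  have hY0 : 0 < vl p Y := zero_lt_iff.2 (by simpa using hY)
  rcases le_or_gt (vl p X) (vl p Y) with hle | hlt
  · rw [max_eq_right hle]
    have : X ^ 2 + X * Y + ρ * Y ^ 2 = ((X / Y) ^ 2 + X / Y + ρ) * Y ^ 2 := by field_simp
    rw [this, map_mul, h, one_mul, map_pow]
    rw [map_div₀]; exact div_le_one_of_le₀ hle hY0.le
  · rw [max_eq_left hlt.le, add_assoc, Valuation.map_add_eq_of_lt_left, map_pow]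
    have hX0 : 0 < vl p X := hY0.trans hlt
    rw [map_pow]
    refine (vl p).map_add_lt ?_ ?_
    · rw [map_mul, sq]; gcongr
    · rw [map_mul, map_pow]
      calc _ ≤ 1 * vl p Y ^ 2 := by gcongr
        _ < vl p X ^ 2 := by rw [one_mul]; exact pow_lt_pow_left₀ hlt zero_le two_ne_zero

/-- `Even valuation` predicate -/
def EvenV (x : Kˣ) : Prop := ∃ s : Kˣ, vl p (x : K) = vl p (s : K) ^ 2

lemma even_of_delta {a b : Kˣ} {ρ : K} (hρ : vl p ρ ≤ 1)
    (h : ∀ x, vl p x ≤ 1 → vl p (x ^ 2 + x + ρ) = 1) (ha : (a : K) = 1 - 4 * ρ)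
    (hb : b ∈ Nm a ⊔ Dval (vl p)) : EvenV p b := by
  obtain ⟨n, ⟨x, y, hn⟩, hd⟩ := mem_sup_Dval.1 hb
  obtain ⟨s, hs⟩ := Dval_even hd
  have hn' : (n : K) = 2 ^ 2 * (((x - y) / 2) ^ 2 + ((x - y) / 2) * y + ρ * y ^ 2) := by
    rw [hn, ha]; ring
  have hv : vl p (n : K) = (vl p 2 * max (vl p ((x - y) / 2)) (vl p y)) ^ 2 := by
    rw [hn', map_mul, even_of_rho p hρ h, mul_pow, map_pow]
  have hbn : (b : K) = ((b / n : Kˣ) : K) * n := by push_cast; field_simp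
  have hn0 : vl p (n : K) ≠ 0 := by simp
  rcases max_choice (vl p ((x - y) / 2)) (vl p y) with hm | hm <;> rw [hm] at hv
  · have h0 : 2 * ((x - y) / 2) ≠ 0 := by
      intro h0; rw [← map_mul, h0] at hv; simp at hv
    refine ⟨s * Units.mk0 _ h0, ?_⟩
    rw [hbn, map_mul, hs, hv]; simp [mul_pow]
  · have h0 : 2 * y ≠ 0 := by
      intro h0; rw [← map_mul, h0] at hv; simp at hv
    refine ⟨s * Units.mk0 _ h0, ?_⟩
    rw [hbn, map_mul, hs, hv]; simp [mul_pow]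

lemma not_even_exp {x : Kˣ} {k : ℤ} (h : vl p (x : K) = exp k) (hk : Odd k) : ¬ EvenV p x := by
  rintro ⟨s, hs⟩
  have h0 : vl p (s : K) ≠ 0 := by simp
  rw [h, ← exp_log h0, ← exp_nsmul, exp_inj] at hs
  rw [hs] at hk
  simp only [nsmul_eq_mul, Nat.cast_ofNat] at hk
  exact (Int.not_even_iff_odd.2 hk) (even_two_mul _)

lemma even_or (x : Kˣ) : EvenV p x ∨ ∃ k : ℤ, Odd k ∧ vl p (x : K) = exp k := by
  have h0 : vl p (x : K) ≠ 0 := by simp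
  rcases Int.even_or_odd (log (vl p (x : K))) with h | h
  · left
    obtain ⟨k, hk⟩ := h
    obtain ⟨π, hπ⟩ := exists_unif p
    refine ⟨π ^ (-k), ?_⟩
    rw [← exp_log h0, hk, Units.val_zpow_eq_zpow_val, map_zpow₀, hπ, ← exp_zsmul, ← exp_nsmul, exp_inj]
    simp; ring
  · exact Or.inr ⟨_, h, (exp_log h0).symm⟩

lemma EvenV.mul {x y : Kˣ} (hx : EvenV p x) (hy : EvenV p y) : EvenV p (x * y) := by
  obtain ⟨s, hs⟩ := hx; obtain ⟨t, ht⟩ := hy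
  exact ⟨s * t, by push_cast; rw [map_mul, map_mul, hs, ht, mul_pow]⟩

lemma EvenV.inv {x : Kˣ} (hx : EvenV p x) : EvenV p x⁻¹ := by
  obtain ⟨s, hs⟩ := hx
  exact ⟨s⁻¹, by push_cast; rw [map_inv₀, map_inv₀, hs, inv_pow]⟩

end red
end TAD

namespace TAD
open Subgroup WithZero IsDedekindDomain NumberField
open scoped WithZero

section nondeg
variable {K : Type*} [Field K] [NumberField K] (p : HeightOneSpectrum (𝓞 K))

/-- local norm group -/
noncomputable abbrev NLf (a : Kˣ) : Subgroup Kˣ := Nm a ⊔ Dval (vl p)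

variable {p}
lemma vl_ne (x : Kˣ) : vl p (x : K) ≠ 0 := by simp
lemma vl_pos (x : Kˣ) : 0 < vl p (x : K) := zero_lt_iff.2 (vl_ne x)

lemma scale_mem_D (a s : Kˣ) : a * s ^ 2 ∈ Dval (vl p) ↔ a ∈ Dval (vl p) :=
  Subgroup.mul_mem_cancel_right _ (sq_mem_Dval s)

lemma EvenV.scale {a : Kˣ} (h : EvenV p a) : ∃ s : Kˣ, vl p ((a * s ^ 2 : Kˣ) : K) = 1 := by
  obtain ⟨s, hs⟩ := h
  refine ⟨s⁻¹, ?_⟩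
  push_cast
  rw [map_mul, hs, map_pow, map_inv₀, inv_pow]
  exact mul_inv_cancel₀ (by simp)

lemma delta_of_notMem {a : Kˣ} (ha : vl p (a : K) = 1) (h : vl p ((a : K) - 1) ≤ vl p 4)
    (hD : a ∉ Dval (vl p)) :
    vl p ((1 - a) / 4 : K) ≤ 1 ∧ ∀ x, vl p x ≤ 1 → vl p (x ^ 2 + x + (1 - a) / 4) = 1 := by
  have h1 : vl p ((1 - a) / 4 : K) ≤ 1 := by
    rw [map_div₀, Valuation.map_sub_swap]; exact div_le_one_of_le₀ h zero_le
  refine ⟨h1, fun x hx => ?_⟩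
  have hx2 : vl p (x ^ 2) ≤ 1 := by rw [map_pow]; exact pow_le_one' hx 2
  have hxx : vl p (x ^ 2 + x) ≤ 1 := ((vl p).map_add _ _).trans (max_le hx2 hx)
  by_contra hne
  have hlt : vl p (x ^ 2 + x + (1 - a) / 4) < 1 :=
    lt_of_le_of_ne (((vl p).map_add _ _).trans (max_le hxx h1)) hne
  have e : (1 + 2 * x) ^ 2 - (a : K) = 4 * (x ^ 2 + x + (1 - a) / 4) := by ring
  have hc : vl p ((1 + 2 * x) ^ 2 - (a : K)) < vl p 4 * vl p (a : K) := by
    rw [e, map_mul, ha]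
    have := v4_pos (vl p)
    gcongr
  have hne0 := close_ne_zero hc
  have h0 : (1 + 2 * x) ≠ 0 := by intro h0; rw [h0] at hne0; simp at hne0
  have := div_mem_Dval (x := (Units.mk0 _ h0) ^ 2) (y := a) (by simpa using hc)
  rw [div_eq_mul_inv, Subgroup.mul_mem_cancel_left _ (sq_mem_Dval _), inv_mem_iff] at this
  exact hD this

lemma Delta_unit {ρ : K} (hρ : vl p ρ ≤ 1)
    (h : ∀ x, vl p x ≤ 1 → vl p (x ^ 2 + x + ρ) = 1) : vl p (1 - 4 * ρ) = 1 := by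
  have h1 := even_of_rho p hρ h (-1) 2
  have : (-1 : K) ^ 2 + -1 * 2 + ρ * 2 ^ 2 = -(1 - 4 * ρ) := by ring
  rw [this, Valuation.map_neg] at h1
  rw [h1, Valuation.map_neg, map_one, max_eq_left (v2_le _)]; simp

lemma NL_even_of_unit {a : Kˣ} (ha : vl p (a : K) = 1) (h : vl p ((a : K) - 1) ≤ vl p 4)
    (hD : a ∉ Dval (vl p)) {b : Kˣ} (hb : b ∈ NLf p a) : EvenV p b := by
  obtain ⟨h1, h2⟩ := delta_of_notMem ha h hD
  exact even_of_delta p h1 h2 (by field_simp; ring) hb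

lemma unif_not_even {π : Kˣ} (hπ : vl p (π : K) = exp (-1 : ℤ)) : ¬ EvenV p π :=
  not_even_exp p hπ ⟨-1, by norm_num⟩

lemma L6_odd {a : Kˣ} (ha : ¬ EvenV p a) : ∃ b : Kˣ, b ∉ NLf p a := by
  obtain ⟨ρ, hρ, h⟩ := exists_rho p
  have hΔ := Delta_unit hρ h
  have h0 : 1 - 4 * ρ ≠ 0 := by intro h0; rw [h0] at hΔ; simp at hΔ
  refine ⟨Units.mk0 _ h0, fun hb => ha ?_⟩
  exact even_of_delta p hρ h (Units.val_mk0 h0) (Dval_symm hb)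

lemma L6_mid {a : Kˣ} (ha : vl p (a : K) = 1) (h4 : vl p 4 < vl p ((a : K) - 1)) {k : ℤ} (hk : Odd k)
    (hα : vl p ((a : K) - 1) = exp k) : ∃ b : Kˣ, b ∉ NLf p a := by
  obtain ⟨ρ, hρ, h⟩ := exists_rho p
  have hΔ := Delta_unit hρ h
  have h0 : 1 - 4 * ρ ≠ 0 := by intro h0; rw [h0] at hΔ; simp at hΔ
  set α : K := a - 1 with hαd
  have hvB : vl p (-α + -(4 * ρ)) = exp k := by
    rw [Valuation.map_add_eq_of_lt_left, Valuation.map_neg, hα]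
    rw [Valuation.map_neg, Valuation.map_neg, map_mul]
    exact lt_of_le_of_lt (mul_le_of_le_one_right' hρ) h4
  have hB0 : -α + -(4 * ρ) ≠ 0 := by
    intro h0; rw [h0, map_zero] at hvB; exact exp_ne_zero hvB.symm
  set B : Kˣ := Units.mk0 _ hB0 with hB
  have hBo : ¬ EvenV p B := not_even_exp p hvB hk
  refine ⟨B, fun hmem => ?_⟩
  obtain ⟨n, ⟨x, y, hn⟩, hd⟩ := mem_sup_Dval.1 hmem
  have hx : x ≠ 0 := by
    rintro rfl
    have hn' : (n : K) = - (a * y ^ 2) := by rw [hn]; ring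
    have hy : y ≠ 0 := by rintro rfl; apply n.ne_zero; rw [hn]; simp
    apply hBo
    have h1 : EvenV p n := ⟨Units.mk0 y hy, by rw [hn', Valuation.map_neg, map_mul, ha, one_mul, map_pow]; rfl⟩
    have h2 : EvenV p (B / n) := Dval_even hd
    have := h2.mul p h1
    rwa [div_mul_cancel] at this
  obtain ⟨s, hs⟩ := newton hd (ε := vl p 4 * vl p (x ^ 2 / n)) (by simp [hx])
  have hBv : (B : K) = ((B / n : Kˣ) : K) * n := by push_cast; field_simp
  have e : (a * y ^ 2 + B * s ^ 2 : K) - ((Units.mk0 x hx ^ 2 : Kˣ) : K) =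
      (((B / n : Kˣ) : K) * s ^ 2 - 1) * n := by
    push_cast
    rw [Units.val_mk0 hx, sub_mul, mul_right_comm, div_mul_cancel₀ _ n.ne_zero, hn]; ring
  have hc : vl p ((a * y ^ 2 + B * s ^ 2 : K) - ((Units.mk0 x hx ^ 2 : Kˣ) : K)) <
      vl p 4 * vl p ((Units.mk0 x hx ^ 2 : Kˣ) : K) := by
    rw [e, map_mul, ← lt_div_iff₀ (vl_pos n), mul_div_assoc, ← map_div₀]
    simpa using hs
  have hE0 := close_ne_zero hc
  have hED : Units.mk0 _ hE0 ∈ Dval (vl p) := Dval_of_close (sq_mem_Dval (Units.mk0 x hx)) hc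
  set E := Units.mk0 _ hE0
  set Δ := Units.mk0 _ h0 with hΔd
  have hΔE : Δ * E ∈ Nm (-(a * B)) := by
    refine ⟨a * y + B * s, y - s, ?_⟩
    have : (Δ : K) = a + B := by rw [hΔd, hB, Units.val_mk0, Units.val_mk0, hαd]; ring
    rw [Units.val_mul, this, Units.val_mk0 hE0]
    push_cast
    ring
  have h3 : Δ ∈ NLf p (-(a * B)) := by
    have : Δ = (Δ * E) * E⁻¹ := by simp
    rw [this]
    exact mul_mem (Subgroup.mem_sup_left hΔE) (Subgroup.mem_sup_right (inv_mem hED))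
  have h4 := even_of_delta p hρ h (Units.val_mk0 h0) (Dval_symm h3)
  refine not_even_exp p ?_ hk h4
  push_cast
  rw [Valuation.map_neg, map_mul, ha, one_mul]
  exact hvB

/-- perfectness -/
lemma exists_sqrt_mod (h2 : vl p 2 < 1) {u : K} (hu : vl p u = 1) :
    ∃ t : K, vl p t = 1 ∧ vl p (u - t ^ 2) < 1 := by
  have : Fintype (RF p) := Fintype.ofFinite _
  have h20 : (2 : RF p) = 0 := by
    have : red p 2 = 0 := (red_eq_zero h2.le).2 h2
    have h1 : red p (1 + 1) = 1 + 1 := by rw [red_add (by simp) (by simp), red_one]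
    rw [← one_add_one_eq_two, ← h1, one_add_one_eq_two, this]
  have : CharP (RF p) 2 := CharTwo.of_one_ne_zero_of_two_eq_zero one_ne_zero h20
  obtain ⟨z, hz⟩ := FiniteField.isSquare_of_char_two (ringChar.eq_iff.2 this) (red p u)
  obtain ⟨t, ht, rfl⟩ := red_surj p z
  have hrt : red p t ≠ 0 := by
    intro h; rw [h, mul_zero] at hz; exact red_ne_zero hu hz
  refine ⟨t, vl_eq_one_of_red ht hrt, ?_⟩
  rw [← red_eq_iff hu.le (by rw [map_pow]; exact pow_le_one' ht 2), red_sq ht, hz, sq]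

lemma L6_unit (n : ℕ) : ∀ a : Kˣ, vl p (a : K) = 1 → a ∉ Dval (vl p) →
    vl p ((a : K) - 1) ≤ vl p 4 * exp (n : ℤ) → ∃ b : Kˣ, b ∉ NLf p a := by
  induction n with
  | zero =>
    intro a ha hD h
    obtain ⟨π, hπ⟩ := exists_unif p
    exact ⟨π, fun hb => unif_not_even hπ (NL_even_of_unit ha (by simpa using h) hD hb)⟩
  | succ n ih =>
    intro a ha hD h
    rcases le_or_gt (vl p ((a : K) - 1)) (vl p 4) with hle | hlt
    · obtain ⟨π, hπ⟩ := exists_unif p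
      exact ⟨π, fun hb => unif_not_even hπ (NL_even_of_unit ha hle hD hb)⟩
    have h10 : (a : K) - 1 ≠ 0 := by
      intro h0; rw [h0, map_zero] at hlt; exact absurd hlt not_lt_zero
    rcases even_or p (Units.mk0 _ h10) with he | ⟨k, hk, hk'⟩
    swap
    · exact L6_mid ha hlt hk hk'
    -- improvement
    suffices ∃ s : Kˣ, vl p ((a * s ^ 2 : Kˣ) : K) = 1 ∧ vl p (((a * s ^ 2 : Kˣ) : K) - 1) < vl p ((a : K) - 1) by
      obtain ⟨s, hs1, hs2⟩ := this
      have := ih (a * s ^ 2) hs1 (by rwa [scale_mem_D]) (by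
        have := lt_imp_le_mul_exp (hs2.trans_le h)
        refine this.trans (le_of_eq ?_)
        rw [mul_assoc, ← exp_add]; congr 2; push_cast; ring)
      rwa [NLf, Nm_mul_sq] at this
    have ha1 : vl p ((a : K) - 1) ≤ 1 := (Valuation.map_sub _ _ _).trans (by simp [ha])
    have h2 : vl p 2 < 1 := by
      by_contra h2
      have h2 : vl p 2 = 1 := le_antisymm (v2_le _) (not_lt.1 h2)
      rw [v4_eq, h2, mul_one] at hlt
      exact absurd ha1 (not_le.2 hlt)
    have gen : ∀ y : Kˣ, vl p (y : K) = 1 → vl p ((a : K) - y ^ 2) < vl p ((a : K) - 1) →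
        ∃ s : Kˣ, vl p ((a * s ^ 2 : Kˣ) : K) = 1 ∧ vl p (((a * s ^ 2 : Kˣ) : K) - 1) < vl p ((a : K) - 1) := by
      intro y hy h
      refine ⟨y⁻¹, by push_cast; rw [map_mul, map_pow, map_inv₀, ha, hy]; simp, ?_⟩
      have : ((a * y⁻¹ ^ 2 : Kˣ) : K) - 1 = (a - y ^ 2) / y ^ 2 := by push_cast; field_simp
      rw [this, map_div₀, map_pow, hy]; simpa using h
    rcases ha1.lt_or_eq with hlt1 | heq1
    · obtain ⟨c, hc⟩ := he
      rw [Units.val_mk0] at hc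
      obtain ⟨t, ht, htu⟩ := exists_sqrt_mod h2 (u := ((a : K) - 1) / c ^ 2) (by
        rw [map_div₀, map_pow, hc, div_self]; simp)
      have hτ : vl p (c * t) ^ 2 = vl p ((a : K) - 1) := by rw [map_mul, ht, mul_one, hc]
      have hτ1 : vl p (c * t) < 1 := by
        by_contra hh
        rw [← hτ] at hlt1
        exact absurd hlt1 (not_lt.2 (one_le_pow₀ (not_lt.1 hh)))
      have hy := v_one_add _ hτ1
      have hy0 : 1 + c * t ≠ 0 := by intro h0; rw [h0] at hy; simp at hy
      refine gen (Units.mk0 _ hy0) hy ?_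
      rw [Units.val_mk0]
      have : (a : K) - (1 + c * t) ^ 2 = (((a : K) - 1) / c ^ 2 - t ^ 2) * c ^ 2 + -(2 * (c * t)) := by
        field_simp; ring
      rw [this]
      refine (vl p).map_add_lt ?_ ?_
      · rw [map_mul, map_pow, ← hc]
        have : 0 < vl p ((a : K) - 1) := zero_lt_iff.2 (by simpa using h10)
        exact mul_lt_of_lt_one_left this htu
      · rw [Valuation.map_neg, map_mul, ← hτ, sq]
        have h5 : 0 < vl p (c * t) := by
          rw [map_mul, ht, mul_one]; exact vl_pos c
        gcongr
        rw [← hτ, v4_eq, ← sq] at hlt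
        exact lt_of_pow_lt_pow_left₀ 2 zero_le hlt
    · obtain ⟨t, ht, htu⟩ := exists_sqrt_mod h2 ha
      have hy0 : t ≠ 0 := by intro h0; rw [h0] at ht; simp at ht
      exact gen (Units.mk0 _ hy0) ht (by rw [heq1]; exact htu)

lemma L6 {a : Kˣ} (hD : a ∉ Dval (vl p)) : ∃ b : Kˣ, b ∉ NLf p a := by
  by_cases he : EvenV p a
  · obtain ⟨s, hs⟩ := he.scale
    have h1 : vl p (((a * s ^ 2 : Kˣ) : K) - 1) ≤ 1 := (Valuation.map_sub _ _ _).trans (by rw [hs]; simp)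
    obtain ⟨n, hn⟩ := exists_exp_neg_natCast_lt (v4_ne (vl p))
    have := L6_unit n (a * s ^ 2) hs (by rwa [scale_mem_D]) (h1.trans (by
      have : (1 : ℤᵐ⁰) = exp (-n : ℤ) * exp (n : ℤ) := by rw [← exp_add]; simp
      rw [this]
      gcongr))
    rwa [NLf, Nm_mul_sq] at this
  · exact L6_odd he

/-- L7 -/
lemma L7 (h2 : vl p 2 = 1) {a b : Kˣ} (hD : a ∉ Dval (vl p)) (he : EvenV p a) (hb : b ∈ NLf p a) :
    EvenV p b := by
  obtain ⟨s, hs⟩ := he.scale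
  rw [NLf, ← Nm_mul_sq a s] at hb
  refine NL_even_of_unit hs ?_ (by rwa [scale_mem_D]) hb
  rw [v4_eq, h2, mul_one]
  exact (Valuation.map_sub _ _ _).trans (by rw [hs]; simp)

lemma odd_card (h2 : vl p 2 = 1) : ringChar (RF p) ≠ 2 := by
  intro h
  have := ringChar.eq_iff.1 h
  have h20 : (2 : RF p) = 0 := CharTwo.two_eq_zero
  have h1 : red p (1 + 1) = 1 + 1 := by rw [red_add (by simp) (by simp), red_one]
  rw [one_add_one_eq_two, one_add_one_eq_two, h20] at h1
  exact red_ne_zero h2 h1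

lemma mem_D_of_red_sq (h2 : vl p 2 = 1) {a : Kˣ} (ha : vl p (a : K) = 1) (hs : IsSquare (red p (a : K))) :
    a ∈ Dval (vl p) := by
  obtain ⟨z, hz⟩ := hs
  obtain ⟨t, ht, rfl⟩ := red_surj p z
  have hrt : red p t ≠ 0 := by
    intro h; rw [h, mul_zero] at hz; exact red_ne_zero ha hz
  have ht1 := vl_eq_one_of_red ht hrt
  have ht0 : t ≠ 0 := by intro h0; rw [h0] at ht1; simp at ht1
  refine Dval_of_close (sq_mem_Dval (Units.mk0 t ht0)) ?_
  push_cast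
  rw [Units.val_mk0, v4_eq, h2, map_pow, ht1, one_pow, mul_one, mul_one,
    ← red_eq_iff ha.le (by rw [map_pow]; exact pow_le_one' ht 2), red_sq ht, hz, sq]

lemma odd_units (h2 : vl p 2 = 1) {a b : Kˣ} (ha : vl p (a : K) = 1) (hb : vl p (b : K) = 1)
    (hDa : a ∉ Dval (vl p)) (hDb : b ∉ Dval (vl p)) : a * b ∈ Dval (vl p) := by
  classical
  have : Fintype (RF p) := Fintype.ofFinite _
  apply mem_D_of_red_sq h2 (by push_cast; rw [map_mul, ha, hb, one_mul])
  push_cast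
  rw [red_mul ha.le hb.le]
  have hc := odd_card h2
  have h1 := (quadraticChar_neg_one_iff_not_isSquare (F := RF p)).2 (mt (mem_D_of_red_sq h2 ha) hDa)
  have h3 := (quadraticChar_neg_one_iff_not_isSquare (F := RF p)).2 (mt (mem_D_of_red_sq h2 hb) hDb)
  rw [← quadraticChar_one_iff_isSquare (mul_ne_zero (red_ne_zero ha) (red_ne_zero hb)), map_mul, h1, h3]
  norm_num

/-- L8 -/
lemma L8 (h2 : vl p 2 = 1) {a b : Kˣ} (ha : vl p (a : K) = 1) (hb : vl p (b : K) = 1) : b ∈ NLf p a := by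
  classical
  have : Fintype (RF p) := Fintype.ofFinite _
  have hc := FiniteField.odd_card_of_char_ne_two (odd_card h2)
  obtain ⟨z, w, hzw⟩ := FiniteField.exists_root_sum_quadratic
    (f := Polynomial.X ^ 2 - Polynomial.C (red p (b : K))) (g := Polynomial.C (-red p (a : K)) * Polynomial.X ^ 2)
    (Polynomial.degree_X_pow_sub_C two_pos _)
    (Polynomial.degree_C_mul_X_pow 2 (neg_ne_zero.2 (red_ne_zero ha))) hc
  simp only [Polynomial.eval_sub, Polynomial.eval_pow, Polynomial.eval_X, Polynomial.eval_C,
    Polynomial.eval_mul] at hzw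
  obtain ⟨x, hx, rfl⟩ := red_surj p z
  obtain ⟨y, hy, rfl⟩ := red_surj p w
  have hx2 : vl p (x ^ 2) ≤ 1 := by rw [map_pow]; exact pow_le_one' hx 2
  have hy2 : vl p (y ^ 2) ≤ 1 := by rw [map_pow]; exact pow_le_one' hy 2
  have hay : vl p (a * y ^ 2) ≤ 1 := by rw [map_mul, ha, one_mul]; exact hy2
  have hn : vl p (x ^ 2 - a * y ^ 2) ≤ 1 := (Valuation.map_sub _ _ _).trans (max_le hx2 hay)
  have hlt : vl p ((x ^ 2 - a * y ^ 2) - (b : K)) < vl p 4 * vl p b := by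
    rw [v4_eq, h2, hb, mul_one, mul_one, ← red_eq_iff hn hb.le, red_sub hx2 hay, red_mul ha.le hy2,
      red_sq hx, red_sq hy]
    linear_combination hzw
  have hne := close_ne_zero hlt
  refine mem_sup_Dval.2 ⟨Units.mk0 _ hne, ⟨_, _, rfl⟩, ?_⟩
  rw [← inv_mem_iff, inv_div]
  exact div_mem_Dval hlt

end nondeg
end TAD

namespace TAD
open Subgroup WithZero IsDedekindDomain NumberField
open scoped WithZero

section idx
variable {K : Type*} [Field K] [NumberField K] {p : HeightOneSpectrum (𝓞 K)}

lemma index_range_sq {G : Type*} [CommGroup G] [Finite G] :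
    (powMonoidHom 2 : G →* G).range.index = Nat.card (powMonoidHom 2 : G →* G).ker := by
  have h1 := (powMonoidHom 2 : G →* G).range.card_mul_index
  have h2 := (powMonoidHom 2 : G →* G).ker.card_mul_index
  rw [Subgroup.index_ker, mul_comm] at h2
  have : 0 < Nat.card (powMonoidHom 2 : G →* G).range := Nat.card_pos
  exact Nat.eq_of_mul_eq_mul_left this (h1.trans h2.symm)

lemma mem_pow_iff (r : 𝓞 K) (n : ℕ) : r ∈ p.asIdeal ^ n ↔ vl p (r : K) ≤ exp (-(n : ℤ)) := by
  rw [← p.intValuation_le_pow_iff_mem, ← p.valuation_of_algebraMap (K := K)]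

variable (e : ℕ)

instance finQ (n : ℕ) : Finite (𝓞 K ⧸ p.asIdeal ^ n) :=
  Ideal.finiteQuotientOfFreeOfNeBot _ (pow_ne_zero _ p.ne_bot)

lemma unit_out {n : ℕ} (hn : n ≠ 0) (u : (𝓞 K ⧸ p.asIdeal ^ n)ˣ) {r : 𝓞 K}
    (hr : Ideal.Quotient.mk _ r = (u : 𝓞 K ⧸ p.asIdeal ^ n)) : vl p (r : K) = 1 := by
  refine le_antisymm (p.valuation_le_one r) (not_lt.1 fun h => ?_)
  have h1 : r ∈ p.asIdeal := (p.valuation_lt_one_iff_mem (K := K) r).1 h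
  have h2 := u.isUnit.map (Ideal.Quotient.factor (Ideal.pow_le_self hn : p.asIdeal ^ n ≤ p.asIdeal))
  rw [← hr, Ideal.Quotient.factor_mk, Ideal.Quotient.eq_zero_iff_mem.2 h1] at h2
  have := p.isPrime.ne_top
  exact not_isUnit_zero (M₀ := RF p) h2

lemma card_ker_sq (he : vl p (2 : K) = exp (-(e : ℤ))) :
    Nat.card (powMonoidHom 2 : (𝓞 K ⧸ p.asIdeal ^ (2 * e + 1))ˣ →* _).ker ≤
      2 * (Ideal.absNorm p.asIdeal) ^ e := by
  set n := 2 * e + 1 with hn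
  let φ : 𝓞 K ⧸ p.asIdeal ^ n →+* 𝓞 K ⧸ p.asIdeal ^ (e + 1) :=
    Ideal.Quotient.factor (Ideal.pow_le_pow_right (by omega))
  let J : AddSubgroup (𝓞 K ⧸ p.asIdeal ^ n) := φ.toAddMonoidHom.ker
  have hφ : Function.Surjective φ := Ideal.Quotient.factor_surjective _
  have hJ : Nat.card J = (Ideal.absNorm p.asIdeal) ^ e := by
    have h1 := J.card_mul_index
    rw [AddSubgroup.index_ker, show φ.toAddMonoidHom.range = ⊤ from AddMonoidHom.range_eq_top_of_surjective φ.toAddMonoidHom hφ, AddSubgroup.card_top] at h1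
    change Nat.card J * Nat.card (𝓞 K ⧸ p.asIdeal ^ (e + 1)) = Nat.card (𝓞 K ⧸ p.asIdeal ^ n) at h1
    have c : ∀ m, Nat.card (𝓞 K ⧸ p.asIdeal ^ m) = (Ideal.absNorm p.asIdeal) ^ m := fun m => by
      rw [← map_pow]; rfl
    rw [c, c] at h1
    have hpos : 0 < Ideal.absNorm p.asIdeal := Nat.pos_of_ne_zero (by
      rw [Ne, Ideal.absNorm_eq_zero_iff]; exact p.ne_bot)
    have : n = e + (e + 1) := by omega
    have h2 : ∀ m, m = e + (e + 1) → (Ideal.absNorm p.asIdeal) ^ m = (Ideal.absNorm p.asIdeal) ^ e * (Ideal.absNorm p.asIdeal) ^ (e + 1) := by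
      rintro m rfl; rw [pow_add]
    rw [h2 n this] at h1
    exact Nat.eq_of_mul_eq_mul_right (by positivity) h1
  have hmem : ∀ r : 𝓞 K, Ideal.Quotient.mk (p.asIdeal ^ n) r ∈ J ↔ vl p (r : K) ≤ exp (-((e + 1 : ℕ) : ℤ)) := by
    intro r
    rw [← mem_pow_iff, ← Ideal.Quotient.eq_zero_iff_mem]; rfl
  have key : ∀ u : (powMonoidHom 2 : (𝓞 K ⧸ p.asIdeal ^ n)ˣ →* _).ker,
      ((u : (𝓞 K ⧸ p.asIdeal ^ n)ˣ) : 𝓞 K ⧸ p.asIdeal ^ n) - 1 ∈ J ∨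
      ((u : (𝓞 K ⧸ p.asIdeal ^ n)ˣ) : 𝓞 K ⧸ p.asIdeal ^ n) + 1 ∈ J := by
    rintro ⟨u, hu⟩
    rw [MonoidHom.mem_ker, powMonoidHom_apply] at hu
    obtain ⟨r, hr⟩ := Ideal.Quotient.mk_surjective (u : 𝓞 K ⧸ p.asIdeal ^ n)
    have hu' : Ideal.Quotient.mk (p.asIdeal ^ n) ((r - 1) * (r + 1)) = 0 := by
      have : ((u ^ 2 : (𝓞 K ⧸ p.asIdeal ^ n)ˣ) : 𝓞 K ⧸ p.asIdeal ^ n) = 1 := by rw [hu]; simp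
      rw [Units.val_pow_eq_pow_val, ← hr] at this
      rw [show (r - 1) * (r + 1) = r ^ 2 - 1 by ring, map_sub, map_pow, this]; simp
    rw [Ideal.Quotient.eq_zero_iff_mem, mem_pow_iff] at hu'
    simp only [← hr]
    have h1 : Ideal.Quotient.mk (p.asIdeal ^ n) r - 1 = Ideal.Quotient.mk (p.asIdeal ^ n) (r - 1) := by simp
    have h2 : Ideal.Quotient.mk (p.asIdeal ^ n) r + 1 = Ideal.Quotient.mk (p.asIdeal ^ n) (r + 1) := by simp
    rw [h1, h2, hmem, hmem]
    by_contra! hcon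
    have g : ∀ x : ℤᵐ⁰, exp (-((e + 1 : ℕ) : ℤ)) < x → exp (-(e : ℤ)) ≤ x := by
      intro x hx
      have hx0 : x ≠ 0 := (zero_le.trans_lt hx).ne'
      rw [← exp_log hx0, exp_lt_exp] at hx
      rw [← exp_log hx0, exp_le_exp]; push_cast at hx; omega
    have h3 := mul_le_mul' (g _ hcon.1) (g _ hcon.2)
    rw [← map_mul, ← exp_add] at h3
    push_cast at hu'
    have h4 := h3.trans (by push_cast; exact hu')
    rw [exp_le_exp] at h4
    rw [hn] at h4
    push_cast at h4; omega
  classical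
  let F : (powMonoidHom 2 : (𝓞 K ⧸ p.asIdeal ^ n)ˣ →* _).ker → J ⊕ J := fun u =>
    if h : ((u : (𝓞 K ⧸ p.asIdeal ^ n)ˣ) : 𝓞 K ⧸ p.asIdeal ^ n) - 1 ∈ J then Sum.inl ⟨_, h⟩
    else Sum.inr ⟨_, (key u).resolve_left h⟩
  have hF : Function.Injective F := by
    intro u w h
    simp only [F] at h
    apply Subtype.ext; apply Units.ext
    split_ifs at h <;> simpa using h
  have := Nat.card_le_card_of_injective F hF
  rwa [Nat.card_sum, hJ, ← two_mul] at this

lemma index_Dval (he : vl p (2 : K) = exp (-(e : ℤ))) :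
    (Dval (vl p)).index ≠ 0 ∧ (Dval (vl p)).index ≤ 4 * (Ideal.absNorm p.asIdeal) ^ e := by
  set n := 2 * e + 1 with hn
  have hn0 : n ≠ 0 := by omega
  have h4 : vl p (4 : K) = exp (-(2 * e : ℤ)) := by
    rw [v4_eq, he, ← exp_add]; congr 1; ring
  choose out hout using (Ideal.Quotient.mk_surjective (I := p.asIdeal ^ n))
  have hv : ∀ u : (𝓞 K ⧸ p.asIdeal ^ n)ˣ, vl p (out u : K) = 1 := fun u => unit_out hn0 u (hout _)
  have hne : ∀ u : (𝓞 K ⧸ p.asIdeal ^ n)ˣ, (out u : K) ≠ 0 := fun u h0 => by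
    have := hv u; rw [h0] at this; simp at this
  have hcl : ∀ {x y : Kˣ} {r s : 𝓞 K}, (x : K) = r → (y : K) = s → vl p (y : K) = 1 →
      Ideal.Quotient.mk (p.asIdeal ^ n) r = Ideal.Quotient.mk (p.asIdeal ^ n) s → x / y ∈ Dval (vl p) := by
    intro x y r s hx hy hv h
    apply div_mem_Dval
    rw [Ideal.Quotient.eq, mem_pow_iff] at h
    rw [hv, mul_one, hx, hy, h4]
    push_cast at h
    refine h.trans_lt ?_
    rw [exp_lt_exp, hn]; push_cast; omega
  let ψ : (𝓞 K ⧸ p.asIdeal ^ n)ˣ →* Kˣ ⧸ Dval (vl p) := MonoidHom.mk'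
    (fun u => QuotientGroup.mk (Units.mk0 (out u : K) (hne u))) (by
      intro u w
      rw [← QuotientGroup.mk_mul, eq_comm, QuotientGroup.eq, mul_comm, ← div_eq_mul_inv]
      refine hcl (r := out (u * w : (𝓞 K ⧸ p.asIdeal ^ n)ˣ)) (s := out u * out w) rfl (by simp) ?_ ?_
      · push_cast; rw [map_mul, Units.val_mk0, Units.val_mk0, hv, hv, one_mul]
      · rw [hout, map_mul, hout, hout]; simp)
  have hrange : Nat.card ψ.range ≤ 2 * (Ideal.absNorm p.asIdeal) ^ e := by
    rw [← Subgroup.index_ker]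
    refine le_trans ?_ (card_ker_sq e he)
    rw [← index_range_sq]
    refine Nat.le_of_dvd (Nat.pos_of_ne_zero Subgroup.FiniteIndex.index_ne_zero) (Subgroup.index_dvd_of_le ?_)
    rintro _ ⟨u, rfl⟩
    rw [MonoidHom.mem_ker, powMonoidHom_apply, map_pow]
    change (QuotientGroup.mk _ ^ 2 : Kˣ ⧸ Dval (vl p)) = 1
    rw [← QuotientGroup.mk_pow, QuotientGroup.eq_one_iff]
    exact sq_mem_Dval _
  have hunit : ∀ x : Kˣ, EvenV p x → (QuotientGroup.mk x : Kˣ ⧸ Dval (vl p)) ∈ ψ.range := by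
    intro x hx
    obtain ⟨s, hs⟩ := hx.scale
    obtain ⟨r, hr⟩ := p.exists_valuation_sub_lt_of_integer hs.le (γ := Units.mk0 (exp (-(2 * e : ℤ))) exp_ne_zero)
    rw [Units.val_mk0] at hr
    have hlt1 : exp (-(2 * e : ℤ)) ≤ (1 : ℤᵐ⁰) := by rw [← exp_zero, exp_le_exp]; omega
    have hr1 : vl p (r : K) = 1 := by
      have h5 := Valuation.map_add_eq_of_lt_right (vl p) (x := (r : K) - (x * s ^ 2 : Kˣ)) (y := ((x * s ^ 2 : Kˣ) : K))
        (by rw [hs]; exact hr.trans_le hlt1)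
      rw [sub_add_cancel, hs] at h5
      exact h5
    have hrn : r ∉ p.asIdeal := by
      intro h
      rw [← p.valuation_lt_one_iff_mem (K := K)] at h
      exact absurd hr1 h.ne
    have hu : IsUnit (Ideal.Quotient.mk (p.asIdeal ^ n) r) := by
      have := p.isMaximal
      rw [Ideal.Quotient.isUnit_mk_pow_iff_notMem p.asIdeal hn0]
      exact hrn
    refine ⟨hu.unit, ?_⟩
    change QuotientGroup.mk _ = _
    rw [eq_comm, QuotientGroup.eq, mul_comm, ← div_eq_mul_inv]
    have hr0 : (r : K) ≠ 0 := by intro h0; rw [h0] at hr1; simp at hr1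
    have h6 : Units.mk0 (r : K) hr0 / (x * s ^ 2) ∈ Dval (vl p) := div_mem_Dval (by
      rw [hs, mul_one, h4]; exact hr)
    have h7 : Units.mk0 (out (hu.unit : 𝓞 K ⧸ p.asIdeal ^ n) : K) (hne hu.unit) / Units.mk0 (r : K) hr0 ∈ Dval (vl p) :=
      hcl rfl rfl hr1 (hout _)
    have := mul_mem (mul_mem h7 h6) (sq_mem_Dval (v := vl p) s)
    convert this using 1
    rw [div_mul_div_cancel, div_mul_eq_mul_div, mul_div_mul_right_eq_div]
  obtain ⟨π, hπ⟩ := exists_unif p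
  let F : Bool × ψ.range → Kˣ ⧸ Dval (vl p) := fun z => (QuotientGroup.mk (if z.1 then π else 1) : Kˣ ⧸ Dval (vl p)) * (z.2 : Kˣ ⧸ Dval (vl p))
  have hF : Function.Surjective F := by
    intro z
    obtain ⟨x, rfl⟩ := QuotientGroup.mk_surjective z
    by_cases hx : EvenV p x
    · exact ⟨(false, ⟨_, hunit x hx⟩), congrArg QuotientGroup.mk (one_mul x)⟩
    · have : EvenV p (x / π) := by
        obtain ⟨k, hk, hkx⟩ := (even_or p x).resolve_left hx
        refine (even_or p _).resolve_right ?_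
        rintro ⟨l, hl, hlx⟩
        push_cast at hlx
        rw [map_div₀, hkx, hπ, ← exp_sub, exp_inj] at hlx
        rw [← hlx] at hl
        rcases hk with ⟨m, rfl⟩; rcases hl with ⟨m', hm⟩; omega
      exact ⟨(true, ⟨_, hunit _ this⟩), congrArg QuotientGroup.mk (mul_div_cancel π x)⟩
  have hfr : Finite ψ.range := Finite.of_surjective ψ.rangeRestrict ψ.rangeRestrict_surjective
  have hfin : Finite (Kˣ ⧸ Dval (vl p)) := Finite.of_surjective F hF
  have hle := Nat.card_le_card_of_surjective F hF
  rw [Nat.card_prod, Nat.card_eq_fintype_card (α := Bool), Fintype.card_bool] at hle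
  refine ⟨Nat.card_pos.ne', hle.trans ?_⟩
  omega

end idx
end TAD

namespace TAD
open Subgroup WithZero IsDedekindDomain NumberField
open scoped WithZero

/-- the places of a number field -/
abbrev Pl (K : Type*) [Field K] [NumberField K] := HeightOneSpectrum (𝓞 K) ⊕ InfinitePlace K

section places
variable {K : Type*} [Field K] [NumberField K]

/-- positive elements at an infinite place -/
def Dinf (w : InfinitePlace K) : Subgroup Kˣ where
  carrier := {x | ∀ h : w.IsReal, 0 < InfinitePlace.embedding_of_isReal h (x : K)}
  one_mem' := by intro h; simp
  mul_mem' := by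
    intro x y hx hy h
    rw [Units.val_mul, map_mul]; exact mul_pos (hx h) (hy h)
  inv_mem' := by
    intro x hx h
    rw [Units.val_inv_eq_inv_val, map_inv₀]; exact inv_pos.2 (hx h)

lemma mem_Dinf {w : InfinitePlace K} {x : Kˣ} :
    x ∈ Dinf w ↔ ∀ h : w.IsReal, 0 < InfinitePlace.embedding_of_isReal h (x : K) := Iff.rfl

/-- local squares -/
noncomputable def D : Pl K → Subgroup Kˣ
  | .inl p => Dval (vl p)
  | .inr w => Dinf w

/-- local norms -/
noncomputable def NL (v : Pl K) (a : Kˣ) : Subgroup Kˣ := Nm a ⊔ D v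

lemma mem_NL {v : Pl K} {a b : Kˣ} : b ∈ NL v a ↔ ∃ n ∈ Nm a, b / n ∈ D v := mem_sup_Dval

lemma D_le_NL (v : Pl K) (a : Kˣ) : D v ≤ NL v a := le_sup_right
lemma Nm_le_NL (v : Pl K) (a : Kˣ) : Nm a ≤ NL v a := le_sup_left

lemma sq_mem_D (v : Pl K) (s : Kˣ) : s ^ 2 ∈ D v := by
  rcases v with p | w
  · exact sq_mem_Dval _
  · intro h
    rw [Units.val_pow_eq_pow_val, map_pow]
    have : InfinitePlace.embedding_of_isReal h (s : K) ≠ 0 := by simp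
    positivity

lemma Dinf_total {w : InfinitePlace K} {x : Kˣ} (hx : x ∉ Dinf w) :
    ∃ h : w.IsReal, InfinitePlace.embedding_of_isReal h (x : K) < 0 := by
  rw [mem_Dinf] at hx; push Not at hx
  obtain ⟨h, hx⟩ := hx
  have : InfinitePlace.embedding_of_isReal h (x : K) ≠ 0 := by simp
  exact ⟨h, lt_of_le_of_ne hx this⟩

lemma Dinf_mul {w : InfinitePlace K} {x y : Kˣ} (hx : x ∉ Dinf w) (hy : y ∉ Dinf w) : x * y ∈ Dinf w := by
  obtain ⟨h, h1⟩ := Dinf_total hx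
  obtain ⟨_, h2⟩ := Dinf_total hy
  intro h; rw [Units.val_mul, map_mul]; exact mul_pos_of_neg_of_neg h1 h2

lemma Dinf_NL_top {w : InfinitePlace K} {a : Kˣ} (ha : a ∈ Dinf w) : Nm a ⊔ Dinf w = ⊤ := by
  rw [eq_top_iff]; intro b _
  by_cases hb : b ∈ Dinf w
  · exact mem_sup_right hb
  · rw [mem_sup_Dval]
    refine ⟨-a, neg_mem_Nm a, ?_⟩
    obtain ⟨h, h1⟩ := Dinf_total hb
    intro h
    push_cast
    rw [map_div₀, map_neg]
    have := ha h
    exact div_pos_of_neg_of_neg h1 (by linarith)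

lemma Dinf_NL_of_notMem {w : InfinitePlace K} {a : Kˣ} (ha : a ∉ Dinf w) : Nm a ⊔ Dinf w = Dinf w := by
  refine sup_eq_right.2 ?_
  rintro z ⟨x, y, hz⟩ h
  obtain ⟨h, h1⟩ := Dinf_total ha
  have h0 : InfinitePlace.embedding_of_isReal h (z : K) ≠ 0 := by simp
  refine lt_of_le_of_ne ?_ h0.symm
  rw [hz, map_sub, map_mul, map_pow, map_pow]
  nlinarith [sq_nonneg (InfinitePlace.embedding_of_isReal h x), sq_nonneg (InfinitePlace.embedding_of_isReal h y)]

lemma NL_symm {v : Pl K} {a b : Kˣ} (h : b ∈ NL v a) : a ∈ NL v b := by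
  rcases v with p | w
  · exact Dval_symm (v := vl p) h
  · change b ∈ Nm a ⊔ Dinf w at h
    change a ∈ Nm b ⊔ Dinf w
    by_cases ha : a ∈ Dinf w
    · exact mem_sup_right ha
    · rw [Dinf_NL_of_notMem ha] at h
      rw [Dinf_NL_top h]; trivial

lemma NL_comm {v : Pl K} {a b : Kˣ} : b ∈ NL v a ↔ a ∈ NL v b := ⟨NL_symm, NL_symm⟩

lemma NL_top {v : Pl K} {a : Kˣ} (h : a ∈ D v) : NL v a = ⊤ := by
  rw [eq_top_iff]; intro b _
  exact NL_symm (D_le_NL v b h)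

lemma NL_congr {v : Pl K} {a a' : Kˣ} (h : a / a' ∈ D v) : NL v a = NL v a' := by
  ext b
  rw [NL_comm, NL_comm (a := a')]
  have := D_le_NL v b h
  constructor
  · intro h1; have := div_mem h1 this; rwa [div_div_cancel] at this
  · intro h1; have := mul_mem this h1; rwa [div_mul_cancel] at this

lemma NL_ne_top {v : Pl K} {a : Kˣ} (h : a ∉ D v) : ∃ b, b ∉ NL v a := by
  rcases v with p | w
  · exact L6 h
  · refine ⟨a, ?_⟩
    change a ∉ Nm a ⊔ Dinf w
    rwa [Dinf_NL_of_notMem h]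

lemma neg_mem_NL (v : Pl K) (a : Kˣ) : -a ∈ NL v a := Nm_le_NL v a (neg_mem_Nm a)

/-- absolute values -/
noncomputable def abv : Pl K → AbsoluteValue K ℝ
  | .inl p => NumberField.HeightOneSpectrum.adicAbv K p
  | .inr w => w.1

lemma abv_fin_lt (p : HeightOneSpectrum (𝓞 K)) (x y : K) : abv (.inl p) x < abv (.inl p) y ↔ vl p x < vl p y := by
  change ((_ : NNReal) : ℝ) < ((_ : NNReal) : ℝ) ↔ _
  rw [NNReal.coe_lt_coe]
  exact (WithZeroMulInt.toNNReal_strictMono (NumberField.HeightOneSpectrum.one_lt_absNorm_nnreal p)).lt_iff_lt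

lemma abv_fin_lt_one (p : HeightOneSpectrum (𝓞 K)) (x : K) : abv (.inl p) x < 1 ↔ vl p x < 1 := by
  have := abv_fin_lt p x 1
  simpa using this

lemma abv_nontriv (v : Pl K) : (abv v).IsNontrivial := by
  rcases v with p | w
  · obtain ⟨π, hπ⟩ := exists_unif p
    refine ⟨π, π.ne_zero, ne_of_lt ?_⟩
    rw [abv_fin_lt_one, hπ, ← exp_zero, exp_lt_exp]; norm_num
  · exact w.isNontrivial

lemma abv_inequiv : Pairwise fun v w : Pl K ↦ ¬ (abv v).IsEquiv (abv w) := by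
  have key : ∀ (p : HeightOneSpectrum (𝓞 K)) (w : InfinitePlace K), ¬ (abv (.inl p)).IsEquiv (abv (.inr w)) := by
    intro p w h
    have h1 := h.lt_iff_lt (x := 1) (y := 2)
    rw [abv_fin_lt] at h1
    have h2 : abv (.inr w) (1 : K) < abv (.inr w) 2 := by
      change w 1 < w 2
      rw [map_one, ← InfinitePlace.norm_embedding_eq, map_ofNat]; norm_num
    have := h1.2 h2
    rw [map_one] at this
    exact absurd (v2_le (vl p)) (not_le.2 this)
  rintro (p | w) (q | w') hne h
  · have hpq : p.asIdeal ≠ q.asIdeal := fun h => hne (congrArg _ (HeightOneSpectrum.ext h))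
    have : ¬ p.asIdeal ≤ q.asIdeal := fun hle => hpq (p.isMaximal.eq_of_le q.isPrime.ne_top hle)
    obtain ⟨r, hr, hr'⟩ := SetLike.not_le_iff_exists.1 this
    have h1 := h.lt_one_iff (x := (r : K))
    rw [abv_fin_lt_one, abv_fin_lt_one, p.valuation_lt_one_iff_mem, q.valuation_lt_one_iff_mem] at h1
    exact hr' (h1.1 hr)
  · exact key _ _ h
  · exact key _ _ h.symm
  · exact hne (congrArg _ (InfinitePlace.eq_iff_isEquiv.2 h))

lemma weak_approx (T : Finset (Pl K)) (f : Pl K → K) {ε : ℝ} (hε : 0 < ε) :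
    ∃ z : K, ∀ v ∈ T, abv v (z - f v) < ε := by
  have hd := AbsoluteValue.denseRange_algebraMap_pi (ι := T) (v := fun v : T => abv (v : Pl K))
    (fun v => abv_nontriv v.1) (fun v w h => abv_inequiv (fun h' => h (Subtype.ext h')))
  obtain ⟨z, hz⟩ := Metric.denseRange_iff.1 hd (fun v => (WithAbs.equiv (abv (v : Pl K))).symm (f v)) ε hε
  refine ⟨z, fun v hv => ?_⟩
  rw [dist_pi_lt_iff hε] at hz
  have := hz ⟨v, hv⟩
  rw [dist_comm, dist_eq_norm] at this
  exact this

lemma D_open (v : Pl K) : ∃ c : ℝ, 0 < c ∧ c ≤ 1 ∧ ∀ x y : Kˣ, abv v ((x : K) - y) < c * abv v (y : K) → x / y ∈ D v := by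
  rcases v with p | w
  · refine ⟨abv (.inl p) 4, ?_, ?_, fun x y h => ?_⟩
    · exact AbsoluteValue.pos _ (by norm_num)
    · rw [← not_lt, ← map_one (abv (.inl p)), abv_fin_lt, not_lt, map_one]; exact v4_le _
    · rw [← map_mul, abv_fin_lt, map_mul] at h
      exact div_mem_Dval (v := vl p) h
  · refine ⟨1, one_pos, le_rfl, fun x y h hr => ?_⟩
    change w _ < 1 * w _ at h
    rw [one_mul, ← InfinitePlace.norm_embedding_of_isReal hr, ← InfinitePlace.norm_embedding_of_isReal hr,
      Real.norm_eq_abs, Real.norm_eq_abs, map_sub] at h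
    push_cast
    rw [map_div₀]
    set X := InfinitePlace.embedding_of_isReal hr (x : K)
    set Y := InfinitePlace.embedding_of_isReal hr (y : K)
    rcases lt_or_ge 0 Y with hY | hY
    · rw [abs_of_pos hY, abs_lt] at h
      exact div_pos (by linarith) hY
    · rw [abs_of_nonpos hY, abs_lt] at h
      exact div_pos_of_neg_of_neg (by linarith) (by linarith)

lemma ne_zero_of_close {v : Pl K} {x : K} {y : Kˣ} {c : ℝ} (hc : c ≤ 1) (h : abv v (x - y) < c * abv v (y : K)) : x ≠ 0 := by
  rintro rfl
  rw [zero_sub, AbsoluteValue.map_neg] at h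
  nlinarith [(abv v).nonneg (y : K)]

lemma exists_pos_le {ι : Type*} (T : Finset ι) (f : ι → ℝ) (hf : ∀ i, 0 < f i) : ∃ ε > 0, ∀ i ∈ T, ε ≤ f i := by
  classical
  induction T using Finset.induction_on with
  | empty => exact ⟨1, one_pos, by simp⟩
  | insert a T ha ih =>
    obtain ⟨ε, h1, h2⟩ := ih
    refine ⟨min ε (f a), lt_min h1 (hf a), fun i hi => ?_⟩
    rcases Finset.mem_insert.1 hi with rfl | hi
    · exact min_le_right _ _
    · exact (min_le_left _ _).trans (h2 i hi)

/-- weak approximation modulo local squares, norms version -/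
lemma approx_Nm (T : Finset (Pl K)) (hT : T.Nonempty) (a : Kˣ) (n : Pl K → Kˣ) (hn : ∀ v, n v ∈ Nm a) :
    ∃ z ∈ Nm a, ∀ v ∈ T, z / n v ∈ D v := by
  choose X Y hXY using hn
  choose c hc hc1 hD using (D_open (K := K))
  let B : Pl K → ℝ := fun v => (2 * abv v (X v) + 1) + abv v (a : K) * (2 * abv v (Y v) + 1)
  have hB : ∀ v, 0 < B v := fun v => by
    have h1 := (abv v).nonneg (X v)
    have h2 := (abv v).nonneg (Y v)
    have h3 := (abv v).nonneg (a : K)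
    positivity
  obtain ⟨ε, he, hle⟩ := exists_pos_le T (fun v => min 1 (c v * abv v (n v : K) / B v))
    (fun v => lt_min one_pos (div_pos (mul_pos (hc v) ((abv v).pos (n v).ne_zero)) (hB v)))
  obtain ⟨x, hx⟩ := weak_approx T X he
  obtain ⟨y, hy⟩ := weak_approx T Y he
  have key : ∀ v ∈ T, abv v (x ^ 2 - a * y ^ 2 - n v) < c v * abv v (n v : K) := by
    intro v hv
    have h1 : ε ≤ 1 := (hle v hv).trans (min_le_left _ _)
    have h2 : ε * B v ≤ c v * abv v (n v : K) := by
      rw [← le_div_iff₀ (hB v)]; exact (hle v hv).trans (min_le_right _ _)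
    refine lt_of_lt_of_le ?_ h2
    have e1 : x ^ 2 - a * y ^ 2 - n v = (x - X v) * ((x - X v) + (X v + X v)) + -(a * ((y - Y v) * ((y - Y v) + (Y v + Y v)))) := by
      rw [hXY]; ring
    rw [e1]
    refine ((abv v).add_le _ _).trans_lt ?_
    rw [AbsoluteValue.map_neg, map_mul, map_mul, map_mul]
    have q : ∀ {t Z : K}, abv v t < ε → abv v (t + (Z + Z)) ≤ 2 * abv v Z + 1 := by
      intro t Z ht
      have := (abv v).add_le t (Z + Z)
      have := (abv v).add_le Z Z
      linarith
    have q1 := q (Z := X v) (hx v hv)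
    have q2 := q (Z := Y v) (hy v hv)
    have n1 := (abv v).nonneg (x - X v)
    have n2 := (abv v).nonneg (y - Y v)
    have n3 := (abv v).nonneg (X v)
    have n4 := (abv v).nonneg (Y v)
    have n5 := (abv v).nonneg (a : K)
    have r1 : abv v (x - X v) * abv v (x - X v + (X v + X v)) < ε * (2 * abv v (X v) + 1) :=
      lt_of_le_of_lt (mul_le_mul_of_nonneg_left q1 n1) (mul_lt_mul_of_pos_right (hx v hv) (by linarith))
    have r2 : abv v (y - Y v) * abv v (y - Y v + (Y v + Y v)) ≤ ε * (2 * abv v (Y v) + 1) :=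
      le_trans (mul_le_mul_of_nonneg_left q2 n2) (mul_le_mul_of_nonneg_right (hy v hv).le (by linarith))
    have r3 := mul_le_mul_of_nonneg_left r2 n5
    simp only [B]
    nlinarith
  obtain ⟨v0, hv0⟩ := hT
  have hne : x ^ 2 - a * y ^ 2 ≠ 0 := ne_zero_of_close (hc1 v0) (key v0 hv0)
  exact ⟨Units.mk0 _ hne, ⟨x, y, rfl⟩, fun v hv => hD v _ _ (key v hv)⟩

lemma approx (T : Finset (Pl K)) (f : Pl K → Kˣ) : ∃ z : Kˣ, ∀ v ∈ T, z / f v ∈ D v := by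
  rcases T.eq_empty_or_nonempty with rfl | hT
  · exact ⟨1, by simp⟩
  have : Nm (1 : Kˣ) = ⊤ := by simpa using Nm_sq (1 : Kˣ)
  obtain ⟨z, -, hz⟩ := approx_Nm T hT 1 f (fun v => by rw [this]; trivial)
  exact ⟨z, hz⟩

lemma approx_Nm' (T : Finset (Pl K)) (a : Kˣ) (n : Pl K → Kˣ) (hn : ∀ v ∈ T, n v ∈ NL v a) :
    ∃ z ∈ Nm a, ∀ v ∈ T, z / n v ∈ D v := by
  classical
  rcases T.eq_empty_or_nonempty with rfl | hT
  · exact ⟨1, one_mem _, by simp⟩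
  have : ∀ v, ∃ m ∈ Nm a, v ∈ T → n v / m ∈ D v := by
    intro v
    by_cases hv : v ∈ T
    · obtain ⟨m, hm, h⟩ := mem_NL.1 (hn v hv)
      exact ⟨m, hm, fun _ => h⟩
    · exact ⟨1, one_mem _, fun h => absurd h hv⟩
  choose m hm hm' using this
  obtain ⟨z, hz, h⟩ := approx_Nm T hT a m hm
  refine ⟨z, hz, fun v hv => ?_⟩
  have := div_mem (h v hv) (hm' v hv)
  rwa [div_div_div_cancel_right] at this

end places
end TAD

namespace TAD
open Subgroup WithZero IsDedekindDomain NumberField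
open scoped WithZero

section places
variable {K : Type*} [Field K] [NumberField K]

lemma Dinf_index (w : InfinitePlace K) : (Dinf w).index ≠ 0 ∧ (Dinf w).index ≤ 2 / w.mult ∧ (Dinf w).index ≤ 2 := by
  by_cases hw : w.IsReal
  · have hle : (Dinf w).index ≠ 0 ∧ (Dinf w).index ≤ 2 := by
      by_cases h : Dinf w = ⊤
      · rw [h]; simp
      · have : ∃ b, b ∉ Dinf w := by
          by_contra! hh; exact h (eq_top_iff.2 fun x _ => hh x)
        obtain ⟨b, hb⟩ := this
        have : (Dinf w).index = 2 := by
          rw [Subgroup.index_eq_two_iff]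
          refine ⟨b, fun x => ?_⟩
          by_cases hx : x ∈ Dinf w
          · refine Or.inr ⟨hx, fun h' => hb ?_⟩
            exact (mul_mem_cancel_left hx).1 h'
          · exact Or.inl ⟨Dinf_mul hx hb, hx⟩
        omega
    refine ⟨hle.1, ?_, hle.2⟩
    rw [InfinitePlace.mult_isReal ⟨w, hw⟩]; simpa using hle.2
  · have : Dinf w = ⊤ := eq_top_iff.2 fun x _ h => absurd h hw
    rw [this, Subgroup.index_top, InfinitePlace.mult_isComplex ⟨w, InfinitePlace.not_isReal_iff_isComplex.1 hw⟩]
    simp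

lemma exists_ord2 (p : HeightOneSpectrum (𝓞 K)) : ∃ e : ℕ, vl p (2 : K) = exp (-(e : ℤ)) := by
  have h0 : vl p (2 : K) ≠ 0 := by simp
  have h1 := v2_le (vl p)
  rw [← exp_log h0, ← exp_zero, exp_le_exp] at h1
  refine ⟨(-log (vl p (2 : K))).toNat, ?_⟩
  rw [← exp_log h0, Int.toNat_of_nonneg (by simpa using h1)]; simp

lemma D_index (v : Pl K) : (D v).index ≠ 0 := by
  rcases v with p | w
  · obtain ⟨e, he⟩ := exists_ord2 p
    exact (index_Dval e he).1
  · exact (Dinf_index w).1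

lemma prod_pow_dvd (S : Finset (HeightOneSpectrum (𝓞 K))) (e : HeightOneSpectrum (𝓞 K) → ℕ)
    (I : Ideal (𝓞 K)) (h : ∀ p ∈ S, p.asIdeal ^ e p ∣ I) : ∏ p ∈ S, p.asIdeal ^ e p ∣ I := by
  refine Finset.prod_dvd_of_coprime ?_ h
  intro p _ q _ hpq
  exact (Ideal.isCoprime_iff_sup_eq.2
    (Ideal.IsMaximal.coprime_of_ne p.isMaximal q.isMaximal (fun h => hpq (HeightOneSpectrum.ext h)))).pow

lemma index_D_prod (S : Finset (HeightOneSpectrum (𝓞 K))) :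
    (∏ p ∈ S, (D (.inl p : Pl K)).index) * ∏ w : InfinitePlace K, (D (.inr w : Pl K)).index ≤
      4 ^ (S.card + Fintype.card (InfinitePlace K)) := by
  choose e he using (exists_ord2 (K := K))
  have h1 : ∏ p ∈ S, (D (.inl p : Pl K)).index ≤ ∏ p ∈ S, (4 * (Ideal.absNorm p.asIdeal) ^ e p) :=
    Finset.prod_le_prod' fun p _ => (index_Dval (e p) (he p)).2
  have hd : ∏ p ∈ S, p.asIdeal ^ e p ∣ Ideal.span {(2 : 𝓞 K)} := by
    refine prod_pow_dvd S e _ fun p _ => ?_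
    rw [Ideal.dvd_span_singleton, mem_pow_iff]
    have h : ((2 : 𝓞 K) : K) = 2 := map_ofNat (algebraMap (𝓞 K) K) 2
    rw [h]; exact (he p).le
  have h2 : ∏ p ∈ S, (Ideal.absNorm p.asIdeal) ^ e p ≤ 2 ^ Module.finrank ℚ K := by
    have h3 : ∏ p ∈ S, (Ideal.absNorm p.asIdeal) ^ e p = Ideal.absNorm (∏ p ∈ S, p.asIdeal ^ e p) := by
      rw [map_prod]; simp
    have h4 : Ideal.absNorm (Ideal.span {(2 : 𝓞 K)}) = 2 ^ Module.finrank ℚ K := by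
      rw [Ideal.absNorm_span_singleton]
      have : (2 : 𝓞 K) = algebraMap ℤ (𝓞 K) 2 := by simp
      rw [this, Algebra.norm_algebraMap, RingOfIntegers.rank]; simp [Int.natAbs_pow]
    rw [h3, ← h4]
    exact Nat.le_of_dvd (by rw [h4]; positivity) (Ideal.absNorm_dvd_absNorm_of_le (Ideal.le_of_dvd hd))
  have h5 : ∏ w : InfinitePlace K, (D (.inr w : Pl K)).index ≤ ∏ w : InfinitePlace K, 2 / w.mult :=
    Finset.prod_le_prod' fun w _ => (Dinf_index w).2.1
  have h6 : (∏ w : InfinitePlace K, 2 / w.mult) * 2 ^ Module.finrank ℚ K = 4 ^ Fintype.card (InfinitePlace K) := by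
    rw [← InfinitePlace.sum_mult_eq, ← Finset.prod_pow_eq_pow_sum, ← Finset.prod_mul_distrib]
    rw [Finset.prod_congr rfl (g := fun _ => 4), Finset.prod_const, Finset.card_univ]
    intro w _
    unfold InfinitePlace.mult
    split_ifs <;> norm_num
  rw [Finset.prod_mul_distrib, Finset.prod_const] at h1
  calc _ ≤ (4 ^ S.card * 2 ^ Module.finrank ℚ K) * ∏ w : InfinitePlace K, 2 / w.mult :=
        Nat.mul_le_mul (h1.trans (Nat.mul_le_mul_left _ h2)) h5
    _ = _ := by rw [pow_add, ← h6]; ring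

end places
end TAD

namespace TAD
open Subgroup WithZero IsDedekindDomain NumberField
open scoped WithZero

section units
variable {K : Type*} [Field K] [NumberField K]

lemma coe_mul' (x y : 𝓞 K) : ((x * y : 𝓞 K) : K) = x * y := map_mul _ _ _

/-- S-units -/
noncomputable def US (S : Finset (HeightOneSpectrum (𝓞 K))) : Subgroup Kˣ where
  carrier := {x | ∀ p ∉ S, vl p (x : K) = 1}
  one_mem' := by intro p _; simp
  mul_mem' := by
    intro x y hx hy p hp
    rw [Units.val_mul, map_mul, hx p hp, hy p hp, one_mul]
  inv_mem' := by
    intro x hx p hp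
    rw [Units.val_inv_eq_inv_val, map_inv₀, hx p hp, inv_one]

lemma mem_US {S : Finset (HeightOneSpectrum (𝓞 K))} {x : Kˣ} : x ∈ US S ↔ ∀ p ∉ S, vl p (x : K) = 1 := Iff.rfl

lemma US_mono {S T : Finset (HeightOneSpectrum (𝓞 K))} (h : S ⊆ T) : US S ≤ US T :=
  fun _ hx p hp => hx p (fun h' => hp (h h'))

lemma sq_mem_US {S : Finset (HeightOneSpectrum (𝓞 K))} {s : Kˣ} (h : s ^ 2 ∈ US S) : s ∈ US S := by
  intro p hp
  have := h p hp
  rw [Units.val_pow_eq_pow_val, map_pow] at this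
  exact (pow_eq_one_iff.1 this).resolve_right (by norm_num)

lemma exists_ideal_gen : ∃ S0 : Finset (HeightOneSpectrum (𝓞 K)), ∀ I : Ideal (𝓞 K), I ≠ ⊥ →
    ∃ k : Kˣ, ∀ v ∉ S0, (∀ i ∈ I, vl v (i : K) ≤ vl v (k : K)) ∧ ∃ i ∈ I, vl v (i : K) = vl v (k : K) := by
  classical
  choose J hJ using (ClassGroup.mk0_surjective (R := 𝓞 K))
  have hfin : ∀ c, {v : HeightOneSpectrum (𝓞 K) | v.asIdeal ∣ (J c : Ideal (𝓞 K))}.Finite := fun c =>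
    Ideal.finite_factors (nonZeroDivisors.coe_ne_zero (J c))
  have : Fintype (ClassGroup (𝓞 K)) := Fintype.ofFinite _
  refine ⟨Finset.univ.biUnion fun c => (hfin c).toFinset, fun I hI => ?_⟩
  let I' : nonZeroDivisors (Ideal (𝓞 K)) := ⟨I, mem_nonZeroDivisors_of_ne_zero hI⟩
  obtain ⟨x, y, hx, hy, hxy⟩ := (ClassGroup.mk0_eq_mk0_iff (I := I') (J := J (ClassGroup.mk0 I'))).1 (hJ _).symm
  have hx' : (x : K) ≠ 0 := by simpa using hx
  have hy' : (y : K) ≠ 0 := by simpa using hy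
  refine ⟨Units.mk0 (y / x : K) (div_ne_zero hy' hx'), fun v hv => ?_⟩
  have hv' : ¬ (J (ClassGroup.mk0 I') : Ideal (𝓞 K)) ≤ v.asIdeal := by
    intro h
    apply hv
    rw [Finset.mem_biUnion]
    exact ⟨_, Finset.mem_univ (ClassGroup.mk0 I'), by simpa using Ideal.dvd_iff_le.2 h⟩
  have hvx : vl v (x : K) ≠ 0 := by simpa using hx'
  constructor
  · intro i hi
    have h1 : x * i ∈ Ideal.span {x} * I := Ideal.mul_mem_mul (Ideal.mem_span_singleton_self x) hi
    change x * i ∈ Ideal.span {x} * (I' : Ideal (𝓞 K)) at h1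
    rw [hxy] at h1
    obtain ⟨j, hj, h2⟩ := Ideal.mem_span_singleton_mul.1 h1
    have h3 : vl v (x : K) * vl v (i : K) = vl v (y : K) * vl v (j : K) := by
      rw [← (vl v).map_mul, ← (vl v).map_mul, ← coe_mul', ← coe_mul', h2]
    rw [Units.val_mk0, map_div₀, le_div_iff₀ (zero_lt_iff.2 hvx), mul_comm, h3]
    exact mul_le_of_le_one_right' (v.valuation_le_one j)
  · obtain ⟨j, hj, hjv⟩ := SetLike.not_le_iff_exists.1 hv'
    have h1 : y * j ∈ Ideal.span {y} * (J (ClassGroup.mk0 I') : Ideal (𝓞 K)) :=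
      Ideal.mul_mem_mul (Ideal.mem_span_singleton_self y) hj
    rw [← hxy] at h1
    obtain ⟨i, hi, h2⟩ := Ideal.mem_span_singleton_mul.1 h1
    refine ⟨i, hi, ?_⟩
    have h3 : vl v (x : K) * vl v (i : K) = vl v (y : K) * vl v (j : K) := by
      rw [← (vl v).map_mul, ← (vl v).map_mul, ← coe_mul', ← coe_mul', h2]
    have hj1 : vl v (j : K) = 1 := by
      refine le_antisymm (v.valuation_le_one j) (not_lt.1 fun h => hjv ?_)
      exact (v.valuation_lt_one_iff_mem (K := K) j).1 h
    rw [hj1, mul_one] at h3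
    rw [Units.val_mk0, map_div₀, eq_div_iff hvx, mul_comm, h3]

lemma prime_sep {p v : HeightOneSpectrum (𝓞 K)} (h : v ≠ p) : ∃ i ∈ p.asIdeal, vl v (i : K) = 1 := by
  have : ¬ p.asIdeal ≤ v.asIdeal := fun hle => h (HeightOneSpectrum.ext (p.isMaximal.eq_of_le v.isPrime.ne_top hle)).symm
  obtain ⟨r, hr, hr'⟩ := SetLike.not_le_iff_exists.1 this
  refine ⟨r, hr, le_antisymm (v.valuation_le_one r) (not_lt.1 fun h => hr' ?_)⟩
  exact (v.valuation_lt_one_iff_mem (K := K) r).1 h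

/-- large sets of places: all ideals principal outside -/
def Big (S : Finset (HeightOneSpectrum (𝓞 K))) : Prop := ∀ I : Ideal (𝓞 K), I ≠ ⊥ →
    ∃ k : Kˣ, ∀ v ∉ S, (∀ i ∈ I, vl v (i : K) ≤ vl v (k : K)) ∧ ∃ i ∈ I, vl v (i : K) = vl v (k : K)

lemma exists_Big : ∃ S0 : Finset (HeightOneSpectrum (𝓞 K)), ∀ S, S0 ⊆ S → Big S := by
  obtain ⟨S0, h⟩ := exists_ideal_gen (K := K)
  refine ⟨S0, fun S hS I hI => ?_⟩
  obtain ⟨k, hk⟩ := h I hI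
  exact ⟨k, fun v hv => hk v (fun h' => hv (hS h'))⟩

lemma Big.unif {S : Finset (HeightOneSpectrum (𝓞 K))} (hS : Big S) (p : HeightOneSpectrum (𝓞 K)) (hp : p ∉ S) :
    ∃ π : Kˣ, vl p (π : K) = exp (-1 : ℤ) ∧ ∀ v ∉ S, v ≠ p → vl v (π : K) = 1 := by
  obtain ⟨k, hk⟩ := hS p.asIdeal p.ne_bot
  refine ⟨k, ?_, fun v hv hvp => ?_⟩
  · obtain ⟨h1, i, hi, h2⟩ := hk p hp
    refine le_antisymm ?_ ?_
    · rw [← h2]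
      have := (mem_pow_iff (p := p) i 1).1 (by simpa using hi)
      simpa using this
    · obtain ⟨π, hπ⟩ := p.intValuation_exists_uniformizer
      have h3 : π ∈ p.asIdeal := by
        have := (mem_pow_iff (p := p) π 1).2 (by rw [p.valuation_of_algebraMap, hπ]; simp)
        simpa using this
      have := h1 π h3
      rw [p.valuation_of_algebraMap, hπ] at this
      exact this
  · obtain ⟨h1, i, hi, h2⟩ := hk v hv
    obtain ⟨j, hj, h3⟩ := prime_sep hvp
    refine le_antisymm ?_ ?_
    · rw [← h2]; exact v.valuation_le_one i
    · rw [← h3]; exact h1 j hj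

lemma Big.sup {S : Finset (HeightOneSpectrum (𝓞 K))} (hS : Big S) (p q : K) (h : p ≠ 0 ∨ q ≠ 0) :
    ∃ k : Kˣ, ∀ v ∉ S, vl v (k : K) = max (vl v p) (vl v q) := by
  obtain ⟨a, b, hb, rfl⟩ := IsFractionRing.div_surjective (A := 𝓞 K) p
  obtain ⟨c, d, hd, rfl⟩ := IsFractionRing.div_surjective (A := 𝓞 K) q
  have hb0 : (b : K) ≠ 0 := by simpa using nonZeroDivisors.ne_zero hb
  have hd0 : (d : K) ≠ 0 := by simpa using nonZeroDivisors.ne_zero hd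
  have hI : Ideal.span {a * d, c * b} ≠ ⊥ := by
    intro h0
    rw [Ideal.span_eq_bot] at h0
    have h1 : ((a * d : 𝓞 K) : K) = 0 := by rw [h0 (a * d) (by simp)]; simp
    have h2 : ((c * b : 𝓞 K) : K) = 0 := by rw [h0 (c * b) (by simp)]; simp
    simp only [coe_mul', mul_eq_zero] at h1 h2
    rcases h with h | h
    · exact h (div_eq_zero_iff.2 (Or.inl (h1.resolve_right hd0)))
    · exact h (div_eq_zero_iff.2 (Or.inl (h2.resolve_right hb0)))
  obtain ⟨k, hk⟩ := hS _ hI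
  refine ⟨k * (Units.mk0 (b * d : K) (mul_ne_zero hb0 hd0))⁻¹, fun v hv => ?_⟩
  obtain ⟨h1, i, hi, h2⟩ := hk v hv
  have hk' : vl v (k : K) = max (vl v (a * d : K)) (vl v (c * b : K)) := by
    apply le_antisymm
    · rw [← h2]
      obtain ⟨x, y, rfl⟩ := Ideal.mem_span_pair.1 hi
      simp only [map_add, map_mul]
      refine ((vl v).map_add _ _).trans (max_le_max ?_ ?_)
      · rw [map_mul]
        exact (mul_le_of_le_one_left' (v.valuation_le_one x)).trans_eq (by simp)
      · rw [map_mul]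
        exact (mul_le_of_le_one_left' (v.valuation_le_one y)).trans_eq (by simp)
    · refine max_le ?_ ?_
      · simpa using h1 (a * d) (Ideal.subset_span (by simp))
      · simpa using h1 (c * b) (Ideal.subset_span (by simp))
  have hvb : vl v (b : K) ≠ 0 := by simpa using hb0
  have hvd : vl v (d : K) ≠ 0 := by simpa using hd0
  have hpos : 0 < vl v (b : K) * vl v (d : K) := zero_lt_iff.2 (mul_ne_zero hvb hvd)
  rw [Units.val_mul, map_mul, hk', Units.val_inv_eq_inv_val, Units.val_mk0, map_inv₀, ← div_eq_mul_inv, map_mul (vl v) (b : K) (d : K)]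
  have hm : Monotone fun x : ℤᵐ⁰ => x / (vl v (b : K) * vl v (d : K)) := fun x y hxy => div_le_div_of_nonneg_right hxy hpos.le
  rw [hm.map_max, map_div₀, map_div₀, map_mul, map_mul, mul_div_mul_right _ _ hvd, mul_comm (vl v (b : K)), mul_div_mul_right _ _ hvb]
end units
end TAD

namespace TAD
open Subgroup WithZero IsDedekindDomain NumberField
open scoped WithZero

section units
variable {K : Type*} [Field K] [NumberField K]

lemma torsion_sq : (powMonoidHom 2 : (𝓞 K)ˣ →* (𝓞 K)ˣ).range.relIndex (Units.torsion K) = 2 := by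
  have h1 : (powMonoidHom 2 : (𝓞 K)ˣ →* (𝓞 K)ˣ).range.subgroupOf (Units.torsion K) =
      (powMonoidHom 2 : Units.torsion K →* Units.torsion K).range := by
    ext ⟨x, hx⟩
    simp only [Subgroup.mem_subgroupOf, MonoidHom.mem_range, powMonoidHom_apply, Subtype.ext_iff]
    constructor
    · rintro ⟨y, rfl⟩
      have hy : y ∈ Units.torsion K := by
        have hx' : IsOfFinOrder (y ^ 2) := hx
        exact (isOfFinOrder_pow.1 hx').resolve_right (by norm_num)
      exact ⟨⟨y, hy⟩, rfl⟩
    · rintro ⟨y, rfl⟩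
      exact ⟨y, rfl⟩
  rw [Subgroup.relIndex, h1, index_range_sq, Nat.card_eq_two_iff]
  have hm : (-1 : (𝓞 K)ˣ) ∈ Units.torsion K := by
    change IsOfFinOrder (-1 : (𝓞 K)ˣ)
    exact isOfFinOrder_iff_pow_eq_one.2 ⟨2, by norm_num, by simp⟩
  refine ⟨⟨1, one_mem _⟩, ⟨⟨-1, hm⟩, ?_⟩, ?_, ?_⟩
  · rw [MonoidHom.mem_ker]; apply Subtype.ext; simp
  · intro h
    have h2 : (1 : (𝓞 K)ˣ) = -1 := Subtype.ext_iff.1 (Subtype.ext_iff.1 h)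
    have h3 : (1 : 𝓞 K) = -1 := by simpa using congrArg (fun x : (𝓞 K)ˣ => (x : 𝓞 K)) h2
    have h4 : (2 : 𝓞 K) = 0 := by linear_combination h3
    exact two_ne_zero h4
  · ext ⟨⟨x, hx⟩, hx2⟩
    simp only [Set.mem_insert_iff, Set.mem_singleton_iff, Set.mem_univ, iff_true]
    rw [MonoidHom.mem_ker] at hx2
    have h2 : x ^ 2 = 1 := congrArg Subtype.val hx2
    have h3 : (x : 𝓞 K) ^ 2 = 1 := by simpa using congrArg (fun x : (𝓞 K)ˣ => (x : 𝓞 K)) h2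
    rcases mul_eq_zero.1 (show ((x : 𝓞 K) - 1) * ((x : 𝓞 K) + 1) = 0 by linear_combination h3) with h | h
    · left; apply Subtype.ext; apply Subtype.ext; apply Units.ext; exact sub_eq_zero.1 h
    · right; apply Subtype.ext; apply Subtype.ext; apply Units.ext; simpa using eq_neg_of_add_eq_zero_left h

lemma index_tors_sq : (Units.torsion K ⊔ (powMonoidHom 2 : (𝓞 K)ˣ →* (𝓞 K)ˣ).range).index = 2 ^ (Units.rank K) := by
  choose c hc huniq using fun u : (𝓞 K)ˣ => Units.exist_unique_eq_mul_prod K u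
  have hun : ∀ (u : (𝓞 K)ˣ) (z : Units.torsion K) (e : Fin (Units.rank K) → ℤ),
      u = z * ∏ i, Units.fundSystem K i ^ (e i) → (c u).2 = e := fun u z e h => by
    have := huniq u (z, e) h
    rw [← this]
  let ψ : (𝓞 K)ˣ →* Multiplicative (Fin (Units.rank K) → ZMod 2) := MonoidHom.mk'
    (fun u => Multiplicative.ofAdd fun i => (((c u).2 i : ℤ) : ZMod 2)) (by
      intro u w
      rw [← ofAdd_add]; congr 1
      have := hun (u * w) ((c u).1 * (c w).1) ((c u).2 + (c w).2) (by
        have e1 : u * w = (((c u).1 : (𝓞 K)ˣ) * ∏ i, Units.fundSystem K i ^ ((c u).2 i)) *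
          (((c w).1 : (𝓞 K)ˣ) * ∏ i, Units.fundSystem K i ^ ((c w).2 i)) := by rw [← hc u, ← hc w]
        rw [e1]
        simp only [Pi.add_apply, zpow_add, Finset.prod_mul_distrib, Subgroup.coe_mul]
        exact mul_mul_mul_comm _ _ _ _)
      funext i
      simp [this])
  have hψ : ∀ u, ψ u = Multiplicative.ofAdd fun i => (((c u).2 i : ℤ) : ZMod 2) := fun u => rfl
  have hker : Units.torsion K ⊔ (powMonoidHom 2 : (𝓞 K)ˣ →* (𝓞 K)ˣ).range = ψ.ker := by
    apply le_antisymm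
    · refine sup_le ?_ ?_
      · intro u hu
        rw [MonoidHom.mem_ker, hψ, hun u ⟨u, hu⟩ 0 (by simp)]
        change Multiplicative.ofAdd _ = Multiplicative.ofAdd 0
        congr 1
      · rintro _ ⟨u, rfl⟩
        rw [MonoidHom.mem_ker, powMonoidHom_apply, map_pow]
        change Multiplicative.ofAdd (2 • (Multiplicative.toAdd (ψ u))) = Multiplicative.ofAdd 0
        congr 1
        funext i
        have : ((2 : ℕ) : ZMod 2) = 0 := rfl
        rw [Pi.smul_apply, nsmul_eq_mul, this, zero_mul]; rfl
    · intro u hu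
      rw [MonoidHom.mem_ker, hψ] at hu
      have h1 : ∀ i, (((c u).2 i : ℤ) : ZMod 2) = 0 := fun i =>
        congrFun (congrArg Multiplicative.toAdd hu) i
      have h2 : ∀ i, ∃ k : ℤ, (c u).2 i = 2 * k := fun i => by
        have := (ZMod.intCast_zmod_eq_zero_iff_dvd _ 2).1 (h1 i)
        exact this
      choose f hf using h2
      have h3 : u = ((c u).1 : (𝓞 K)ˣ) * (∏ i, Units.fundSystem K i ^ (f i)) ^ 2 := by
        conv_lhs => rw [hc u]
        congr 1
        rw [← Finset.prod_pow]
        refine Finset.prod_congr rfl fun i _ => ?_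
        rw [hf, mul_comm, zpow_mul]; norm_cast
      rw [h3]
      exact mul_mem_sup (c u).1.2 ⟨_, rfl⟩
  have hsurj : Function.Surjective ψ := by
    intro z
    have : ∀ i, ∃ k : ℤ, (k : ZMod 2) = Multiplicative.toAdd z i := fun i => ZMod.intCast_surjective _
    choose f hf using this
    refine ⟨∏ i, Units.fundSystem K i ^ (f i), ?_⟩
    rw [hψ, hun _ 1 f (by simp)]
    change Multiplicative.ofAdd _ = Multiplicative.ofAdd (Multiplicative.toAdd z)
    congr 1
    funext i
    exact hf i
  rw [hker, Subgroup.index_ker, MonoidHom.range_eq_top_of_surjective ψ hsurj, Subgroup.card_top, Nat.card_eq_fintype_card]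
  simp

lemma relIndex_base : (Sq K).relIndex (US (∅ : Finset (HeightOneSpectrum (𝓞 K)))) = 2 ^ Fintype.card (InfinitePlace K) := by
  let f : (𝓞 K)ˣ →* Kˣ := Units.map (algebraMap (𝓞 K) K).toMonoidHom
  have hintg : ∀ x : K, (∀ p : HeightOneSpectrum (𝓞 K), vl p x ≤ 1) → ∃ y : 𝓞 K, (y : K) = x := fun x h =>
    HeightOneSpectrum.mem_integers_of_valuation_le_one K x h
  have hUS : US (∅ : Finset (HeightOneSpectrum (𝓞 K))) = (⊤ : Subgroup (𝓞 K)ˣ).map f := by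
    ext x
    rw [mem_US, Subgroup.mem_map]
    constructor
    · intro h
      obtain ⟨y, hy⟩ := hintg x (fun p => (h p (by simp)).le)
      obtain ⟨z, hz⟩ := hintg (x⁻¹ : Kˣ) (fun p => by rw [Units.val_inv_eq_inv_val, map_inv₀, h p (by simp), inv_one])
      have : y * z = 1 := by
        apply RingOfIntegers.ext
        rw [coe_mul', hy, hz]; simp
      exact ⟨⟨y, z, this, by rw [mul_comm, this]⟩, trivial, Units.ext hy⟩
    · rintro ⟨u, -, rfl⟩ p _
      have h1 := p.valuation_le_one (K := K) (u : 𝓞 K)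
      have h2 := p.valuation_le_one (K := K) ((u⁻¹ : (𝓞 K)ˣ) : 𝓞 K)
      have h3 : vl p ((u : 𝓞 K) : K) * vl p (((u⁻¹ : (𝓞 K)ˣ) : 𝓞 K) : K) = 1 := by
        rw [← (vl p).map_mul, ← coe_mul', Units.mul_inv]; simp
      refine le_antisymm h1 ?_
      rw [← h3]; exact mul_le_of_le_one_right' h2
  have hcomap : (Sq K).comap f = (powMonoidHom 2 : (𝓞 K)ˣ →* (𝓞 K)ˣ).range := by
    have hf : Function.Injective f := Units.map_injective RingOfIntegers.coe_injective
    ext x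
    rw [Subgroup.mem_comap, mem_Sq]
    constructor
    · rintro ⟨s, hs⟩
      have : s ∈ US (∅ : Finset (HeightOneSpectrum (𝓞 K))) := by
        apply sq_mem_US; rw [← hs, hUS]; exact ⟨x, trivial, rfl⟩
      rw [hUS] at this
      obtain ⟨y, -, rfl⟩ := this
      refine ⟨y, hf ?_⟩
      rw [hs, powMonoidHom_apply, map_pow]
    · rintro ⟨y, rfl⟩
      exact ⟨f y, by rw [powMonoidHom_apply, map_pow]⟩
  rw [hUS, ← Subgroup.relIndex_comap, hcomap, Subgroup.relIndex_top_right,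
    ← Subgroup.relIndex_mul_index (K := Units.torsion K ⊔ (powMonoidHom 2 : (𝓞 K)ˣ →* (𝓞 K)ˣ).range) le_sup_right,
    Subgroup.relIndex_sup_right, torsion_sq, index_tors_sq, ← pow_succ']
  congr 1
  have : 0 < Fintype.card (InfinitePlace K) := Fintype.card_pos
  unfold Units.rank; omega

lemma exists_US_single (p : HeightOneSpectrum (𝓞 K)) : ∃ t : Kˣ, (∀ q ≠ p, vl q (t : K) = 1) ∧ vl p (t : K) ≠ 1 := by
  obtain ⟨h, hpos, ⟨t, ht⟩⟩ : ∃ h : ℕ, h ≠ 0 ∧ (p.asIdeal ^ h).IsPrincipal := by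
    refine ⟨Nat.card (ClassGroup (𝓞 K)), Nat.card_pos.ne', ?_⟩
    let I : nonZeroDivisors (Ideal (𝓞 K)) := ⟨p.asIdeal, mem_nonZeroDivisors_of_ne_zero p.ne_bot⟩
    have : ClassGroup.mk0 (I ^ Nat.card (ClassGroup (𝓞 K))) = 1 := by rw [map_pow, pow_card_eq_one']
    have := (ClassGroup.mk0_eq_one_iff (I ^ Nat.card (ClassGroup (𝓞 K))).2).1 this
    exact this
  have ht0 : (t : K) ≠ 0 := by
    intro h0
    have : t = 0 := by simpa using h0
    rw [this] at ht
    have h3 : p.asIdeal ^ h = ⊥ := by rw [ht]; simp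
    exact pow_ne_zero h p.ne_bot h3
  refine ⟨Units.mk0 t ht0, fun q hq => ?_, ?_⟩
  · obtain ⟨i, hi, h1⟩ := prime_sep hq
    have hi' : i ^ h ∈ p.asIdeal ^ h := Ideal.pow_mem_pow hi h
    rw [ht] at hi'
    obtain ⟨j, hj⟩ := Submodule.mem_span_singleton.1 hi'
    refine le_antisymm (q.valuation_le_one t) ?_
    have h2 : vl q ((i ^ h : 𝓞 K) : K) = 1 := by
      have e : ((i ^ h : 𝓞 K) : K) = (i : K) ^ h := map_pow (algebraMap (𝓞 K) K) i h
      rw [e, (vl q).map_pow, h1, one_pow]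
    rw [← hj, smul_eq_mul, coe_mul', map_mul] at h2
    rw [Units.val_mk0, ← h2]; exact mul_le_of_le_one_left' (q.valuation_le_one j)
  · have : t ∈ p.asIdeal ^ h := by rw [ht]; exact Submodule.mem_span_singleton_self t
    have := (p.valuation_lt_one_iff_mem (K := K) t).2 (Ideal.pow_le_self hpos this)
    exact this.ne

lemma relIndex_step (S : Finset (HeightOneSpectrum (𝓞 K))) (p : HeightOneSpectrum (𝓞 K)) (hp : p ∉ S) [DecidableEq (HeightOneSpectrum (𝓞 K))] :
    (Sq K).relIndex (US (insert p S)) = (Sq K).relIndex (US S) * 2 := by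
  set B := US (insert p S) with hB
  set A := US S with hA
  have hAB : A ≤ B := US_mono (Finset.subset_insert p S)
  -- valuation
  let ν : Kˣ → ℤ := fun x => log (vl p (x : K))
  have hν : ∀ x : Kˣ, vl p (x : K) = exp (ν x) := fun x => (exp_log (vl_ne x)).symm
  have hmul : ∀ x y : Kˣ, ν (x * y) = ν x + ν y := fun x y => by
    have := hν (x * y); rw [Units.val_mul, map_mul, hν x, hν y, ← exp_add, exp_inj] at this; exact this.symm
  have hinv : ∀ x : Kˣ, ν x⁻¹ = - ν x := fun x => by
    have h1 := hmul x x⁻¹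
    have h2 : ν 1 = 0 := by simp [ν]
    rw [mul_inv_cancel, h2] at h1; omega
  have hA' : ∀ x ∈ B, ν x = 0 → x ∈ A := by
    intro x hx h0 q hq
    by_cases hqp : q = p
    · rw [hqp, hν, h0, exp_zero]
    · exact hx q (by simp [hqp, hq])
  have hA0 : ∀ x ∈ A, ν x = 0 := by
    intro x hx
    have := hx p hp
    simp [ν, this]
  let Γ : AddSubgroup ℤ := 
    { carrier := {n | ∃ x ∈ B, ν x = n}
      zero_mem' := ⟨1, one_mem _, by simp [ν]⟩
      add_mem' := by
        rintro _ _ ⟨x, hx, rfl⟩ ⟨y, hy, rfl⟩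
        exact ⟨x * y, mul_mem hx hy, hmul x y⟩
      neg_mem' := by
        rintro _ ⟨x, hx, rfl⟩
        exact ⟨x⁻¹, inv_mem hx, hinv x⟩ }
  obtain ⟨c, hc⟩ := Int.subgroup_cyclic Γ
  have hcΓ : c ∈ Γ := by rw [hc]; exact AddSubgroup.subset_closure rfl
  obtain ⟨t, htB, htc⟩ := hcΓ
  have hdiv : ∀ x ∈ B, ∃ k : ℤ, ν x = k * c := by
    intro x hx
    have : ν x ∈ Γ := ⟨x, hx, rfl⟩
    rw [hc, AddSubgroup.mem_closure_singleton] at this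
    obtain ⟨k, hk⟩ := this
    exact ⟨k, by rw [← hk]; simp⟩
  have hc0 : c ≠ 0 := by
    rintro rfl
    obtain ⟨x, hx1, hx2⟩ := exists_US_single p
    obtain ⟨k, hk⟩ := hdiv x (fun q hq => hx1 q (by rintro rfl; simp at hq))
    apply hx2; rw [hν, hk, mul_zero, exp_zero]
  have hpow : ∀ k : ℤ, ν (t ^ k) = k * c := by
    intro k
    have : vl p ((t ^ k : Kˣ) : K) = exp (k * c) := by
      rw [Units.val_zpow_eq_zpow_val, map_zpow₀, hν t, htc, ← exp_zsmul]; simp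
    rw [hν, exp_inj] at this; exact this
  have hWmem : ∀ x ∈ B, (x ∈ A ⊔ (Sq K ⊓ B) ↔ ∃ k : ℤ, ν x = 2 * k * c) := by
    intro x hx
    constructor
    · intro h
      obtain ⟨a, ha, q, ⟨hq, hqB⟩, rfl⟩ := Subgroup.mem_sup.1 h
      obtain ⟨s, rfl⟩ := mem_Sq.1 hq
      obtain ⟨k, hk⟩ := hdiv s (sq_mem_US hqB)
      refine ⟨k, ?_⟩
      rw [hmul, hA0 a ha, pow_two, hmul, hk]; ring
    · rintro ⟨k, hk⟩
      have h1 : x * (t ^ k)⁻¹ ^ 2 ∈ A := by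
        refine hA' _ (mul_mem hx (pow_mem (inv_mem (zpow_mem htB k)) 2)) ?_
        rw [hmul, pow_two, hmul, hinv, hpow, hk]; ring
      have h2 : (t ^ k) ^ 2 ∈ Sq K ⊓ B := ⟨mem_Sq.2 ⟨_, rfl⟩, pow_mem (zpow_mem htB k) 2⟩
      have := mul_mem_sup h1 h2
      rwa [inv_pow, inv_mul_cancel_right] at this
  have hW2 : (A ⊔ (Sq K ⊓ B)).relIndex B = 2 := by
    rw [Subgroup.relIndex_eq_two_iff]
    refine ⟨t, htB, fun x hx => ?_⟩
    rw [hWmem x hx, hWmem _ (mul_mem hx htB)]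
    obtain ⟨k, hk⟩ := hdiv x hx
    rw [hmul, htc, hk]
    have e1 : (∃ m : ℤ, k * c + c = 2 * m * c) ↔ Odd k := by
      constructor
      · rintro ⟨m, hm⟩
        have : k + 1 = 2 * m := mul_right_cancel₀ hc0 (by linear_combination hm)
        exact ⟨m - 1, by omega⟩
      · rintro ⟨m, rfl⟩; exact ⟨m + 1, by ring⟩
    have e2 : (∃ m : ℤ, k * c = 2 * m * c) ↔ Even k := by
      constructor
      · rintro ⟨m, hm⟩
        have : k = 2 * m := mul_right_cancel₀ hc0 hm
        exact ⟨m, by omega⟩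
      · rintro ⟨m, rfl⟩; exact ⟨m, by ring⟩
    rw [e1, e2]
    rcases Int.even_or_odd k with h | h
    · exact Or.inr ⟨h, Int.not_odd_iff_even.2 h⟩
    · exact Or.inl ⟨h, Int.not_even_iff_odd.2 h⟩
  have h1 := Subgroup.relIndex_mul_relIndex (Sq K ⊓ B) (A ⊔ (Sq K ⊓ B)) B le_sup_right (sup_le hAB inf_le_right)
  rw [hW2, Subgroup.relIndex_sup_right, Subgroup.inf_relIndex_right] at h1
  rw [← h1]
  congr 1
  rw [← Subgroup.inf_relIndex_right, inf_assoc, inf_eq_right.2 hAB, Subgroup.inf_relIndex_right]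

theorem relIndex_US (S : Finset (HeightOneSpectrum (𝓞 K))) :
    (Sq K).relIndex (US S) = 2 ^ (S.card + Fintype.card (InfinitePlace K)) := by
  classical
  induction S using Finset.induction_on with
  | empty => rw [relIndex_base]; simp
  | insert p S hp ih =>
    rw [relIndex_step S p hp, ih, Finset.card_insert_of_notMem hp, ← pow_succ]; congr 1; ring

end units
end TAD

namespace TAD
open Subgroup WithZero IsDedekindDomain NumberField
open scoped WithZero

section places
variable (K : Type*) {L : Type*} [Field K] [NumberField K] [Field L] [NumberField L] [Algebra K L]

/-- the place below -/
noncomputable abbrev un (W : HeightOneSpectrum (𝓞 L)) : HeightOneSpectrum (𝓞 K) := W.under (𝓞 K)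

lemma vl_un (W : HeightOneSpectrum (𝓞 L)) : ∃ e : ℕ, e ≠ 0 ∧ ∀ x : K, vl W (algebraMap K L x) = vl (un K W) x ^ e := by
  have : W.asIdeal.LiesOver (un K W).asIdeal := ⟨rfl⟩
  refine ⟨(un K W).asIdeal.ramificationIdx' W.asIdeal, 
    Ideal.IsDedekindDomain.ramificationIdx'_ne_zero_of_liesOver W.asIdeal (un K W).ne_bot, fun x => ?_⟩
  exact (HeightOneSpectrum.valuation_liesOver L (un K W) W x).symm

lemma vl_un_eq_one (W : HeightOneSpectrum (𝓞 L)) (x : K) : vl W (algebraMap K L x) = 1 ↔ vl (un K W) x = 1 := by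
  obtain ⟨e, he, h⟩ := vl_un K W
  rw [h, pow_eq_one_iff]; simp [he]

lemma vl_un_lt (W : HeightOneSpectrum (𝓞 L)) (x y : K) :
    vl W (algebraMap K L x) < vl W (algebraMap K L y) ↔ vl (un K W) x < vl (un K W) y := by
  obtain ⟨e, he, h⟩ := vl_un K W
  rw [h, h, pow_lt_pow_iff_left₀ zero_le zero_le he]

lemma vl_un_eq (W : HeightOneSpectrum (𝓞 L)) (x y : K) :
    vl W (algebraMap K L x) = vl W (algebraMap K L y) ↔ vl (un K W) x = vl (un K W) y := by
  obtain ⟨e, he, h⟩ := vl_un K W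
  rw [h, h, pow_left_inj₀ zero_le zero_le he]

lemma un_surj (v : HeightOneSpectrum (𝓞 K)) : ∃ W : HeightOneSpectrum (𝓞 L), un K W = v := by
  obtain ⟨v, h1, h2⟩ := v
  obtain ⟨P, hP, rfl⟩ := v.exists_ideal_over_prime_of_isIntegral_of_isDomain (S := 𝓞 L) (by simp)
  refine ⟨⟨P, hP, ?_⟩, rfl⟩
  rintro rfl
  apply h2
  rw [Ideal.comap_bot_of_injective]
  exact FaithfulSMul.algebraMap_injective (𝓞 K) (𝓞 L)

lemma un_fin (v : HeightOneSpectrum (𝓞 K)) : {W : HeightOneSpectrum (𝓞 L) | un K W = v}.Finite := by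
  have h := IsDedekindDomain.primesOver_finite v.asIdeal (𝓞 L)
  refine Set.Finite.of_finite_image (f := HeightOneSpectrum.asIdeal) (h.subset ?_) ?_
  · rintro _ ⟨W, hW, rfl⟩
    refine ⟨W.isPrime, ⟨?_⟩⟩
    rw [← (show un K W = v from hW)]; rfl
  · intro x _ y _ h; exact HeightOneSpectrum.ext h

lemma SL_fin (S : Finset (HeightOneSpectrum (𝓞 K))) : {W : HeightOneSpectrum (𝓞 L) | un K W ∈ S}.Finite := by
  refine (Set.Finite.biUnion S.finite_toSet (fun v _ => un_fin (L := L) K v)).subset ?_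
  intro W hW
  simp only [Set.mem_iUnion]
  exact ⟨un K W, hW, rfl⟩

variable {K} in
variable (L) in
/-- places above S -/
noncomputable def SL (S : Finset (HeightOneSpectrum (𝓞 K))) : Finset (HeightOneSpectrum (𝓞 L)) := (SL_fin K S).toFinset

variable {K}
lemma mem_SL {S : Finset (HeightOneSpectrum (𝓞 K))} {W : HeightOneSpectrum (𝓞 L)} : W ∈ SL L S ↔ un K W ∈ S := by
  simp [SL]

/-- inclusion on units -/
noncomputable abbrev ι (K L : Type*) [Field K] [Field L] [Algebra K L] : Kˣ →* Lˣ := Units.map (algebraMap K L).toMonoidHom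

lemma ι_val (x : Kˣ) : ((ι K L x : Lˣ) : L) = algebraMap K L (x : K) := rfl

lemma D_up {W : HeightOneSpectrum (𝓞 L)} {x : Kˣ} (h : x ∈ Dval (vl (un K W))) : ι K L x ∈ Dval (vl W) := by
  obtain ⟨s, hs⟩ := mem_Dval.1 h
  refine mem_Dval.2 ⟨ι K L s, ?_⟩
  have := (vl_un_lt K W _ _).2 hs
  simpa [map_ofNat (algebraMap K L) 4] using this

lemma ι_mem_US {S : Finset (HeightOneSpectrum (𝓞 K))} {x : Kˣ} : ι K L x ∈ US (SL L S) ↔ x ∈ US S := by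
  constructor
  · intro h v hv
    obtain ⟨W, rfl⟩ := un_surj (L := L) K v
    exact (vl_un_eq_one K W _).1 (h W (by rwa [mem_SL]))
  · intro h W hW
    rw [mem_SL] at hW
    exact (vl_un_eq_one K W _).2 (h _ hW)

lemma vl_ext {p : HeightOneSpectrum (𝓞 L)} {v : Valuation L ℤᵐ⁰}
    (h : ∀ r : 𝓞 L, vl p (r : L) = v (r : L)) (x : L) : vl p x = v x := by
  obtain ⟨a, b, hb, rfl⟩ := IsFractionRing.div_surjective (A := 𝓞 L) x
  rw [map_div₀, map_div₀, h, h]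

lemma place_equiv (σ : L ≃ₐ[K] L) (W : HeightOneSpectrum (𝓞 L)) :
    ∃ W' : HeightOneSpectrum (𝓞 L), (∀ z, vl W' z = vl W (σ z)) ∧ un K W' = un K W := by
  let e := RingOfIntegers.mapRingEquiv (σ : L ≃+* L)
  have he : ∀ r, ((e r : 𝓞 L) : L) = σ r := fun r => rfl
  have hprime : (W.asIdeal.comap e).IsPrime := inferInstance
  let W' : HeightOneSpectrum (𝓞 L) := ⟨W.asIdeal.comap e, hprime, by
    intro h
    obtain ⟨r, hr, hr0⟩ := Submodule.exists_mem_ne_zero_of_ne_bot W.ne_bot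
    have : e.symm r ∈ W.asIdeal.comap e := by rw [Ideal.mem_comap, RingEquiv.apply_symm_apply]; exact hr
    rw [h] at this
    exact hr0 (by simpa using this)⟩
  have hpow : ∀ n : ℕ, W'.asIdeal ^ n = (W.asIdeal ^ n).comap e := by
    intro n
    change (W.asIdeal.comap e) ^ n = _
    rw [← Ideal.map_symm, ← Ideal.map_symm, Ideal.map_pow]
  have h1 : ∀ z, vl W' z = vl W (σ z) := by
    have : ∀ r : 𝓞 L, vl W' (r : L) = (vl W).comap (σ : L →+* L) (r : L) := by
      intro r
      change vl W' (r : L) = vl W (σ r)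
      by_cases hr : r = 0
      · simp [hr]
      have hm : ∀ n : ℕ, vl W' (r : L) ≤ exp (-(n:ℤ)) ↔ vl W (σ r) ≤ exp (-(n:ℤ)) := by
        intro n
        rw [← mem_pow_iff, ← he, ← mem_pow_iff, hpow, Ideal.mem_comap]
      have key : ∀ x y : ℤᵐ⁰, x ≠ 0 → x ≤ 1 → (x ≤ y ↔ x ≤ y) := fun _ _ _ _ => Iff.rfl
      have hrL : (r : L) ≠ 0 := by simpa using hr
      have ex : ∀ (p : HeightOneSpectrum (𝓞 L)) (s : 𝓞 L), s ≠ 0 → ∃ n : ℕ, vl p (s : L) = exp (-(n : ℤ)) := by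
        intro p s hs
        have h1 := p.valuation_le_one (K := L) s
        have h0 : vl p (s : L) ≠ 0 := by rw [Valuation.ne_zero_iff]; simpa using hs
        have h2 := exp_log h0
        change vl p (s : L) ≤ 1 at h1
        rw [← h2, ← exp_zero, exp_le_exp] at h1
        refine ⟨(-log (vl p (s : L))).toNat, ?_⟩
        rw [Int.toNat_of_nonneg (by omega), neg_neg, h2]
      obtain ⟨n, hn⟩ := ex W' r hr
      obtain ⟨m, hm'⟩ := ex W (e r) (by simpa using hr)
      rw [he] at hm'
      apply le_antisymm
      · rw [hm', hm, hm']
      · rw [hn, ← hm, hn]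
    exact vl_ext this
  refine ⟨W', h1, ?_⟩
  apply HeightOneSpectrum.ext
  ext r
  have h2 : ∀ (W : HeightOneSpectrum (𝓞 L)), r ∈ (un K W).asIdeal ↔ vl W (algebraMap K L r) < 1 := by
    intro W
    have := vl_un_lt K W (r : K) 1
    rw [map_one, map_one, map_one] at this
    rw [this]
    exact ((un K W).valuation_lt_one_iff_mem (K := K) r).symm
  rw [h2, h2, h1, σ.commutes]

end places
end TAD

namespace TAD
open Subgroup WithZero IsDedekindDomain NumberField
open scoped WithZero

/-- quadratic extension data -/
structure Quad (K L : Type*) [Field K] [Field L] [Algebra K L] (a : Kˣ) where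
  θ : Lˣ
  σ : L ≃ₐ[K] L
  hθ : (θ : L) ^ 2 = algebraMap K L a
  hσ : σ θ = - θ
  span : ∀ z : L, ∃ p q : K, z = algebraMap K L p + algebraMap K L q * θ

section quadex
open Polynomial
universe u
variable {K : Type u} [Field K] [NumberField K]

lemma exists_quad (a : Kˣ) (ha : a ∉ Sq K) : ∃ (L : Type u) (_ : Field L) (_ : NumberField L) (_ : Algebra K L),
    Nonempty (Quad K L a) := by
  let f : K[X] := X ^ 2 - C (a : K)
  have hirr : Irreducible f := by
    rw [X_pow_sub_C_irreducible_iff_of_prime Nat.prime_two]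
    intro b hb
    have hb0 : b ≠ 0 := by
      rintro rfl; exact a.ne_zero (by rw [← hb]; simp)
    exact ha (mem_Sq.2 ⟨Units.mk0 b hb0, Units.ext (by simp [hb])⟩)
  have hmon : f.Monic := monic_X_pow_sub_C _ (by norm_num)
  have : Fact (Irreducible f) := ⟨hirr⟩
  have : Module.Finite K (AdjoinRoot f) := hmon.finite_adjoinRoot
  have hr : (AdjoinRoot.root f) ^ 2 = algebraMap K (AdjoinRoot f) a := by
    have := AdjoinRoot.eval₂_root f
    simp only [f, eval₂_sub, eval₂_pow, eval₂_X, eval₂_C] at this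
    exact sub_eq_zero.1 this
  have hr0 : AdjoinRoot.root f ≠ 0 := by
    intro h
    rw [h] at hr
    have : algebraMap K (AdjoinRoot f) a = 0 := by rw [← hr]; simp
    exact a.ne_zero (by simpa using this)
  let s : AdjoinRoot f →ₐ[K] AdjoinRoot f := AdjoinRoot.liftAlgHom f (Algebra.ofId K _) (- AdjoinRoot.root f) (by
    simp only [f, eval₂_sub, eval₂_pow, eval₂_X, eval₂_C, neg_sq, hr]; exact sub_self _)
  have hs : s (AdjoinRoot.root f) = - AdjoinRoot.root f := AdjoinRoot.liftAlgHom_root ..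
  have hss : s.comp s = AlgHom.id K _ := by
    apply AdjoinRoot.algHom_ext
    simp [hs]
  refine ⟨AdjoinRoot f, inferInstance, NumberField.of_module_finite K _, inferInstance, ⟨⟨Units.mk0 _ hr0, AlgEquiv.ofAlgHom s s hss hss, hr, hs, ?_⟩⟩⟩
  intro z
  obtain ⟨g, rfl⟩ := AdjoinRoot.mk_surjective z
  have h1 : (g %ₘ f).natDegree ≤ 1 := by
    have := natDegree_modByMonic_lt g hmon (by rintro h; have := congrArg natDegree h; simp [f] at this)
    have h2 : f.natDegree = 2 := natDegree_X_pow_sub_C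
    omega
  obtain ⟨q, p, hq⟩ := exists_eq_X_add_C_of_natDegree_le_one h1
  refine ⟨p, q, ?_⟩
  have h3 : AdjoinRoot.mk f g = AdjoinRoot.mk f (g %ₘ f) := by
    conv_lhs => rw [← modByMonic_add_div g f]
    simp
  rw [h3, hq]
  simp [AdjoinRoot.algebraMap_eq, add_comm]

end quadex

namespace Quad
variable {K L : Type*} [Field K] [NumberField K] [Field L] [NumberField L] [Algebra K L] {a : Kˣ}

lemma indep (Q : Quad K L a) {p q : K} (h : algebraMap K L p + algebraMap K L q * Q.θ = 0) : p = 0 ∧ q = 0 := by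
  have h2 := congrArg Q.σ h
  simp only [map_add, map_mul, AlgEquiv.commutes, Q.hσ, map_zero] at h2
  have h3 : algebraMap K L (2 * p) = 0 := by
    rw [map_mul, map_ofNat]; linear_combination h + h2
  have hp : p = 0 := by simpa using h3
  refine ⟨hp, ?_⟩
  rw [hp, map_zero, zero_add] at h
  simpa using h

lemma σσ (Q : Quad K L a) (z : L) : Q.σ (Q.σ z) = z := by
  obtain ⟨p, q, rfl⟩ := Q.span z
  simp [Q.hσ]

lemma ι_inj (Q : Quad K L a) : Function.Injective (ι K L) := Units.map_injective (algebraMap K L).injective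

/-- conjugation on units -/
noncomputable def s (Q : Quad K L a) : Lˣ →* Lˣ := Units.map (Q.σ : L →* L)

lemma s_val (Q : Quad K L a) (z : Lˣ) : ((Q.s z : Lˣ) : L) = Q.σ z := rfl

lemma exists_N (Q : Quad K L a) (z : Lˣ) : ∃ n : Kˣ, ι K L n = z * Q.s z ∧ n ∈ Nm a := by
  obtain ⟨p, q, h⟩ := Q.span z
  have h1 : algebraMap K L (p ^ 2 - a * q ^ 2) = z * Q.σ z := by
    rw [h]
    simp only [map_add, map_mul, map_sub, map_pow, AlgEquiv.commutes, Q.hσ]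
    rw [← Q.hθ]; ring
  have h0 : p ^ 2 - a * q ^ 2 ≠ 0 := by
    intro h0
    rw [h0, map_zero] at h1
    have := (z * Q.s z).ne_zero
    exact this (by rw [Units.val_mul, s_val, ← h1])
  exact ⟨Units.mk0 _ h0, Units.ext h1, mem_Nm.2 ⟨p, q, rfl⟩⟩

/-- norm -/
noncomputable def N (Q : Quad K L a) : Lˣ →* Kˣ := MonoidHom.mk' (fun z => (Q.exists_N z).choose) (by
  intro x y
  apply Q.ι_inj
  refine (Q.exists_N (x * y)).choose_spec.1.trans (Eq.trans ?_ (map_mul (ι K L) _ _).symm)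
  refine Eq.trans ?_ (congrArg₂ (· * ·) (Q.exists_N x).choose_spec.1 (Q.exists_N y).choose_spec.1).symm
  simp only [map_mul]
  exact mul_mul_mul_comm _ _ _ _)

lemma ι_N (Q : Quad K L a) (z : Lˣ) : ι K L (Q.N z) = z * Q.s z := (Q.exists_N z).choose_spec.1
lemma N_mem (Q : Quad K L a) (z : Lˣ) : Q.N z ∈ Nm a := (Q.exists_N z).choose_spec.2
lemma s_ι (Q : Quad K L a) (x : Kˣ) : Q.s (ι K L x) = ι K L x := Units.ext (Q.σ.commutes _)
lemma N_ι (Q : Quad K L a) (x : Kˣ) : Q.N (ι K L x) = x ^ 2 := by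
  apply Q.ι_inj; rw [ι_N, s_ι, map_pow, pow_two]

lemma mem_Nm_iff (Q : Quad K L a) (x : Kˣ) : x ∈ Nm a ↔ ∃ z, Q.N z = x := by
  constructor
  · intro h
    obtain ⟨p, q, h⟩ := mem_Nm.1 h
    have h1 : algebraMap K L x = (algebraMap K L p + algebraMap K L q * Q.θ) * (algebraMap K L p - algebraMap K L q * Q.θ) := by
      rw [h]; simp only [map_mul, map_sub, map_pow]
      rw [← Q.hθ]; ring
    have h0 : algebraMap K L p + algebraMap K L q * Q.θ ≠ 0 := by
      intro h0; rw [h0, zero_mul] at h1; exact x.ne_zero (by simpa using h1)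
    refine ⟨Units.mk0 _ h0, Q.ι_inj (Units.ext ?_)⟩
    rw [ι_N, Units.val_mul, s_val, ι_val, h1, Units.val_mk0]
    simp [Q.hσ]; left; ring
  · rintro ⟨z, rfl⟩; exact Q.N_mem z

lemma sq_iff (Q : Quad K L a) (x : Kˣ) : ι K L x ∈ Sq L ↔ x ∈ Sq K ∨ x * a ∈ Sq K := by
  constructor
  · intro h
    obtain ⟨z, hz⟩ := mem_Sq.1 h
    obtain ⟨p, q, h⟩ := Q.span z
    have h1 : algebraMap K L (p ^ 2 + a * q ^ 2 - x) + algebraMap K L (2 * p * q) * Q.θ = 0 := by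
      have : algebraMap K L x = (z : L) ^ 2 := congrArg Units.val hz
      simp only [map_mul, map_sub, map_pow, map_add, map_ofNat]
      rw [this, h, ← Q.hθ]; ring
    obtain ⟨h2, h3⟩ := Q.indep h1
    have h4 : p * q = 0 := by
      have : (2 : K) ≠ 0 := two_ne_zero
      apply mul_left_cancel₀ this; linear_combination h3
    rcases mul_eq_zero.1 h4 with rfl | rfl
    · right
      have hx : (x : K) * a = (a * q) ^ 2 := by linear_combination - (a : K) * h2
      have h0 : (a : K) * q ≠ 0 := by
        intro h0; rw [h0] at hx; exact (x * a).ne_zero (by simp [hx])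
      exact mem_Sq.2 ⟨Units.mk0 _ h0, Units.ext (by simp [hx])⟩
    · left
      have hx : (x : K) = p ^ 2 := by linear_combination - h2
      have h0 : p ≠ 0 := by
        intro h0; rw [h0] at hx; exact x.ne_zero (by simp [hx])
      exact mem_Sq.2 ⟨Units.mk0 _ h0, Units.ext (by simp [hx])⟩
  · have ha : ι K L a = Q.θ ^ 2 := Units.ext (by simp [Q.hθ])
    rintro (h | h)
    · obtain ⟨t, rfl⟩ := mem_Sq.1 h
      exact mem_Sq.2 ⟨ι K L t, map_pow _ _ _⟩
    · obtain ⟨t, ht⟩ := mem_Sq.1 h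
      refine mem_Sq.2 ⟨ι K L t / Q.θ, ?_⟩
      rw [div_pow, ← map_pow, ← ht, map_mul, ← ha, mul_div_cancel_right]

lemma ι_a (Q : Quad K L a) : ι K L a = Q.θ ^ 2 := Units.ext (by simp [Q.hθ])

lemma hilbert90 (Q : Quad K L a) (z : Lˣ) (hz : z * Q.s z = 1) : ∃ y : Lˣ, z * Q.s y = y := by
  by_cases h : (z : L) = -1
  · refine ⟨Q.θ, Units.ext ?_⟩
    rw [Units.val_mul, s_val, Q.hσ, h]; ring
  · have h0 : (1 : L) + z ≠ 0 := by
      intro h0; exact h (by linear_combination h0)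
    refine ⟨Units.mk0 _ h0, Units.ext ?_⟩
    have : (z : L) * Q.σ z = 1 := congrArg Units.val hz
    rw [Units.val_mul, s_val, Units.val_mk0, map_add, map_one]
    linear_combination this

end Quad
end TAD

namespace TAD
open Subgroup WithZero IsDedekindDomain NumberField
open scoped WithZero

section
variable {K : Type*} [Field K] [NumberField K]
/-- S together with infinite places -/
noncomputable def SI (S : Finset (HeightOneSpectrum (𝓞 K))) : Finset (Pl K) := S.disjSum Finset.univ

lemma SI_card (S : Finset (HeightOneSpectrum (𝓞 K))) : (SI S).card = S.card + Fintype.card (InfinitePlace K) := by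
  simp [SI]

@[simp] lemma inl_mem_SI {S : Finset (HeightOneSpectrum (𝓞 K))} {p} : (Sum.inl p : Pl K) ∈ SI S ↔ p ∈ S := by simp [SI]
@[simp] lemma inr_mem_SI {S : Finset (HeightOneSpectrum (𝓞 K))} {w} : (Sum.inr w : Pl K) ∈ SI S := by simp [SI]
end

namespace Quad
variable {K L : Type*} [Field K] [NumberField K] [Field L] [NumberField L] [Algebra K L] {a : Kˣ}

lemma ne_of_D (Q : Quad K L a) (W : HeightOneSpectrum (𝓞 L)) (h : a ∈ Dval (vl (un K W))) : ∃ W' : HeightOneSpectrum (𝓞 L),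
    (∀ z, vl W' z = vl W (Q.σ z)) ∧ un K W' = un K W ∧ W' ≠ W := by
  obtain ⟨W', h1, h2⟩ := place_equiv Q.σ W
  refine ⟨W', h1, h2, ?_⟩
  rintro rfl
  obtain ⟨s, hs⟩ := mem_Dval.1 h
  rw [← vl_un_lt] at hs
  set t := algebraMap K L s with ht
  have e1 : algebraMap K L (a * (s : K) ^ 2 - 1) = - ((1 - t * Q.θ) * (1 + t * Q.θ)) := by
    rw [map_sub, map_mul, map_pow, ← Q.hθ, map_one]; ring
  have e2 : vl W' (1 + t * Q.θ) = vl W' (1 - t * Q.θ) := by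
    rw [h1]; congr 1; simp [Q.hσ, ht]; ring
  rw [e1, Valuation.map_neg, map_mul, e2, map_ofNat] at hs
  have e3 : vl W' 2 ≤ vl W' (1 - t * Q.θ) := by
    have := (vl W').map_add (1 - t * Q.θ) (1 + t * Q.θ)
    rw [e2, max_self] at this
    convert this using 2; ring
  have e4 : vl W' 4 = vl W' 2 * vl W' 2 := by rw [← map_mul]; norm_num
  rw [e4] at hs
  exact absurd (mul_le_mul' e3 e3) (not_le.2 hs)

lemma inf_two (Q : Quad K L a) (v : InfinitePlace K) (h : a ∈ Dinf v) : ∃ W W' : InfinitePlace L,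
    W.comap (algebraMap K L) = v ∧ W'.comap (algebraMap K L) = v ∧ W ≠ W' := by
  obtain ⟨W, hW⟩ := InfinitePlace.comap_surjective (K := L) v
  set ψ := W.embedding with hψ
  have hWm : InfinitePlace.mk ψ = W := InfinitePlace.mk_embedding W
  have e : (ψ.comp (Q.σ : L →+* L)).comp (algebraMap K L) = ψ.comp (algebraMap K L) := by
    ext x; simp
  have hc : (InfinitePlace.mk ψ).comap (algebraMap K L) = v := by rw [hWm]; exact hW
  have hc' := hc
  rw [InfinitePlace.comap_mk] at hc'
  refine ⟨InfinitePlace.mk ψ, InfinitePlace.mk (ψ.comp (Q.σ : L →+* L)), hc, ?_, ?_⟩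
  · rw [InfinitePlace.comap_mk, e, hc']
  · intro heq
    rcases InfinitePlace.mk_eq_iff.1 heq with h1 | h1
    · have := congrArg (fun f : L →+* ℂ => f Q.θ) h1
      simp [Q.hσ, self_eq_neg] at this
    · have h2 : ComplexEmbedding.IsReal (ψ.comp (algebraMap K L)) := by
        ext x
        have := congrArg (fun f : L →+* ℂ => f (algebraMap K L x)) h1
        simpa using this
      have hr : v.IsReal := ⟨_, h2, hc'⟩
      have hpos := mem_Dinf.1 h hr
      have h3 : ((InfinitePlace.embedding_of_isReal hr (a : K) : ℝ) : ℂ) = ψ Q.θ ^ 2 := by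
        rw [InfinitePlace.embedding_of_isReal_apply, ← map_pow, Q.hθ]
        have : v.embedding = ψ.comp (algebraMap K L) := by
          conv_lhs => rw [← hc']
          exact InfinitePlace.embedding_mk_eq_of_isReal h2
        rw [this]; rfl
      have h4 : (starRingEnd ℂ) (ψ Q.θ) = - ψ Q.θ := by
        have := congrArg (fun f : L →+* ℂ => f Q.θ) h1
        simpa [Q.hσ] using this
      set r := InfinitePlace.embedding_of_isReal hr (a : K)
      have h5 : (Complex.normSq (ψ Q.θ) : ℂ) = - (r : ℂ) := by
        rw [Complex.normSq_eq_conj_mul_self, h4, h3]; ring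
      have h6 : Complex.normSq (ψ Q.θ) = - r := by exact_mod_cast h5
      have := Complex.normSq_nonneg (ψ Q.θ)
      linarith

open Classical in
lemma place_count (Q : Quad K L a) (S : Finset (HeightOneSpectrum (𝓞 K))) :
    2 * (SI S).card ≤ (SI (SL L S)).card + ((SI S).filter (fun v => a ∉ D v)).card := by
  let f : Pl L → Pl K := Sum.map (un K) (fun W => W.comap (algebraMap K L))
  have hm : ∀ W ∈ SI (SL L S), f W ∈ SI S := by
    rintro (W | W) hW
    · change Sum.inl (un K W) ∈ SI S
      rw [inl_mem_SI] at hW ⊢; exact mem_SL.1 hW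
    · exact inr_mem_SI
  have h0 : ∀ W, f W ∈ SI S → W ∈ SI (SL L S) := by
    rintro (W | W) hW
    · change Sum.inl (un K W) ∈ SI S at hW
      rw [inl_mem_SI] at hW ⊢; exact mem_SL.2 hW
    · exact inr_mem_SI
  have h1 : ∀ v, ∃ W, f W = v := by
    rintro (v | v)
    · obtain ⟨W, hW⟩ := un_surj (L := L) K v
      exact ⟨Sum.inl W, by simp [f, hW]⟩
    · obtain ⟨W, hW⟩ := InfinitePlace.comap_surjective (K := L) v
      exact ⟨Sum.inr W, by simp [f, hW]⟩
  have h2 : ∀ v, a ∈ D v → ∃ W W', f W = v ∧ f W' = v ∧ W ≠ W' := by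
    rintro (v | v) ha
    · obtain ⟨W, rfl⟩ := un_surj (L := L) K v
      obtain ⟨W', -, h3, h4⟩ := Q.ne_of_D W ha
      exact ⟨Sum.inl W', Sum.inl W, by simp [f, h3], rfl, by simpa using h4⟩
    · obtain ⟨W, W', h3, h4, h5⟩ := Q.inf_two v ha
      exact ⟨Sum.inr W, Sum.inr W', by simp [f, h3], by simp [f, h4], by simpa using h5⟩
  rw [Finset.card_eq_sum_card_fiberwise hm, Finset.card_filter, ← Finset.sum_add_distrib, mul_comm, ← smul_eq_mul, ← Finset.sum_const]
  refine Finset.sum_le_sum fun v hv => ?_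
  by_cases ha : a ∈ D v
  · obtain ⟨W, W', h3, h4, h5⟩ := h2 v ha
    simp only [ha, not_true_eq_false, if_false, add_zero]
    rw [← Finset.card_pair h5]
    apply Finset.card_le_card
    intro x hx
    rw [Finset.mem_insert, Finset.mem_singleton] at hx
    rw [Finset.mem_filter]
    rcases hx with rfl | rfl
    · exact ⟨h0 _ (h3 ▸ hv), h3⟩
    · exact ⟨h0 _ (h4 ▸ hv), h4⟩
  · simp only [ha, not_false_eq_true, if_true]
    obtain ⟨W, h3⟩ := h1 v
    have : 0 < (Finset.filter (fun x => f x = v) (SI (SL L S))).card :=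
      Finset.card_pos.2 ⟨W, Finset.mem_filter.2 ⟨h0 _ (h3 ▸ hv), h3⟩⟩
    omega

variable {S : Finset (HeightOneSpectrum (𝓞 K))}

lemma s_mem (Q : Quad K L a) {z : Lˣ} (hz : z ∈ US (SL L S)) : Q.s z ∈ US (SL L S) := by
  intro W hW
  obtain ⟨W', h1, h2⟩ := place_equiv Q.σ W
  rw [s_val, ← h1]
  exact hz W' (by rw [mem_SL, h2]; rwa [mem_SL] at hW)

lemma N_mem_US (Q : Quad K L a) {z : Lˣ} (hz : z ∈ US (SL L S)) : Q.N z ∈ US S := by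
  rw [← ι_mem_US (L := L), Q.ι_N]
  exact mul_mem hz (Q.s_mem hz)

lemma ker_US (Q : Quad K L a) (hS : Big S) (h2 : ∀ v ∉ S, vl v (2 : K) = 1) (haS : a ∈ US S) {z : Lˣ} (hz : z ∈ US (SL L S)) (h1 : Q.N z = 1) :
    ∃ y ∈ US (SL L S), z * Q.s y = y := by
  have hz1 : z * Q.s z = 1 := by rw [← Q.ι_N, h1, map_one]
  obtain ⟨y, hy⟩ := Q.hilbert90 z hz1
  obtain ⟨p, q, hpq⟩ := Q.span y
  have h0 : p ≠ 0 ∨ q ≠ 0 := by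
    by_contra h; push Not at h
    rw [h.1, h.2] at hpq; exact y.ne_zero (by rw [hpq]; simp)
  obtain ⟨k, hk⟩ := hS.sup p q h0
  refine ⟨y * (ι K L k)⁻¹, ?_, ?_⟩
  · intro W hW
    have hv : un K W ∉ S := by rwa [mem_SL] at hW
    have hθ : vl W (Q.θ : L) = 1 := by
      have := (vl_un_eq_one K W a).2 (haS _ hv)
      rw [← Q.hθ, map_pow, pow_eq_one_iff] at this
      simpa using this
    have h2' : vl W (2 : L) = 1 := by
      have := (vl_un_eq_one K W 2).2 (h2 _ hv)
      rwa [map_ofNat] at this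
    have hys : vl W (Q.σ y) = vl W (y : L) := by
      have h3 : (z : L) * Q.σ y = y := congrArg Units.val hy
      conv_rhs => rw [← h3]
      rw [map_mul, hz W hW, one_mul]
    have hσy : Q.σ y = algebraMap K L p - algebraMap K L q * Q.θ := by
      rw [hpq]; simp [Q.hσ]; ring
    obtain ⟨e, he, hpow⟩ := vl_un K W
    have hp : vl W (algebraMap K L p) ≤ vl W (y : L) := by
      have := (vl W).map_add (y : L) (Q.σ y)
      rw [hys, max_self] at this
      have e1 : (y : L) + Q.σ y = 2 * algebraMap K L p := by rw [hσy, hpq]; ring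
      rwa [e1, map_mul, h2', one_mul] at this
    have hq : vl W (algebraMap K L q) ≤ vl W (y : L) := by
      have := (vl W).map_sub (y : L) (Q.σ y)
      rw [hys, max_self] at this
      have e1 : (y : L) - Q.σ y = 2 * algebraMap K L q * Q.θ := by rw [hσy, hpq]; ring
      rwa [e1, map_mul, map_mul, h2', one_mul, hθ, mul_one] at this
    have hle : vl W (y : L) ≤ max (vl W (algebraMap K L p)) (vl W (algebraMap K L q)) := by
      have := (vl W).map_add (algebraMap K L p) (algebraMap K L q * Q.θ)
      rwa [← hpq, map_mul, hθ, mul_one] at this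
    have hyk : vl W (algebraMap K L k) = vl W (y : L) := by
      apply le_antisymm
      · rw [hpow, hk _ hv]
        rcases max_choice (vl (un K W) p) (vl (un K W) q) with h | h
        · rw [h, ← hpow]; exact hp
        · rw [h, ← hpow]; exact hq
      · refine hle.trans (max_le ?_ ?_)
        · rw [hpow, hpow, hk _ hv]; exact pow_le_pow_left₀ zero_le (le_max_left _ _) _
        · rw [hpow, hpow, hk _ hv]; exact pow_le_pow_left₀ zero_le (le_max_right _ _) _
    rw [Units.val_mul, map_mul, Units.val_inv_eq_inv_val, ι_val, map_inv₀, hyk]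
    exact mul_inv_cancel₀ ((vl W).ne_zero_iff.2 y.ne_zero)
  · rw [map_mul, map_inv, Q.s_ι, ← mul_assoc, hy]

open Classical in
theorem lemmaH (Q : Quad K L a) (ha : a ∉ Sq K) (hS : Big S) (h2 : ∀ v ∉ S, vl v (2 : K) = 1) (haS : a ∈ US S) :
    (Nm a).relIndex (US S) ≠ 0 ∧ 
    2 * (Nm a).relIndex (US S) ≤ 2 ^ ((SI S).filter (fun v => a ∉ D v)).card := by
  set U := US S with hU
  set V := US (SL L S) with hV
  set U' := U.map (ι K L) with hU'
  set U2 := Sq K ⊓ U with hU2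
  set NV := V.map Q.N with hNV
  have hU'V : U' ≤ V := by
    rintro _ ⟨u, hu, rfl⟩; exact ι_mem_US.2 hu
  have hNVU : NV ≤ U := by
    rintro _ ⟨z, hz, rfl⟩; exact Q.N_mem_US hz
  have hU2NV : U2 ≤ NV := by
    rintro _ ⟨hx, hxU⟩
    obtain ⟨s, rfl⟩ := mem_Sq.1 hx
    exact ⟨ι K L s, hU'V ⟨s, sq_mem_US hxU, rfl⟩, Q.N_ι s⟩
  have hNVNm : NV ≤ Nm a := by
    rintro _ ⟨z, hz, rfl⟩; exact Q.N_mem z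
  have e1 : U2.relIndex NV * NV.relIndex U = 2 ^ (SI S).card := by
    rw [Subgroup.relIndex_mul_relIndex _ _ _ hU2NV hNVU, Subgroup.inf_relIndex_right, relIndex_US, SI_card]
  have e2 : U2.relIndex NV = (U' ⊔ Sq L).relIndex V := by
    rw [hNV, ← Subgroup.relIndex_comap, ← Subgroup.inf_relIndex_right, ← Subgroup.inf_relIndex_right (U' ⊔ Sq L)]
    congr 1
    ext z
    simp only [Subgroup.mem_inf]
    refine and_congr_left fun hz => ?_
    rw [Subgroup.mem_comap]
    constructor
    · rintro ⟨hx, hxU⟩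
      obtain ⟨u, hu⟩ := mem_Sq.1 hx
      have huU : u ∈ U := sq_mem_US (by rw [← hu]; exact hxU)
      have hz1 : z * (ι K L u)⁻¹ ∈ V := mul_mem hz (inv_mem (hU'V ⟨u, huU, rfl⟩))
      have hz2 : Q.N (z * (ι K L u)⁻¹) = 1 := by rw [map_mul, map_inv, Q.N_ι, hu, mul_inv_cancel]
      obtain ⟨y, hy, hzy⟩ := Q.ker_US hS h2 haS hz1 hz2
      have : z = ι K L (u * (Q.N y)⁻¹) * y ^ 2 := by
        rw [map_mul, map_inv, Q.ι_N]
        have h3 : z = y * (Q.s y)⁻¹ * ι K L u :=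
          mul_inv_eq_iff_eq_mul.1 (eq_mul_inv_of_mul_eq hzy)
        rw [h3, pow_two, mul_inv]
        simp only [mul_comm, mul_left_comm, mul_assoc, mul_inv_cancel_left, inv_mul_cancel_left]
      rw [this]
      exact mul_mem_sup ⟨_, mul_mem huU (inv_mem (Q.N_mem_US hy)), rfl⟩ (mem_Sq.2 ⟨y, rfl⟩)
    · intro h
      obtain ⟨_, ⟨u, hu, rfl⟩, q, hq, rfl⟩ := Subgroup.mem_sup.1 h
      obtain ⟨y, rfl⟩ := mem_Sq.1 hq
      refine ⟨?_, hNVU ⟨_, hz, rfl⟩⟩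
      rw [map_mul, Q.N_ι, map_pow, ← mul_pow]
      exact mem_Sq.2 ⟨_, rfl⟩
  have e3 : ((Sq L).comap (ι K L)).relIndex U * (U' ⊔ Sq L).relIndex V = 2 ^ (SI (SL L S)).card := by
    rw [SI_card, ← relIndex_US, ← Subgroup.inf_relIndex_right (Sq L)]
    have hmod : (U' ⊔ Sq L) ⊓ V = U' ⊔ (Sq L ⊓ V) := sup_inf_assoc_of_le _ hU'V
    rw [← Subgroup.inf_relIndex_right (U' ⊔ Sq L), hmod, ← Subgroup.relIndex_mul_relIndex (Sq L ⊓ V) (U' ⊔ (Sq L ⊓ V)) V le_sup_right (sup_le hU'V inf_le_right),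
      Subgroup.relIndex_sup_right, Subgroup.relIndex_comap]
    congr 1
    rw [← Subgroup.inf_relIndex_right, ← Subgroup.inf_relIndex_right (Sq L ⊓ V), inf_assoc, inf_eq_right.2 hU'V]
  have e4 : 2 * ((Sq L).comap (ι K L)).relIndex U = 2 ^ (SI S).card := by
    set C := (Sq L).comap (ι K L)
    have hle : Sq K ⊓ U ≤ C ⊓ U := inf_le_inf_right _ (by
      intro x hx; exact (Q.sq_iff x).2 (Or.inl hx))
    rw [SI_card, ← relIndex_US, ← Subgroup.inf_relIndex_right (Sq K), ← Subgroup.inf_relIndex_right C,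
      ← Subgroup.relIndex_mul_relIndex (Sq K ⊓ U) (C ⊓ U) U hle inf_le_right]
    congr 1
    symm
    rw [Subgroup.relIndex_eq_two_iff]
    have haC : a ∈ C := by
      rw [Subgroup.mem_comap, Q.ι_a]; exact mem_Sq.2 ⟨_, rfl⟩
    refine ⟨a, ⟨haC, haS⟩, ?_⟩
    rintro x ⟨hxC, hxU⟩
    have h3 : x * a ∈ Sq K ⊓ U ↔ x * a ∈ Sq K := ⟨fun h => h.1, fun h => ⟨h, mul_mem hxU haS⟩⟩
    have h4 : x ∈ Sq K ⊓ U ↔ x ∈ Sq K := ⟨fun h => h.1, fun h => ⟨h, hxU⟩⟩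
    rw [h3, h4]
    have hno : ¬ (x * a ∈ Sq K ∧ x ∈ Sq K) := fun ⟨h5, h6⟩ => ha (by
      have := mul_mem (inv_mem h6) h5
      rwa [inv_mul_cancel_left] at this)
    rcases (Q.sq_iff x).1 hxC with h | h
    · exact Or.inr ⟨h, fun h' => hno ⟨h', h⟩⟩
    · exact Or.inl ⟨h, fun h' => hno ⟨h, h'⟩⟩
  have hcount := Q.place_count S
  rw [e2] at e1
  set A := (U' ⊔ Sq L).relIndex V
  set B := ((Sq L).comap (ι K L)).relIndex U
  set n := (SI S).card
  set m := (SI (SL L S)).card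
  set t := ((SI S).filter (fun v => a ∉ D v)).card
  set i := NV.relIndex U
  have hi0 : i ≠ 0 := by
    intro h; rw [h, mul_zero] at e1; exact (pow_ne_zero _ two_ne_zero) e1.symm
  have hle : (Nm a).relIndex U ≤ i := Subgroup.relIndex_le_of_le_left hNVNm hi0
  have hne : (Nm a).relIndex U ≠ 0 := fun h => hi0 (Nat.eq_zero_of_zero_dvd (h ▸ Subgroup.relIndex_dvd_of_le_left U hNVNm))
  refine ⟨hne, ?_⟩
  have e5 : 2 * i * 2 ^ m = 2 ^ (2 * n) := by
    rw [← e3, two_mul n, pow_add]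
    nth_rewrite 1 [← e4]; rw [← e1]; ring
  have e6 : 2 ^ (2 * n) ≤ 2 ^ m * 2 ^ t := by
    rw [← pow_add]; exact Nat.pow_le_pow_right (by norm_num) hcount
  rw [← e5, mul_comm] at e6
  have := Nat.le_of_mul_le_mul_left e6 (by positivity)
  omega

end Quad
end TAD

namespace TAD
open Subgroup WithZero IsDedekindDomain NumberField
open scoped WithZero

universe u
section
variable {K : Type u} [Field K] [NumberField K]

lemma exists_US (x : Kˣ) : ∃ S : Finset (HeightOneSpectrum (𝓞 K)), x ∈ US S := by
  classical
  have h1 := HeightOneSpectrum.Support.finite (𝓞 K) (x : K)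
  have h2 := HeightOneSpectrum.Support.finite (𝓞 K) ((x⁻¹ : Kˣ) : K)
  refine ⟨h1.toFinset ∪ h2.toFinset, fun p hp => ?_⟩
  simp only [Finset.mem_union, Set.Finite.mem_toFinset, not_or] at hp
  have h3 : ¬ 1 < vl p (x : K) := hp.1
  have h4 : ¬ 1 < vl p ((x⁻¹ : Kˣ) : K) := hp.2
  rw [Units.val_inv_eq_inv_val, map_inv₀, not_lt, inv_le_one₀ (vl_pos x)] at h4
  exact le_antisymm (not_lt.1 h3) h4

lemma vl_exp (p : HeightOneSpectrum (𝓞 K)) (x : Kˣ) : ∃ m : ℤ, vl p (x : K) = exp m := ⟨_, (exp_log (vl_ne x)).symm⟩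

lemma vl_zpow (p : HeightOneSpectrum (𝓞 K)) (x : Kˣ) (m : ℤ) : vl p ((x ^ m : Kˣ) : K) = vl p (x : K) ^ m := by
  rw [Units.val_zpow_eq_zpow_val, map_zpow₀]

namespace Quad
variable {L : Type u} [Field L] [NumberField L] [Algebra K L] {a : Kˣ}

lemma norm_unif (Q : Quad K L a) {S : Finset (HeightOneSpectrum (𝓞 K))} (hS : Big (SL L S)) {p : HeightOneSpectrum (𝓞 K)} (hp : p ∉ S)
    (ha : a ∈ D (.inl p)) : ∃ n ∈ Nm a, vl p (n : K) = exp (-1 : ℤ) ∧ ∀ v ∉ S, v ≠ p → vl v (n : K) = 1 := by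
  obtain ⟨W, rfl⟩ := un_surj (L := L) K p
  obtain ⟨y, hy1, hy2⟩ := hS.unif W (by rwa [mem_SL])
  refine ⟨Q.N y, Q.N_mem y, ?_, ?_⟩
  · obtain ⟨W', h1, h2, h3⟩ := Q.ne_of_D W ha
    have e1 : vl W (algebraMap K L (Q.N y)) = exp (-1 : ℤ) := by
      have := congrArg (fun x : Lˣ => vl W (x : L)) (Q.ι_N y)
      simp only [Units.val_mul, map_mul, Q.s_val] at this
      rw [← h1, hy2 W' (by rwa [mem_SL, h2]) h3, mul_one, hy1] at this
      exact this
    obtain ⟨e, he, hpow⟩ := vl_un K W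
    obtain ⟨m, hm⟩ := vl_exp (un K W) (Q.N y)
    rw [hpow, hm, ← exp_nsmul, exp_inj] at e1
    have hm1 : m = -1 := by
      have e1' : (e : ℤ) * m = -1 := by simpa using e1
      have he' : (0 : ℤ) < e := by positivity
      have : m < 0 := by by_contra h; push Not at h; nlinarith
      have hge : -1 ≤ m := by by_contra h; push Not at h; nlinarith
      omega
    rw [hm, hm1]
  · intro v hv hvp
    obtain ⟨V, rfl⟩ := un_surj (L := L) K v
    obtain ⟨V', h1, h2⟩ := place_equiv Q.σ V
    rw [← vl_un_eq_one]
    have := congrArg (fun x : Lˣ => vl V (x : L)) (Q.ι_N y)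
    simp only [Units.val_mul, map_mul, Q.s_val] at this
    rw [← h1, hy2 V (by rwa [mem_SL]) (by rintro rfl; exact hvp rfl),
      hy2 V' (by rwa [mem_SL, h2]) (by rintro rfl; exact hvp h2.symm), mul_one] at this
    exact this

lemma lemmaN (Q : Quad K L a) {S : Finset (HeightOneSpectrum (𝓞 K))} (hSK : Big S) (hS : Big (SL L S)) (b : Kˣ)
    (hb : ∀ v ∉ S, a ∉ D (.inl v) → EvenV v b) : ∃ n ∈ Nm a, b / n ∈ US S := by
  classical
  obtain ⟨T, hT⟩ := exists_US b
  have hT' : b ∈ US (S ∪ T) := US_mono Finset.subset_union_right hT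
  clear hT
  induction T using Finset.induction_on generalizing b with
  | empty => exact ⟨1, one_mem _, by simpa using hT'⟩
  | insert p T hpT ih =>
    by_cases hp : p ∈ S
    · refine ih b hb ?_
      rwa [Finset.union_insert, Finset.insert_eq_of_mem (Finset.mem_union_left _ hp)] at hT'
    obtain ⟨n, hn, hn1, hn2⟩ : ∃ n ∈ Nm a, vl p (n : K) = vl p (b : K) ∧ ∀ v ∉ S, v ≠ p → vl v (n : K) = 1 := by
      by_cases ha : a ∈ D (.inl p)
      · obtain ⟨n, hn, h1, h2⟩ := Q.norm_unif hS hp ha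
        obtain ⟨m, hm⟩ := vl_exp p b
        refine ⟨n ^ (-m), zpow_mem hn _, ?_, fun v hv hvp => ?_⟩
        · rw [vl_zpow, h1, hm, ← exp_zsmul]; simp
        · rw [vl_zpow, h2 v hv hvp, one_zpow]
      · obtain ⟨s, hs⟩ := hb p hp ha
        obtain ⟨π, h1, h2⟩ := hSK.unif p hp
        obtain ⟨m, hm⟩ := vl_exp p s
        refine ⟨(π ^ (-m)) ^ 2, sq_mem_Nm a _, ?_, fun v hv hvp => ?_⟩
        · rw [Units.val_pow_eq_pow_val, map_pow, vl_zpow, h1, hs, hm, ← exp_zsmul]; simp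
        · rw [Units.val_pow_eq_pow_val, map_pow, vl_zpow, h2 v hv hvp, one_zpow, one_pow]
    have hv1 : ∀ v ∉ S, v ≠ p → vl v ((b / n : Kˣ) : K) = vl v (b : K) := by
      intro v hv hvp
      rw [Units.val_div_eq_div_val, map_div₀, hn2 v hv hvp, div_one]
    have hvp : vl p ((b / n : Kˣ) : K) = 1 := by
      rw [Units.val_div_eq_div_val, map_div₀, hn1, div_self (vl_ne b)]
    obtain ⟨n', hn', h⟩ := ih (b / n) (by
      intro v hv hav
      by_cases hvp' : v = p
      · subst hvp'; exact ⟨1, by rw [hvp]; simp⟩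
      · obtain ⟨s, hs⟩ := hb v hv hav
        exact ⟨s, by rw [hv1 v hv hvp', hs]⟩) (by
      intro v hv
      rw [Finset.mem_union, not_or] at hv
      by_cases hvp' : v = p
      · subst hvp'; exact hvp
      · rw [hv1 v hv.1 hvp']
        exact hT' v (by simp [hv.1, hv.2, hvp']))
    exact ⟨n * n', mul_mem hn hn', by rwa [← div_div]⟩

end Quad

open Classical in
/-- S is large for a -/
def Good (a : Kˣ) (S : Finset (HeightOneSpectrum (𝓞 K))) : Prop :=
  (∀ v ∉ S, vl v (2 : K) = 1) ∧ a ∈ US S ∧ Big S ∧ ((Nm a).relIndex (US S) ≠ 0 ∧ 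
    2 * (Nm a).relIndex (US S) ≤ 2 ^ ((SI S).filter (fun v => a ∉ D v)).card) ∧
  (∀ b : Kˣ, (∀ v ∉ S, a ∉ D (.inl v) → EvenV v b) → ∃ n ∈ Nm a, b / n ∈ US S)

theorem exists_Good {a : Kˣ} (ha : a ∉ Sq K) : ∃ S0 : Finset (HeightOneSpectrum (𝓞 K)), ∀ S, S0 ⊆ S → Good a S := by
  classical
  obtain ⟨L, _, _, _, ⟨Q⟩⟩ := exists_quad a ha
  obtain ⟨S1, h1⟩ := exists_Big (K := K)
  obtain ⟨S2, h2⟩ := exists_Big (K := L)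
  obtain ⟨S3, h3⟩ := exists_US a
  obtain ⟨S4, h4⟩ := exists_US (Units.mk0 (2 : K) two_ne_zero)
  refine ⟨S1 ∪ S2.image (un K) ∪ S3 ∪ S4, fun S hS => ?_⟩
  have hS1 : S1 ⊆ S := fun x hx => hS (by simp [hx])
  have hS3 : S3 ⊆ S := fun x hx => hS (by simp [hx])
  have hS4 : S4 ⊆ S := fun x hx => hS (by simp [hx])
  have hS2 : S2 ⊆ SL L S := fun W hW => mem_SL.2 (hS (by
    simp only [Finset.mem_union]; left; left; right; exact Finset.mem_image_of_mem _ hW))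
  have h2' : ∀ v ∉ S, vl v (2 : K) = 1 := fun v hv => h4 v (fun h => hv (hS4 h))
  have ha' : a ∈ US S := US_mono hS3 h3
  exact ⟨h2', ha', h1 S hS1, Q.lemmaH ha (h1 S hS1) h2' ha', fun b hb => Q.lemmaN (h1 S hS1) (h2 _ hS2) b hb⟩

/-- elements nontrivial at exactly one prescribed place -/
lemma exists_sep (T : Finset (Pl K)) (a : Kˣ) (hT : ∀ v ∈ T, a ∉ D v) (T' : Finset (Pl K)) (hTT : T ⊆ T') :
    ∃ g : Pl K → Kˣ, ∀ v ∈ T, g v ∉ NL v a ∧ ∀ w ∈ T', w ≠ v → g v ∈ D w := by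
  classical
  have : ∀ v : Pl K, ∃ g : Kˣ, v ∈ T → g ∉ NL v a ∧ ∀ w ∈ T', w ≠ v → g ∈ D w := by
    intro v
    by_cases hv : v ∈ T
    · obtain ⟨b, hb⟩ := NL_ne_top (hT v hv)
      obtain ⟨z, hz⟩ := approx T' (fun w => if w = v then b else 1)
      refine ⟨z, fun _ => ⟨?_, fun w hw hwv => ?_⟩⟩
      · have := hz v (hTT hv)
        simp only [if_true] at this
        intro hzN
        apply hb
        have h2 := mul_mem (inv_mem (D_le_NL v a this)) hzN
        simpa using h2
      · have := hz w hw
        simpa [hwv] using this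
    · exact ⟨1, fun h => absurd h hv⟩
  choose g hg using this
  exact ⟨g, hg⟩

theorem lemmaF {a : Kˣ} (ha : a ∉ Sq K) (S : Finset (HeightOneSpectrum (𝓞 K))) : ∃ v ∉ S, a ∉ D (.inl v) := by
  classical
  by_contra hcon
  push Not at hcon
  obtain ⟨S0, hS0⟩ := exists_Good ha
  obtain ⟨-, -, -, ⟨hne, hH⟩, hN⟩ := hS0 (S0 ∪ S) Finset.subset_union_left
  set S' := S0 ∪ S
  set T := (SI S').filter (fun v => a ∉ D v) with hT
  obtain ⟨g, hg⟩ := exists_sep T a (fun v hv => (Finset.mem_filter.1 hv).2) T subset_rfl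
  have : ∀ v, ∃ n ∈ Nm a, g v / n ∈ US S' := fun v => hN (g v) (fun w hw haw => absurd (hcon w (fun h => hw (Finset.mem_union_right _ h))) haw)
  choose n hn hgn using this
  have hkey : ∀ (v w : Pl K), g v / n v ∈ NL w a ↔ g v ∈ NL w a := fun v w => by
    rw [div_eq_mul_inv]
    exact Subgroup.mul_mem_cancel_right _ (inv_mem (Nm_le_NL w a (hn v)))
  have := two_pow_le_relIndex T (fun v => NL v a) (US S') (Nm a) (fun v => g v / n v) (fun v _ => hgn v)
    (fun v hv => by rw [hkey]; exact (hg v hv).1)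
    (fun v hv w hw hwv => by rw [hkey]; exact D_le_NL w a ((hg v hv).2 w hw hwv))
    (fun v hv x _ hx => Nm_le_NL v a hx) hne
  have h2 : 0 < 2 ^ T.card := by positivity
  omega

theorem lemmaQ {a u : Kˣ} (ha : a ∉ Sq K) (hu : u ∉ Sq K) (hua : u * a ∉ Sq K) (S : Finset (HeightOneSpectrum (𝓞 K))) :
    ∃ q ∉ S, a ∈ D (.inl q) ∧ u ∉ D (.inl q) := by
  classical
  obtain ⟨L, _, _, _, ⟨Q⟩⟩ := exists_quad a ha
  obtain ⟨S2, h2⟩ := exists_US (Units.mk0 (2 : K) two_ne_zero)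
  obtain ⟨S3, h3⟩ := exists_US a
  obtain ⟨S4, h4⟩ := exists_US u
  have huL : ι K L u ∉ Sq L := fun h => by
    rcases (Q.sq_iff u).1 h with h | h
    · exact hu h
    · exact hua h
  obtain ⟨W, hW, huW⟩ := lemmaF huL (SL L (S ∪ S2 ∪ S3 ∪ S4))
  rw [mem_SL] at hW
  simp only [Finset.mem_union, not_or] at hW
  obtain ⟨⟨⟨hWS, hW2⟩, hW3⟩, hW4⟩ := hW
  have huq : u ∉ D (.inl (un K W)) := fun h => huW (D_up h)
  refine ⟨un K W, hWS, ?_, huq⟩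
  by_contra haq
  have := odd_units (p := un K W) (h2 _ hW2) (h3 _ hW3) (h4 _ hW4) haq huq
  have h5 := D_up (L := L) this
  rw [map_mul, Q.ι_a] at h5
  exact huW ((Subgroup.mul_mem_cancel_left _ (sq_mem_Dval Q.θ)).1 h5)

end
end TAD

namespace TAD
open Subgroup WithZero IsDedekindDomain NumberField
open scoped WithZero

lemma index_le_two {G : Type*} [CommGroup G] {H : Subgroup G} (h : ∀ x y, x ∉ H → y ∉ H → x * y ∈ H) :
    H.index ≠ 0 ∧ H.index ≤ 2 := by
  by_cases hH : H = ⊤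
  · rw [hH]; simp
  · obtain ⟨b, hb⟩ := exists_notMem hH
    have : H.index = 2 := by
      rw [Subgroup.index_eq_two_iff]
      refine ⟨b, fun x => ?_⟩
      by_cases hx : x ∈ H
      · exact Or.inr ⟨hx, fun h' => hb ((mul_mem_cancel_left hx).1 h')⟩
      · exact Or.inl ⟨h _ _ hx hb, hx⟩
    omega

universe u
section
variable {K : Type u} [Field K] [NumberField K]

/-- separating system of S-units at auxiliary primes Q -/
def Diag (S Q : Finset (HeightOneSpectrum (𝓞 K))) (g : HeightOneSpectrum (𝓞 K) → Kˣ) : Prop :=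
  ∀ q ∈ Q, q ∉ S ∧ g q ∈ US S ∧ g q ∉ D (.inl q) ∧ ∀ q' ∈ Q, q' ≠ q → g q ∈ D (.inl q')

lemma Diag.correct {S Q : Finset (HeightOneSpectrum (𝓞 K))} {g} (hg : Diag S Q g) (h2 : ∀ v ∉ S, vl v (2 : K) = 1)
    (Q0 : Finset (HeightOneSpectrum (𝓞 K))) (hQ0 : Q0 ⊆ Q) (x : Kˣ) (hx : ∀ v ∈ Q0, vl v (x : K) = 1) :
    ∃ h ∈ US S, ∀ q ∈ Q0, x * h ∈ D (.inl q) := by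
  classical
  induction Q0 using Finset.induction_on with
  | empty => exact ⟨1, one_mem _, by simp⟩
  | insert q Q0 hq ih =>
    obtain ⟨h, hh, hd⟩ := ih (fun y hy => hQ0 (Finset.mem_insert_of_mem hy)) (fun v hv => hx v (Finset.mem_insert_of_mem hv))
    obtain ⟨hqS, hgU, hgD, hgo⟩ := hg q (hQ0 (Finset.mem_insert_self _ _))
    by_cases hc : x * h ∈ D (.inl q)
    · refine ⟨h, hh, fun q' hq' => ?_⟩
      rcases Finset.mem_insert.1 hq' with rfl | hq'
      · exact hc
      · exact hd q' hq'
    · refine ⟨h * g q, mul_mem hh hgU, fun q' hq' => ?_⟩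
      rw [← mul_assoc]
      rcases Finset.mem_insert.1 hq' with rfl | hq'
      · refine odd_units (h2 _ hqS) ?_ (hgU _ hqS) hc hgD
        rw [Units.val_mul, (vl _).map_mul, hx _ (Finset.mem_insert_self _ _), hh _ hqS, one_mul]
      · refine mul_mem (hd q' hq') (hgo q' (hQ0 (Finset.mem_insert_of_mem hq')) ?_)
        intro h'; rw [h'] at hq'; exact hq hq'

lemma EvenV.of_one {p : HeightOneSpectrum (𝓞 K)} {x : Kˣ} (h : vl p (x : K) = 1) : EvenV p x := ⟨1, by simp [h]⟩

lemma L8' {p : HeightOneSpectrum (𝓞 K)} (h2 : vl p (2 : K) = 1) {a b : Kˣ} (ha : EvenV p a) (hb : vl p (b : K) = 1) :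
    b ∈ NL (.inl p) a := by
  obtain ⟨s, hs⟩ := ha.scale
  have := L8 h2 hs hb
  rwa [NLf, Nm_mul_sq] at this

theorem claimX {S Q : Finset (HeightOneSpectrum (𝓞 K))} {g} (hg : Diag S Q g) (h2 : ∀ v ∉ S, vl v (2 : K) = 1)
    (hB : Big S) {x : Kˣ} (hx : ∀ v ∉ S, v ∉ Q → vl v (x : K) = 1) (hxD : ∀ v ∈ SI S, x ∈ D v) : x ∈ Sq K := by
  classical
  by_contra hcon
  obtain ⟨S0, hS0⟩ := exists_Good hcon
  set T := S0 ∪ S ∪ Q with hT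
  obtain ⟨-, -, -, ⟨hne, hH⟩, -⟩ := hS0 T (by intro y hy; simp [hT, hy])
  set P := (SI T).filter (fun v => x ∉ D v) with hP
  have hST : S ⊆ T := by intro y hy; simp [hT, hy]
  have main : ∀ v : Pl K, ∃ y : Kˣ, v ∈ P → y ∈ US T ∧ y ∉ NL v x ∧ ∀ w ∈ P, w ≠ v → y ∈ NL w x := by
    rintro (p | w)
    swap
    · refine ⟨1, fun h => absurd (hxD _ inr_mem_SI) (Finset.mem_filter.1 h).2⟩
    by_cases hpP : Sum.inl p ∈ P
    swap
    · exact ⟨1, fun h => absurd h hpP⟩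
    obtain ⟨hpT, hpD⟩ := Finset.mem_filter.1 hpP
    have hpS : p ∉ S := fun h => hpD (hxD _ (inl_mem_SI.2 h))
    have inf : ∀ w ∈ P, ∃ q, w = .inl q ∧ q ∉ S := by
      rintro (q | w) hw
      · exact ⟨q, rfl, fun h => (Finset.mem_filter.1 hw).2 (hxD _ (inl_mem_SI.2 h))⟩
      · exact absurd (hxD _ inr_mem_SI) (Finset.mem_filter.1 hw).2
    have odd : ∀ q ∉ S, ¬ EvenV q x → q ∈ Q := by
      intro q hq he; by_contra h; exact he (.of_one (hx q hq h))
    by_cases he : EvenV p x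
    · obtain ⟨π, h1, h1'⟩ := hB.unif p hpS
      obtain ⟨h, hh, hd⟩ := hg.correct h2 (Q.erase p) (Finset.erase_subset _ _) π (fun v hv => by
        rw [Finset.mem_erase] at hv; exact h1' v (hg v hv.2).1 hv.1)
      have hv1 : ∀ v ∉ S, v ≠ p → vl v ((π * h : Kˣ) : K) = 1 := fun v hv hvp => by
        rw [Units.val_mul, (vl _).map_mul, h1' v hv hvp, hh v hv, one_mul]
      refine ⟨π * h, fun _ => ⟨?_, ?_, ?_⟩⟩
      · intro v hv
        refine hv1 v (fun h => hv (hST h)) ?_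
        rintro rfl; exact hv (inl_mem_SI.1 hpT)
      · intro hN
        have := L7 (h2 p hpS) hpD he hN
        refine not_even_exp p (k := -1) ?_ (by decide) this
        rw [Units.val_mul, (vl _).map_mul, h1, hh _ hpS, mul_one]
      · intro w hw hwp
        obtain ⟨q, rfl, hqS⟩ := inf w hw
        have hqp : q ≠ p := fun h => hwp (by rw [h])
        by_cases heq : EvenV q x
        · exact L8' (h2 q hqS) heq (hv1 q hqS hqp)
        · exact D_le_NL _ _ (hd q (Finset.mem_erase.2 ⟨hqp, odd q hqS heq⟩))
    · have hpQ := odd p hpS he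
      obtain ⟨-, hgU, hgD, hgo⟩ := hg p hpQ
      refine ⟨g p, fun _ => ⟨US_mono hST hgU, ?_, ?_⟩⟩
      · intro hN
        have hN' : x ∈ NL (.inl p) (g p) := NL_symm hN
        exact he (L7 (h2 p hpS) hgD (.of_one (hgU p hpS)) hN')
      · intro w hw hwp
        obtain ⟨q, rfl, hqS⟩ := inf w hw
        have hqp : q ≠ p := fun h => hwp (by rw [h])
        by_cases heq : EvenV q x
        · exact L8' (h2 q hqS) heq (hgU q hqS)
        · exact D_le_NL _ _ (hgo q (odd q hqS heq) hqp)
  choose y hy using main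
  have := two_pow_le_relIndex P (fun v => NL v x) (US T) (Nm x) y (fun v hv => (hy v hv).1) (fun v hv => (hy v hv).2.1)
    (fun v hv => (hy v hv).2.2) (fun v hv z _ hz => Nm_le_NL v x hz) hne
  have h2 : 0 < 2 ^ P.card := by positivity
  omega

lemma exists_Diag {a : Kˣ} (ha : a ∉ Sq K) {S : Finset (HeightOneSpectrum (𝓞 K))} (h2 : ∀ v ∉ S, vl v (2 : K) = 1)
    (k : ℕ) (hk : k + 1 ≤ S.card + Fintype.card (InfinitePlace K)) :
    ∃ Q g, Q.card = k ∧ Diag S Q g ∧ ∀ q ∈ Q, a ∈ D (.inl q) := by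
  classical
  induction k with
  | zero => exact ⟨∅, fun _ => 1, rfl, by simp [Diag], by simp⟩
  | succ k ih =>
    obtain ⟨Q, g, hQk, hg, hQa⟩ := ih (by omega)
    obtain ⟨u, huU, huQ, hu1, hu2⟩ : ∃ u ∈ US S, (∀ q ∈ Q, u ∈ D (.inl q)) ∧ u ∉ Sq K ∧ u * a ∉ Sq K := by
      by_contra! hcon
      let H : HeightOneSpectrum (𝓞 K) → Subgroup (US S) := fun q => (D (.inl q)).subgroupOf (US S)
      have hH : ∀ q ∈ Q, (H q).index ≠ 0 ∧ (H q).index ≤ 2 := fun q hq => by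
        refine index_le_two fun x y hx hy => ?_
        exact odd_units (h2 q (hg q hq).1) (x.2 q (hg q hq).1) (y.2 q (hg q hq).1) hx hy
      obtain ⟨hJ, hJ0⟩ := relIndex_iInf_le Q H (fun q hq => (hH q hq).1)
      set J := ⨅ q ∈ Q, H q with hJd
      have hJ2 : J.index ≤ 2 ^ k := hJ.trans (by
        rw [← hQk]; exact Finset.prod_le_pow_card _ _ _ (fun q hq => (hH q hq).2))
      have hSJ : (Sq K).subgroupOf (US S) ≤ J := by
        rw [hJd]
        refine le_iInf fun q => le_iInf fun hq => ?_
        intro x hx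
        rw [mem_subgroupOf, mem_Sq] at hx
        obtain ⟨s, hs⟩ := hx
        rw [mem_subgroupOf, hs]
        exact sq_mem_D _ s
      have hi := Subgroup.relIndex_mul_index hSJ
      change _ = (Sq K).relIndex (US S) at hi
      rw [relIndex_US] at hi
      have h3 : ((Sq K).subgroupOf (US S)).relIndex J ≤ 2 := by
        refine (index_le_two fun x y hx hy => ?_).2
        rw [mem_subgroupOf, mem_subgroupOf] at hx hy ⊢
        have hJm : ∀ z : J, ∀ q ∈ Q, (z : Kˣ) ∈ D (.inl q) := fun z q hq => by
          have h5 : J ≤ H q := iInf₂_le q hq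
          exact h5 z.2
        obtain ⟨s, hs⟩ := mem_Sq.1 (hcon x x.1.2 (hJm x) hx)
        obtain ⟨t, ht⟩ := mem_Sq.1 (hcon y y.1.2 (hJm y) hy)
        refine mem_Sq.2 ⟨s * t / a, ?_⟩
        rw [div_pow, mul_pow, ← hs, ← ht, eq_div_iff_mul_eq']
        push_cast
        rw [sq, mul_mul_mul_comm]
      have h4 : 2 ^ (S.card + Fintype.card (InfinitePlace K)) ≤ 2 * 2 ^ k := by
        rw [← hi]; exact Nat.mul_le_mul h3 hJ2
      rw [← pow_succ'] at h4
      have := (Nat.pow_le_pow_iff_right (by norm_num : 1 < 2)).1 h4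
      omega
    obtain ⟨q, hqS, hqa, hqu⟩ := lemmaQ ha hu1 hu2 (S ∪ Q)
    rw [Finset.mem_union, not_or] at hqS
    refine ⟨insert q Q, fun p => if p = q then u else if g p ∈ D (.inl q) then g p else g p * u, ?_, ?_, ?_⟩
    · rw [Finset.card_insert_of_notMem hqS.2, hQk]
    · intro p hp
      rcases Finset.mem_insert.1 hp with rfl | hp
      · simp only [if_true]
        refine ⟨hqS.1, huU, hqu, fun q' hq' hne => huQ q' ((Finset.mem_insert.1 hq').resolve_left hne)⟩
      · have hpq : p ≠ q := by intro h'; rw [h'] at hp; exact hqS.2 hp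
        obtain ⟨h1, hgU, h4, h5⟩ := hg p hp
        simp only [if_neg hpq]
        split_ifs with hgq
        · refine ⟨h1, hgU, h4, fun q' hq' hne => ?_⟩
          rcases Finset.mem_insert.1 hq' with rfl | hq'
          · exact hgq
          · exact h5 q' hq' hne
        · refine ⟨h1, mul_mem hgU huU, fun h => h4 ((mul_mem_cancel_right (huQ p hp)).1 h), fun q' hq' hne => ?_⟩
          rcases Finset.mem_insert.1 hq' with rfl | hq'
          · exact odd_units (h2 _ hqS.1) (hgU _ hqS.1) (huU _ hqS.1) hgq hqu
          · exact mul_mem (h5 q' hq' hne) (huQ q' hq')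
    · intro p hp
      rcases Finset.mem_insert.1 hp with rfl | hp
      · exact hqa
      · exact hQa p hp

end
end TAD

namespace TAD
open Subgroup WithZero IsDedekindDomain NumberField
open scoped WithZero
universe u
section
variable {K : Type u} [Field K] [NumberField K]

/-- local norms at all places of S and infinity -/
noncomputable def Nloc (S : Finset (HeightOneSpectrum (𝓞 K))) (a : Kˣ) : Subgroup Kˣ := ⨅ v ∈ SI S, NL v a

lemma mem_Nloc {S : Finset (HeightOneSpectrum (𝓞 K))} {a x : Kˣ} : x ∈ Nloc S a ↔ ∀ v ∈ SI S, x ∈ NL v a := by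
  simp [Nloc, mem_iInf]

open Classical in
theorem mainI {a : Kˣ} (ha : a ∉ Sq K) (S1 : Finset (HeightOneSpectrum (𝓞 K))) :
    ∃ S, S1 ⊆ S ∧ ∃ U : Subgroup Kˣ, (∀ x y, x ∉ U ⊔ Nloc S a → y ∉ U ⊔ Nloc S a → x * y ∈ U ⊔ Nloc S a) ∧
      (∀ u ∈ U, ∀ v ∉ SI S, u ∈ NL v a) ∧ (∀ u ∈ U, u ∈ Nloc S a → u ∈ Nm a) ∧
      (∀ b, (∀ v ∉ SI S, b ∈ NL v a) → ∃ n ∈ Nm a, b / n ∈ U) ∧ 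
      ((Nloc S a).index ≠ 0 ∧ (Nloc S a).index ≤ 2 ^ ((SI S).filter (fun v => a ∉ D v)).card) := by
  obtain ⟨S0, hS0⟩ := exists_Good ha
  set S := S0 ∪ S1 with hS
  have hS0S : S0 ⊆ S := Finset.subset_union_left
  obtain ⟨h2, haU, hB, -, hN⟩ := hS0 S hS0S
  set s := S.card + Fintype.card (InfinitePlace K) with hs
  have hs0 : 1 ≤ s := by
    have : 0 < Fintype.card (InfinitePlace K) := Fintype.card_pos
    omega
  obtain ⟨Q, g, hQk, hg, hQa⟩ := exists_Diag ha h2 (s - 1) (by omega)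
  obtain ⟨-, -, -, ⟨hr0, hr⟩, -⟩ := hS0 (S ∪ Q) (hS0S.trans Finset.subset_union_left)
  have hdis : Disjoint S Q := by
    rw [Finset.disjoint_right]; exact fun q hq => (hg q hq).1
  set U := US (S ∪ Q) with hU
  set M : Subgroup Kˣ := ⨅ v ∈ SI S, D v with hM
  obtain ⟨hM1, hM0⟩ := relIndex_iInf_le (SI S) (fun v => D v) (fun v _ => D_index v)
  rw [← hM] at hM1 hM0
  have hM2 : M.index ≤ 4 ^ s := by
    refine hM1.trans ?_
    rw [SI, Finset.prod_disjSum]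
    exact index_D_prod S
  have hMU0 : M.relIndex U ≠ 0 := fun h => by
    have := relIndex_dvd_index_of_normal M U
    rw [h] at this
    exact hM0 (Nat.eq_zero_of_zero_dvd this)
  have hMU : 2 ^ (2 * s - 1) ≤ M.relIndex U := by
    have h1 : M ⊓ U ≤ Sq K := by
      rintro x ⟨hxM, hxU⟩
      refine claimX hg h2 hB (fun v hv hvQ => hxU v (by simp [hv, hvQ])) (fun v hv => ?_)
      have : M ≤ D v := iInf₂_le v hv
      exact this hxM
    have h3 := relIndex_dvd_of_le_left U h1
    rw [inf_relIndex_right, hU, relIndex_US, Finset.card_union_of_disjoint hdis, hQk] at h3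
    have h4 : S.card + (s - 1) + Fintype.card (InfinitePlace K) = 2 * s - 1 := by omega
    rw [h4] at h3
    exact Nat.le_of_dvd (Nat.pos_of_ne_zero hMU0) h3
  have hUM : (U ⊔ M).index ≠ 0 ∧ (U ⊔ M).index ≤ 2 := by
    have h1 := relIndex_mul_index (le_sup_right : M ≤ U ⊔ M)
    rw [relIndex_sup_right] at h1
    constructor
    · intro h; rw [h, mul_zero] at h1; exact hM0 h1.symm
    · have h3 : 2 ^ (2 * s - 1) * (U ⊔ M).index ≤ 2 ^ (2 * s - 1) * 2 := by
        refine (Nat.mul_le_mul_right _ hMU).trans ?_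
        rw [h1, ← pow_succ]
        refine hM2.trans (le_of_eq ?_)
        rw [show 2 * s - 1 + 1 = 2 * s by omega, pow_mul]; norm_num
      exact Nat.le_of_mul_le_mul_left h3 (by positivity)
  have hMN : M ≤ Nloc S a := iInf₂_mono fun v _ => D_le_NL v a
  have hUN : (U ⊔ Nloc S a).index ≠ 0 ∧ (U ⊔ Nloc S a).index ≤ 2 := by
    have h1 := index_dvd_of_le (sup_le_sup_left hMN U)
    exact ⟨fun h => hUM.1 (by rw [h] at h1; exact Nat.eq_zero_of_zero_dvd h1),
      (Nat.le_of_dvd (Nat.pos_of_ne_zero hUM.1) h1).trans hUM.2⟩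
  set T := (SI S).filter (fun v => a ∉ D v) with hT
  have hN0 : (Nloc S a).index ≠ 0 := fun h => by
    have h1 := index_dvd_of_le hMN
    rw [h] at h1; exact hM0 (Nat.eq_zero_of_zero_dvd h1)
  have hTN : 2 ^ T.card ≤ (Nloc S a).index := by
    obtain ⟨g, hg⟩ := exists_sep T a (fun v hv => (Finset.mem_filter.1 hv).2) T subset_rfl
    rw [← relIndex_top_right] at hN0 ⊢
    exact two_pow_le_relIndex T (fun v => NL v a) ⊤ (Nloc S a) g (fun _ _ => trivial) (fun v hv => (hg v hv).1)
      (fun v hv w hw hwv => D_le_NL w a ((hg v hv).2 w hw hwv))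
      (fun v hv x _ hx => mem_Nloc.1 hx v (Finset.mem_filter.1 hv).1) hN0
  have hidx := relIndex_mul_index (le_sup_right : Nloc S a ≤ U ⊔ Nloc S a)
  rw [relIndex_sup_right] at hidx
  have hNmN : Nm a ≤ Nloc S a := le_iInf₂ fun v _ => Nm_le_NL v a
  have hle : (Nloc S a).relIndex U ≤ (Nm a).relIndex U :=
    Nat.le_of_dvd (Nat.pos_of_ne_zero hr0) (relIndex_dvd_of_le_left U hNmN)
  have htt : (SI (S ∪ Q)).filter (fun v => a ∉ D v) = T := by
    ext v
    simp only [hT, Finset.mem_filter]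
    constructor
    · rintro ⟨h1, h3⟩
      refine ⟨?_, h3⟩
      rcases v with p | w
      · rw [inl_mem_SI] at h1 ⊢
        exact (Finset.mem_union.1 h1).resolve_right (fun h => h3 (hQa p h))
      · exact inr_mem_SI
    · rintro ⟨h1, h3⟩
      refine ⟨?_, h3⟩
      rcases v with p | w
      · rw [inl_mem_SI] at h1 ⊢
        exact Finset.mem_union_left _ h1
      · exact inr_mem_SI
  rw [htt] at hr
  have hb1 : (Nloc S a).index ≤ (Nloc S a).relIndex U * 2 := by
    rw [← hidx]; exact Nat.mul_le_mul_left _ hUN.2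
  have heq : (Nloc S a).relIndex U = (Nm a).relIndex U := by omega
  refine ⟨S, Finset.subset_union_right, U, ?_, ?_, ?_, ?_, hN0, ?_⟩
  · intro x y hx hy
    have h1 : (U ⊔ Nloc S a).index = 2 := by
      have : (U ⊔ Nloc S a).index ≠ 1 := fun h => hx (by rw [index_eq_one.1 h]; trivial)
      omega
    exact (mul_mem_iff_of_index_two h1).2 (by simp [hx, hy])
  · rintro u hu (p | w) hv
    · rw [inl_mem_SI] at hv
      by_cases hp : p ∈ Q
      · rw [NL_top (hQa p hp)]; trivial
      · exact L8' (h2 p hv) (.of_one (haU p hv)) (hu p (by simp [hv, hp]))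
    · exact absurd inr_mem_SI hv
  · intro u hu huN
    have h1 : (Nm a).subgroupOf U ≤ (Nloc S a).subgroupOf U := fun x hx => hNmN hx
    have h3 := relIndex_mul_index h1
    change _ * (Nloc S a).relIndex U = (Nm a).relIndex U at h3
    rw [heq] at h3
    have h4 := Nat.eq_of_mul_eq_mul_right (Nat.pos_of_ne_zero hr0) (h3.trans (one_mul _).symm)
    rw [relIndex_eq_one] at h4
    exact h4 (show (⟨u, hu⟩ : U) ∈ (Nloc S a).subgroupOf U from huN)
  rotate_left
  · have h9 : (Nloc S a).index ≤ 2 ^ T.card := by omega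
    convert h9
  · intro b hb
    obtain ⟨n, hn, hbn⟩ := hN b (fun v hv hav => L7 (h2 v hv) hav (.of_one (haU v hv)) (hb (.inl v) (by simpa using hv)))
    exact ⟨n, hn, US_mono Finset.subset_union_left hbn⟩

/-- Hasse-Minkowski for ternary forms -/
theorem HM3 {a b : Kˣ} (h : ∀ v : Pl K, b ∈ NL v a) : b ∈ Nm a := by
  by_cases ha : a ∈ Sq K
  · obtain ⟨s, rfl⟩ := mem_Sq.1 ha
    rw [Nm_sq]; trivial
  obtain ⟨S, -, U, -, -, h3, h4, -⟩ := mainI ha ∅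
  obtain ⟨n, hn, hb⟩ := h4 b (fun v _ => h v)
  have := h3 _ hb (mem_Nloc.2 fun v _ => div_mem (h v) (Nm_le_NL v a hn))
  simpa using mul_mem this hn

lemma notMem_Sq {a : Kˣ} {v : Pl K} (h : a ∉ D v) : a ∉ Sq K := fun h' => by
  obtain ⟨s, rfl⟩ := mem_Sq.1 h'
  exact h (sq_mem_D v s)

lemma exists_fin (v : Pl K) : ∃ S : Finset (HeightOneSpectrum (𝓞 K)), ∀ S', S ⊆ S' → v ∈ SI S' := by
  rcases v with p | w
  · exact ⟨{p}, fun S' h => by simpa using h⟩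
  · exact ⟨∅, fun S' _ => inr_mem_SI⟩

theorem NL_index {a : Kˣ} {v : Pl K} {x y : Kˣ} (hx : x ∉ NL v a) (hy : y ∉ NL v a) : x * y ∈ NL v a := by
  classical
  by_contra hxy
  have hav : a ∉ D v := fun h => hx (by rw [NL_top h]; trivial)
  obtain ⟨S1, hS1⟩ := exists_fin v
  obtain ⟨S, hS, U, -, -, -, -, h0, hle⟩ := mainI (notMem_Sq hav) S1
  set T := (SI S).filter (fun v => a ∉ D v) with hT
  have hvS := hS1 S hS
  have hvT : v ∈ T := Finset.mem_filter.2 ⟨hvS, hav⟩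
  obtain ⟨g, hg⟩ := exists_sep T a (fun v hv => (Finset.mem_filter.1 hv).2) T subset_rfl
  have hsqN : ∀ (w : Pl K) z, z ^ 2 ∈ NL w a := fun w z => D_le_NL w a (sq_mem_D w z)
  have hzp : ∀ y z : Kˣ, z ∈ NL v a ⊔ zpowers y → z ∈ NL v a ∨ y * z ∈ NL v a := by
    intro y z hz
    obtain ⟨n, hn, m, ⟨k, hk⟩, rfl⟩ := mem_sup.1 hz
    simp only at hk
    rcases Int.even_or_odd' k with ⟨j, rfl | rfl⟩
    · left
      refine mul_mem hn ?_
      rw [← hk, mul_comm, zpow_mul, zpow_ofNat]; exact hsqN _ _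
    · right
      rw [mul_left_comm]
      refine mul_mem hn ?_
      rw [← hk]
      have : y * y ^ (2 * j + 1) = (y ^ (j + 1)) ^ 2 := by
        rw [← zpow_one_add, ← zpow_natCast, ← zpow_mul]; congr 1; push_cast; ring
      rw [this]; exact hsqN _ _
  -- local elements placed at v
  have hpl : ∀ x : Kˣ, ∃ z, z / x ∈ NL v a ∧ ∀ w ∈ T, w ≠ v → z ∈ NL w a := by
    intro x
    obtain ⟨z, hz⟩ := approx T (fun w => if w = v then x else 1)
    refine ⟨z, ?_, fun w hw hwv => ?_⟩
    · have := hz v hvT; simp only [if_true] at this; exact D_le_NL _ _ this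
    · have := hz w hw; simp only [hwv, if_false, div_one] at this; exact D_le_NL _ _ this
  obtain ⟨x', hx', hx2⟩ := hpl x
  obtain ⟨y', hy', hy2⟩ := hpl y
  have hxx : ∀ H : Subgroup Kˣ, NL v a ≤ H → (x' ∈ H ↔ x ∈ H) := fun H hH => by
    have := mul_mem_cancel_left (H := H) (hH hx') (y := x); rwa [div_mul_cancel] at this
  have hyy : ∀ H : Subgroup Kˣ, NL v a ≤ H → (y' ∈ H ↔ y ∈ H) := fun H hH => by
    have := mul_mem_cancel_left (H := H) (hH hy') (y := y); rwa [div_mul_cancel] at this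
  let T' : Finset (Option (Pl K)) := Finset.insertNone T
  let H : Option (Pl K) → Subgroup Kˣ := fun o => o.elim (NL v a ⊔ zpowers x) (fun w => if w = v then NL v a ⊔ zpowers y else NL w a)
  let G : Option (Pl K) → Kˣ := fun o => o.elim y' (fun w => if w = v then x' else g w)
  have key := two_pow_le_relIndex T' H ⊤ (Nloc S a) G (fun _ _ => trivial) ?_ ?_ ?_ (by rwa [relIndex_top_right])
  · rw [relIndex_top_right, Finset.card_insertNone] at key
    have h5 := key.trans hle
    have := (Nat.pow_le_pow_iff_right (by norm_num : 1 < 2)).1 h5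
    omega
  · rintro (_ | w) hw
    · change y' ∉ NL v a ⊔ zpowers x
      rw [hyy _ le_sup_left]
      intro h; rcases hzp _ _ h with h | h
      · exact hy h
      · exact hxy h
    · change (if w = v then x' else g w) ∉ (if w = v then NL v a ⊔ zpowers y else NL w a)
      split_ifs with hwv
      · rw [hxx _ le_sup_left]
        intro h; rcases hzp _ _ h with h | h
        · exact hx h
        · exact hxy (by rwa [mul_comm] at h)
      · exact (hg w (by simpa [T'] using hw)).1
  · rintro (_ | w) hw (_ | w') hw' hne
    · exact absurd rfl hne
    · change y' ∈ (if w' = v then NL v a ⊔ zpowers y else NL w' a)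
      split_ifs with hwv
      · rw [hyy _ le_sup_left]; exact mem_sup_right (mem_zpowers y)
      · exact hy2 w' (by simpa [T'] using hw') hwv
    · change (if w = v then x' else g w) ∈ NL v a ⊔ zpowers x
      split_ifs with hwv
      · rw [hxx _ le_sup_left]; exact mem_sup_right (mem_zpowers x)
      · exact mem_sup_left (D_le_NL _ _ ((hg w (by simpa [T'] using hw)).2 v hvT (Ne.symm hwv)))
    · change (if w = v then x' else g w) ∈ (if w' = v then NL v a ⊔ zpowers y else NL w' a)
      have hww : w' ≠ w := fun h => hne (by rw [h])
      have hwT : w ∈ T := by simpa [T'] using hw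
      have hwT' : w' ∈ T := by simpa [T'] using hw'
      split_ifs with h1 h3 h3
      · exact absurd (h1.trans h3.symm) hww
      · exact mem_sup_left (D_le_NL _ _ ((hg w hwT).2 v hvT (Ne.symm h3)))
      · exact hx2 w' hwT' h1
      · exact D_le_NL _ _ ((hg w hwT).2 w' hwT' hww)
  · rintro (_ | w) hw z _ hz
    · exact mem_sup_left (mem_Nloc.1 hz v hvS)
    · change z ∈ (if w = v then NL v a ⊔ zpowers y else NL w a)
      split_ifs with h1
      · exact mem_sup_left (mem_Nloc.1 hz v hvS)
      · exact mem_Nloc.1 hz w (Finset.mem_filter.1 (by simpa [T'] using hw : w ∈ T)).1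

/-- the set of places where (a,c) is ramified is T -/
def Rz (a c : Kˣ) (T : Set (Pl K)) : Prop := ∀ v, c ∉ NL v a ↔ v ∈ T

theorem lemmaE {a : Kˣ} {v1 v2 : Pl K} (h1 : a ∉ D v1) (h2 : a ∉ D v2) (hne : v1 ≠ v2) (hr1 : ¬ ∃ c, Rz a c {v1})
    (hr2 : ¬ ∃ c, Rz a c {v2}) : ∃ c, Rz a c {v1, v2} := by
  classical
  obtain ⟨S1, hS1⟩ := exists_fin v1
  obtain ⟨S2, hS2⟩ := exists_fin v2
  obtain ⟨S, hS, U, hi, hU, -⟩ := mainI (notMem_Sq h1) (S1 ∪ S2)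
  have hv1 := hS1 S (Finset.subset_union_left.trans hS)
  have hv2 := hS2 S (Finset.subset_union_right.trans hS)
  obtain ⟨g, hg⟩ := exists_sep {v1, v2} a (by simp [h1, h2]) (SI S) (by
    intro v hv; simp only [Finset.mem_insert, Finset.mem_singleton] at hv; rcases hv with rfl | rfl <;> assumption)
  obtain ⟨g1, g1'⟩ := hg v1 (by simp)
  obtain ⟨g2, g2'⟩ := hg v2 (by simp)
  have conv : ∀ (g : Kˣ) (T : Set (Pl K)), (∀ v ∈ T, v ∈ SI S) → (∀ v ∈ SI S, g ∉ NL v a ↔ v ∈ T) → g ∈ U ⊔ Nloc S a → ∃ c, Rz a c T := by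
    intro g T hTS hgT hgU
    obtain ⟨u, hu, n, hn, rfl⟩ := mem_sup.1 hgU
    refine ⟨u, fun v => ?_⟩
    by_cases hv : v ∈ SI S
    · rw [← hgT v hv, mul_mem_cancel_right (mem_Nloc.1 hn v hv)]
    · have := hU u hu v hv
      simp only [this, not_true, false_iff]
      exact fun h => hv (hTS v h)
  have n1 : g v1 ∉ U ⊔ Nloc S a := fun h => hr1 (conv _ _ (by simpa using hv1) (fun v hv => by
    rw [Set.mem_singleton_iff]
    constructor
    · intro h; by_contra hvv; exact h (D_le_NL _ _ (g1' v hv hvv))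
    · rintro rfl; exact g1) h)
  have n2 : g v2 ∉ U ⊔ Nloc S a := fun h => hr2 (conv _ _ (by simpa using hv2) (fun v hv => by
    rw [Set.mem_singleton_iff]
    constructor
    · intro h; by_contra hvv; exact h (D_le_NL _ _ (g2' v hv hvv))
    · rintro rfl; exact g2) h)
  refine conv _ _ ?_ (fun v hv => ?_) (hi _ _ n1 n2)
  · rintro v (rfl | rfl) <;> assumption
  · rw [Set.mem_insert_iff, Set.mem_singleton_iff]
    constructor
    · intro h; by_contra! hvv; exact h (D_le_NL _ _ (mul_mem (g1' v hv hvv.1) (g2' v hv hvv.2)))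
    · rintro (rfl | rfl)
      · rw [mul_mem_cancel_right (D_le_NL _ _ (g2' v hv hne))]; exact g1
      · rw [mul_mem_cancel_left (D_le_NL _ _ (g1' v hv hne.symm))]; exact g2
end
end TAD

namespace TAD
open Subgroup WithZero IsDedekindDomain NumberField
open scoped WithZero
universe u
section
variable {K L : Type u} [Field K] [NumberField K] [Field L] [NumberField L] [Algebra K L]

/-- restriction of places -/
noncomputable def pd (K : Type u) {L : Type u} [Field K] [NumberField K] [Field L] [NumberField L] [Algebra K L] : Pl L → Pl K :=
  Sum.map (un K) (fun W => W.comap (algebraMap K L))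

lemma D_pd {W : Pl L} {x : Kˣ} (h : x ∈ D (pd K W)) : ι K L x ∈ D W := by
  rcases W with W | W
  · exact D_up h
  · intro hW
    have h1 : ComplexEmbedding.IsReal (W.embedding.comp (algebraMap K L)) := by
      ext y
      have := congrArg (fun f : L →+* ℂ => f (algebraMap K L y)) (InfinitePlace.isReal_iff.1 hW)
      simpa using this
    have hc : InfinitePlace.mk (W.embedding.comp (algebraMap K L)) = W.comap (algebraMap K L) := by
      rw [← InfinitePlace.comap_mk, InfinitePlace.mk_embedding]
    have hr : (W.comap (algebraMap K L)).IsReal := ⟨_, h1, hc⟩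
    have h2 := h hr
    have h3 : (W.comap (algebraMap K L)).embedding = W.embedding.comp (algebraMap K L) := by
      conv_lhs => rw [← hc]
      exact InfinitePlace.embedding_mk_eq_of_isReal h1
    have h4 : InfinitePlace.embedding_of_isReal hr (x : K) = InfinitePlace.embedding_of_isReal hW (ι K L x : L) := by
      apply Complex.ofReal_injective
      rw [InfinitePlace.embedding_of_isReal_apply, InfinitePlace.embedding_of_isReal_apply, h3]; rfl
    rwa [← h4]

lemma Nm_up {a b : Kˣ} (h : b ∈ Nm a) : ι K L b ∈ Nm (ι K L a) := by
  obtain ⟨x, y, h⟩ := h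
  exact ⟨algebraMap K L x, algebraMap K L y, by rw [ι_val, h]; simp⟩

lemma NL_pd {W : Pl L} {a b : Kˣ} (h : b ∈ NL (pd K W) a) : ι K L b ∈ NL W (ι K L a) := by
  obtain ⟨n, hn, hd⟩ := mem_NL.1 h
  exact mem_NL.2 ⟨ι K L n, Nm_up hn, by rw [← map_div]; exact D_pd hd⟩

lemma NL_index' {a : Kˣ} {v : Pl K} {x y : Kˣ} (hx : x ∉ NL v a) (hy : y ∉ NL v a) : x / y ∈ NL v a := by
  rw [div_eq_mul_inv]; exact NL_index hx (fun h => hy (inv_mem_iff.1 h))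

/-- local splitting in a quadratic extension of local degree 2 -/
lemma Quad.local_split {g : Kˣ} (Q : Quad K L g) (W : Pl L) (hg : g ∉ D (pd K W)) (u c : Kˣ) :
    ι K L c ∈ NL W (ι K L u) := by
  by_cases hc : c ∈ NL (pd K W) u
  · exact NL_pd hc
  have hu : NL (pd K W) u ≠ ⊤ := fun h => hc (by rw [h]; trivial)
  have hg' : NL (pd K W) g ≠ ⊤ := by
    obtain ⟨b, hb⟩ := NL_ne_top hg
    exact fun h => hb (by rw [h]; trivial)
  obtain ⟨c', h1, h2⟩ := not_union hu hg'
  have h3 : u * g ∈ NL (pd K W) c' := NL_index (fun h => h1 (NL_symm h)) (fun h => h2 (NL_symm h))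
  have h4 := NL_pd (L := L) (NL_symm h3)
  rw [map_mul, Q.ι_a, NL, Nm_mul_sq] at h4
  have h5 := NL_pd (L := L) (NL_index' hc h1)
  have := mul_mem h5 h4
  rwa [← map_mul, div_mul_cancel] at this

/-- values of the pure quaternion form -/
def Pg (u c g : Kˣ) : Prop := ∃ x y z : K, (g : K) = u * x ^ 2 + c * (y ^ 2 - u * z ^ 2)

lemma Nm_isot {u c : Kˣ} (h : c ∈ Nm u) : ∃ y z : K, (u : K) + c * (y ^ 2 - u * z ^ 2) = 0 := by
  obtain ⟨y, z, h1⟩ := div_mem (neg_mem_Nm u) h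
  refine ⟨y, z, ?_⟩
  rw [← h1]
  push_cast
  field_simp; ring

lemma Pg_of_split {u c : Kˣ} (h : c ∈ Nm u) (g : Kˣ) : Pg u c g := by
  obtain ⟨y, z, h1⟩ := Nm_isot h
  have hu : (u : K) ≠ 0 := u.ne_zero
  let t : K := (g - u) / (2 * u)
  have ht : 2 * u * t = g - u := by simp only [t]; field_simp
  refine ⟨t + 1, t * y, t * z, ?_⟩
  linear_combination (-t ^ 2) * h1 - ht

lemma Nm_of_isot {u c : Kˣ} (x y z : K) (h : (u : K) * x ^ 2 + c * (y ^ 2 - u * z ^ 2) = 0) (hne : ¬ (x = 0 ∧ y = 0 ∧ z = 0)) :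
    c ∈ Nm u := by
  by_cases hn : y ^ 2 - u * z ^ 2 = 0
  · -- u is a square
    have hx : x = 0 := by
      rw [hn, mul_zero, add_zero] at h
      simpa using h
    have hz : z ≠ 0 := fun hz => hne ⟨hx, by simpa [hz] using hn, hz⟩
    have hy : y ≠ 0 := by
      rintro rfl
      simp [hz] at hn
    have : u = (Units.mk0 (y / z) (div_ne_zero hy hz)) ^ 2 := by
      ext; push_cast
      rw [Units.val_mk0]; field_simp
      linear_combination -hn
    rw [this, Nm_sq]; trivial
  · have hx : x ≠ 0 := by
      rintro rfl
      simp [hn] at h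
    have h1 : Units.mk0 _ hn ∈ Nm u := ⟨y, z, rfl⟩
    have h2 := div_mem (mul_mem (neg_mem_Nm u) (sq_mem_Nm u (Units.mk0 x hx))) h1
    convert h2
    ext
    push_cast
    rw [Units.val_mk0, Units.val_mk0]
    field_simp
    linear_combination h

lemma Quad.descent {g : Kˣ} (Q : Quad K L g) {u c : Kˣ} (h : ι K L c ∈ Nm (ι K L u)) : Pg u c g := by
  by_cases hs : c ∈ Nm u
  · exact Pg_of_split hs g
  obtain ⟨y, z, h1⟩ := Nm_isot h
  obtain ⟨p2, q2, rfl⟩ := Q.span y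
  obtain ⟨p3, q3, rfl⟩ := Q.span z
  rw [ι_val, ι_val] at h1
  have hθ := Q.hθ
  have e : algebraMap K L (u + c * (p2 ^ 2 - u * p3 ^ 2) + g * (c * (q2 ^ 2 - u * q3 ^ 2))) 
     + algebraMap K L (2 * c * (p2 * q2 - u * p3 * q3)) * Q.θ = 0 := by
    simp only [map_add, map_mul, map_sub, map_pow, map_ofNat]
    rw [← h1, ← hθ]; ring
  obtain ⟨e1, e2⟩ := Q.indep e
  have hc : (c : K) ≠ 0 := c.ne_zero
  have e3 : p2 * q2 - u * p3 * q3 = 0 := by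
    have h20 : (2 : K) ≠ 0 := two_ne_zero
    simpa [hc, h20] using e2
  set q := (c : K) * (q2 ^ 2 - u * q3 ^ 2) with hq
  have hq0 : q ≠ 0 := by
    intro h0
    rw [h0, mul_zero, add_zero] at e1
    exact hs (Nm_of_isot 1 p2 p3 (by linear_combination e1) (by simp))
  refine ⟨c * (p3 * q2 - p2 * q3) / q, u * q3 / q, q2 / q, ?_⟩
  field_simp
  rw [hq] at e1 ⊢
  linear_combination (c * (q2 ^ 2 - u * q3 ^ 2)) * e1 - c ^ 2 * (p2 * q2 - u * p3 * q3) * e3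
end

section
variable {K : Type u} [Field K] [NumberField K]

theorem thmP {u c g : Kˣ} (h : ∀ v : Pl K, c ∉ NL v u → g ∉ D v) : Pg u c g := by
  by_cases hs : c ∈ Nm u
  · exact Pg_of_split hs g
  obtain ⟨v, hv⟩ : ∃ v : Pl K, c ∉ NL v u := by
    by_contra! hcon; exact hs (HM3 hcon)
  obtain ⟨L, _, _, _, ⟨Q⟩⟩ := exists_quad g (notMem_Sq (h v hv))
  refine Q.descent (HM3 fun W => ?_)
  by_cases hc : c ∈ NL (pd K W) u
  · exact NL_pd hc
  · exact Q.local_split W (h _ hc) u c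

theorem Pg_conv {u c g : Kˣ} (h : Pg u c g) {v : Pl K} (hg : g ∈ D v) : c ∈ NL v u := by
  obtain ⟨x, y, z, h⟩ := h
  by_cases hn : y ^ 2 - u * z ^ 2 = 0
  · rw [hn, mul_zero, add_zero] at h
    have hx : x ≠ 0 := by rintro rfl; simp at h
    have : g = u * (Units.mk0 x hx) ^ 2 := by ext; simpa using h
    rw [this, mul_mem_cancel_right (sq_mem_D v _)] at hg
    rw [NL_top hg]; trivial
  · set n := Units.mk0 _ hn with hnd
    have hnN : n ∈ NL v u := Nm_le_NL v u ⟨y, z, rfl⟩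
    have h1 : c * n * g ∈ Nm (u * g) := by
      refine ⟨g, x, ?_⟩
      push_cast
      rw [hnd, Units.val_mk0]
      linear_combination (-(g : K)) * h
    have h2 := Nm_le_NL v _ h1
    rw [NL_congr (a' := u) (by simpa using hg)] at h2
    rw [mul_mem_cancel_right (D_le_NL v u hg), mul_mem_cancel_right hnN] at h2
    exact h2

open Classical in
/-- local symbol -/
noncomputable def hil (v : Pl K) (a b : Kˣ) : ℤˣ := if b ∈ NL v a then 1 else -1

lemma hil_one_iff {v : Pl K} {a b : Kˣ} : hil v a b = 1 ↔ b ∈ NL v a := by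
  unfold hil; split_ifs with h
  · simp [h]
  · simp only [h, iff_false]; decide

lemma hil_congr {v w : Pl K} {a b c d : Kˣ} (h : b ∈ NL v a ↔ d ∈ NL w c) : hil v a b = hil w c d := by
  unfold hil
  by_cases h1 : b ∈ NL v a
  · rw [if_pos h1, if_pos (h.1 h1)]
  · rw [if_neg h1, if_neg (fun h2 => h1 (h.2 h2))]

lemma hil_comm (v : Pl K) (a b : Kˣ) : hil v a b = hil v b a := hil_congr NL_comm

lemma hil_ne {v : Pl K} {a b : Kˣ} (h : b ∉ NL v a) : hil v a b = -1 := if_neg h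

lemma hil_mul_right (v : Pl K) (a b c : Kˣ) : hil v a (b * c) = hil v a b * hil v a c := by
  by_cases hb : b ∈ NL v a
  · rw [hil_one_iff.2 hb, one_mul]; exact hil_congr (mul_mem_cancel_left hb)
  · by_cases hc : c ∈ NL v a
    · rw [hil_one_iff.2 hc, mul_one]; exact hil_congr (mul_mem_cancel_right hc)
    · rw [hil_ne hb, hil_ne hc, hil_one_iff.2 (NL_index hb hc)]; decide

lemma hil_mul_left (v : Pl K) (a b c : Kˣ) : hil v (b * c) a = hil v b a * hil v c a := by
  rw [hil_comm, hil_mul_right, hil_comm v a, hil_comm v a]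

lemma hil_neg_self (v : Pl K) (a : Kˣ) : hil v a (-a) = 1 := hil_one_iff.2 (neg_mem_NL v a)
lemma hil_D_left {v : Pl K} {a : Kˣ} (h : a ∈ D v) (b : Kˣ) : hil v a b = 1 := hil_one_iff.2 (by rw [NL_top h]; trivial)
lemma hil_D_right {v : Pl K} {a : Kˣ} (h : a ∈ D v) (b : Kˣ) : hil v b a = 1 := by rw [hil_comm]; exact hil_D_left h b
lemma hil_Nm (v : Pl K) {a b : Kˣ} (h : b ∈ Nm a) : hil v a b = 1 := hil_one_iff.2 (Nm_le_NL v a h)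
lemma hil_ne_iff {v : Pl K} {a b : Kˣ} : hil v a b = -1 ↔ b ∉ NL v a := by
  rw [← hil_one_iff]
  rcases Int.units_eq_one_or (hil v a b) with h | h <;> rw [h] <;> decide

/-- presentation change -/
lemma presentation {u c a n : Kˣ} {x : K} (hn : n ∈ Nm u) (h : (a : K) = u * x ^ 2 + c * n) (v : Pl K) :
    hil v u c = hil v a (-(u * c * n)) := by
  have e1 : hil v u c = hil v u (c * n) := by rw [hil_mul_right, hil_Nm v hn, mul_one]
  rw [e1, mul_assoc]
  obtain ⟨m, hm⟩ : ∃ m, m = c * n := ⟨_, rfl⟩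
  rw [← hm]
  have hm' : (a : K) = u * x ^ 2 + m := by rw [hm, h]; simp
  by_cases hx : x = 0
  · have : a = m := by ext; simp [hm', hx]
    rw [this, ← mul_neg, hil_mul_right, hil_neg_self, mul_one, hil_comm]
  · have h1 : m * a ∈ Nm (u * a) := by
      refine ⟨a, x, ?_⟩
      push_cast
      linear_combination (-(a : K)) * hm'
    have h2 := hil_Nm v h1
    have e2 : hil v a a = hil v a (-1) := by
      have := hil_neg_self v a
      rw [← neg_one_mul, hil_mul_right] at this
      rw [eq_comm, eq_comm, ← mul_one (hil v a a), ← this, mul_comm, mul_assoc, Int.units_mul_self, mul_one]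
    rw [hil_mul_left, hil_mul_right, hil_mul_right, e2] at h2
    have e3 : hil v a (-(u * m)) = hil v a (-1) * (hil v u a * hil v a m) := by
      rw [← neg_one_mul, hil_mul_right, hil_mul_right, hil_comm v a u]
    rw [e3]
    have := congrArg (fun t => t * (hil v a (-1) * (hil v u a * hil v a m))) h2
    simp only [one_mul] at this
    rw [← this]
    rcases Int.units_eq_one_or (hil v u m) with h | h <;> rcases Int.units_eq_one_or (hil v u a) with h' | h' <;>
    rcases Int.units_eq_one_or (hil v a m) with h'' | h'' <;> rcases Int.units_eq_one_or (hil v a (-1)) with h3 | h3 <;>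
    rw [h, h', h'', h3] <;> decide
end
end TAD

namespace TAD
open Subgroup WithZero IsDedekindDomain NumberField
open scoped WithZero NumberTheorySymbols

section
variable {K : Type*} [Field K] [NumberField K]

lemma norm_cast_det (c : 𝓞 K) (m : ℕ) : ((Algebra.norm ℤ c : ℤ) : ZMod m) =
    ((Algebra.leftMulMatrix (RingOfIntegers.basis K) c).map (Int.castRingHom (ZMod m))).det := by
  rw [Algebra.norm_eq_matrix_det (RingOfIntegers.basis K), ← RingHom.mapMatrix_apply, ← RingHom.map_det]
  simp

lemma norm_mod_one {c d : 𝓞 K} {m : ℕ} (h : c = 1 + m * d) : ((Algebra.norm ℤ c : ℤ) : ZMod m) = 1 := by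
  rw [norm_cast_det, h, map_add, map_one, map_mul, map_natCast]
  have : (((1 : Matrix _ _ ℤ) + (m : Matrix _ _ ℤ) * Algebra.leftMulMatrix (RingOfIntegers.basis K) d).map
      (Int.castRingHom (ZMod m))) = 1 := by
    rw [← RingHom.mapMatrix_apply, map_add, map_mul, map_one, map_natCast]
    ext i j
    simp
  rw [this, Matrix.det_one]

lemma norm_mod_v (v : HeightOneSpectrum (𝓞 K)) (p : ℕ) [Fact p.Prime] [CharP (RF v) p]
    [Algebra (ZMod p) (RF v)] (c : 𝓞 K) (hc : ∀ x ∈ v.asIdeal, ∃ d : 𝓞 K, (c - 1) * x = p * d) :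
    ((Algebra.norm ℤ c : ℤ) : ZMod p) = Algebra.norm (ZMod p) (Ideal.Quotient.mk v.asIdeal c : RF v) := by
  classical
  set b := RingOfIntegers.basis K
  let I := Module.Free.ChooseBasisIndex ℤ (𝓞 K)
  let A := (Algebra.leftMulMatrix b c).map (Int.castRingHom (ZMod p))
  let E : (I → ZMod p) →ₗ[ZMod p] (I → ZMod p) := Matrix.toLin' A
  have hE : E.det = ((Algebra.norm ℤ c : ℤ) : ZMod p) := by
    rw [norm_cast_det, LinearMap.det_toLin']
  let φ : 𝓞 K →+ (I → ZMod p) :=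
    { toFun := fun x i => ((b.repr x i : ℤ) : ZMod p)
      map_zero' := by ext i; simp
      map_add' := by intro x y; ext i; simp }
  have hφ : ∀ x i, φ x i = ((b.repr x i : ℤ) : ZMod p) := fun _ _ => rfl
  have hφE : ∀ x, φ (c * x) = E (φ x) := by
    intro x
    ext i
    rw [hφ, ← Algebra.leftMulMatrix_mulVec_repr, Matrix.toLin'_apply]
    simp only [Matrix.mulVec, dotProduct, A, Matrix.map_apply, hφ]
    push_cast
    rfl
  have hsurj : Function.Surjective φ := by
    intro f
    refine ⟨b.equivFun.symm (fun i => ((f i).cast : ℤ)), ?_⟩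
    ext i
    rw [hφ]
    have : b.repr (b.equivFun.symm (fun i => ((f i).cast : ℤ))) i = ((f i).cast : ℤ) := by
      rw [← Module.Basis.equivFun_apply, LinearEquiv.apply_symm_apply]
    rw [this]; simp
  have hker : ∀ x, φ x = 0 → ∃ d : 𝓞 K, x = p * d := by
    intro x hx
    have h1 : ∀ i, ∃ k : ℤ, b.repr x i = p * k := by
      intro i
      have := congrFun hx i
      rw [hφ] at this
      exact (ZMod.intCast_zmod_eq_zero_iff_dvd _ _).1 this
    choose k hk using h1
    refine ⟨b.equivFun.symm k, ?_⟩
    have : x = (p : ℤ) • b.equivFun.symm k := by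
      apply b.equivFun.injective
      rw [map_zsmul, LinearEquiv.apply_symm_apply]
      ext i
      simp [Module.Basis.equivFun_apply, hk]
    rw [this]; simp
  have hp0 : ∀ d : 𝓞 K, φ (p * d) = 0 := by
    intro d
    ext i
    rw [hφ]
    have : b.repr (p * d) i = p * b.repr d i := by
      rw [← nsmul_eq_mul, map_nsmul]; simp
    rw [this]; simp
  have hpv : (p : 𝓞 K) ∈ v.asIdeal := by
    rw [← Ideal.Quotient.eq_zero_iff_mem, map_natCast]
    exact CharP.cast_eq_zero (RF v) p
  let W : Submodule (ZMod p) (I → ZMod p) :=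
    AddSubgroup.toZModSubmodule p (v.asIdeal.toAddSubgroup.map φ)
  have hW : ∀ f, f ∈ W ↔ ∃ x ∈ v.asIdeal, φ x = f := by
    intro f
    simp [W]
  have hfix : ∀ f ∈ W, E f = f := by
    intro f hf
    obtain ⟨x, hx, rfl⟩ := (hW f).1 hf
    obtain ⟨d, hd⟩ := hc x hx
    rw [← hφE, show c * x = x + p * d by rw [← hd]; ring, map_add, hp0, add_zero]
  have he : W ≤ W.comap E := by
    intro f hf
    rw [Submodule.mem_comap, hfix f hf]; exact hf
  have hdet := LinearMap.det_eq_det_mul_det W E he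
  have h1 : E.restrict he = LinearMap.id := by
    ext f : 1
    apply Subtype.ext
    exact hfix f f.2
  rw [h1, LinearMap.det_id, one_mul, hE] at hdet
  rw [hdet, Algebra.norm_apply]
  have hmem : ∀ x, φ x ∈ W ↔ x ∈ v.asIdeal := by
    intro x
    rw [hW]
    constructor
    · rintro ⟨y, hy, hxy⟩
      obtain ⟨d, hd⟩ := hker (x - y) (by rw [map_sub, hxy, sub_self])
      rw [show x = p * d + y by rw [← hd]; ring]
      exact add_mem (Ideal.mul_mem_right _ _ hpv) hy
    · intro h; exact ⟨x, h, rfl⟩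
  -- the isomorphism
  let ψ0 : 𝓞 K →+ ((I → ZMod p) ⧸ W) := (W.mkQ.toAddMonoidHom).comp φ
  let ψ : RF v →+ ((I → ZMod p) ⧸ W) := QuotientAddGroup.lift v.asIdeal.toAddSubgroup ψ0 (by
    intro x hx
    change W.mkQ (φ x) = 0
    rw [Submodule.mkQ_apply, Submodule.Quotient.mk_eq_zero]
    exact (hmem x).2 hx)
  have hψ : ∀ x, ψ (Ideal.Quotient.mk v.asIdeal x) = Submodule.Quotient.mk (φ x) := fun x => rfl
  have hbij : Function.Bijective ψ := by
    constructor
    · rw [injective_iff_map_eq_zero]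
      intro z hz
      obtain ⟨x, rfl⟩ := Ideal.Quotient.mk_surjective z
      rw [hψ, Submodule.Quotient.mk_eq_zero, hmem] at hz
      exact Ideal.Quotient.eq_zero_iff_mem.2 hz
    · intro z
      obtain ⟨f, rfl⟩ := Submodule.Quotient.mk_surjective W z
      obtain ⟨x, rfl⟩ := hsurj f
      exact ⟨_, hψ x⟩
  let e : RF v ≃ₗ[ZMod p] ((I → ZMod p) ⧸ W) := LinearEquiv.ofBijective (ψ.toZModLinearMap p) hbij
  have he' : ∀ z, e z = ψ z := fun _ => rfl
  rw [← LinearMap.det_conj _ e]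
  congr 1
  apply LinearMap.ext
  intro z
  obtain ⟨z, rfl⟩ := e.surjective z
  obtain ⟨x, rfl⟩ := Ideal.Quotient.mk_surjective z
  rw [LinearMap.comp_apply, LinearMap.comp_apply, LinearEquiv.coe_coe, LinearEquiv.coe_coe, LinearEquiv.symm_apply_apply]
  have hl : (Algebra.lmul (ZMod p) (RF v) (Ideal.Quotient.mk v.asIdeal c)) (Ideal.Quotient.mk v.asIdeal x)
    = Ideal.Quotient.mk v.asIdeal (c * x) := by rw [map_mul]; rfl
  rw [hl, he', he', hψ, hψ, Submodule.mapQ_apply, hφE]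

/-- norm of a nonsquare is a nonsquare -/
lemma norm_nonsq {F L : Type*} [Field F] [Field L] [Finite F] [Finite L] [Algebra F L] (hF : ringChar L ≠ 2)
    {x : L} (hx : ¬ IsSquare x) : ¬ IsSquare (Algebra.norm F x) := by
  classical
  rintro ⟨t, ht⟩
  have := Fintype.ofFinite F
  have := Fintype.ofFinite L
  have hx0 : x ≠ 0 := by rintro rfl; exact hx (IsSquare.zero)
  have ht0 : t ≠ 0 := by
    rintro rfl
    rw [mul_zero, Algebra.norm_eq_zero_iff] at ht
    exact hx0 ht
  apply hx
  rw [FiniteField.isSquare_iff hF hx0]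
  have e1 := FiniteField.algebraMap_norm_eq_pow (K := F) (K' := L) (x := x)
  rw [Nat.card_eq_fintype_card, Nat.card_eq_fintype_card] at e1
  have hF' : ringChar F ≠ 2 := by
    rwa [Algebra.ringChar_eq F L]
  have oL := FiniteField.odd_card_of_char_ne_two hF
  have oF := FiniteField.odd_card_of_char_ne_two hF'
  have hc : Fintype.card L = Fintype.card F ^ Module.finrank F L := Module.card_eq_pow_finrank
  have hd : Fintype.card F - 1 ∣ Fintype.card L - 1 := by
    rw [hc]; simpa using Nat.sub_dvd_pow_sub_pow (Fintype.card F) 1 (Module.finrank F L)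
  obtain ⟨k, hk⟩ := hd
  have h1F := Fintype.one_lt_card (α := F)
  have e2 : Fintype.card L / 2 = k * ((Fintype.card F - 1) / 2) := by
    obtain ⟨j, hj⟩ : ∃ j, Fintype.card F = 2 * j + 1 := ⟨Fintype.card F / 2, by omega⟩
    rw [hj] at hk ⊢
    have : Fintype.card L = 2 * (j * k) + 1 := by
      have : (2 * j + 1 - 1) * k = 2 * (j * k) := by rw [Nat.add_sub_cancel]; ring
      have := Fintype.card_pos (α := L)
      omega
    rw [this, show (2 * j + 1 - 1) / 2 = j by omega, mul_comm k j]; omega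
  rw [hk, Nat.mul_div_cancel_left _ (by omega)] at e1
  rw [e2, pow_mul, ← e1, ht, ← map_pow, ← sq, ← pow_mul, show 2 * ((Fintype.card F - 1) / 2) = Fintype.card F - 1 by omega,
    FiniteField.pow_card_sub_one_eq_one t ht0, map_one]

/-- Jacobi symbol of the norm of a prime where r is a local square -/
lemma jac_norm (w : HeightOneSpectrum (𝓞 K)) (r : ℕ) (hr : r % 8 = 1) (hrw : (r : 𝓞 K) ∉ w.asIdeal) :
    Int.gcd (Ideal.absNorm w.asIdeal : ℤ) r = 1 ∧
    ((2 : 𝓞 K) ∈ w.asIdeal ∨ IsSquare (Ideal.Quotient.mk w.asIdeal (r : 𝓞 K) : RF w) →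
      J((Ideal.absNorm w.asIdeal : ℤ) | r) = 1) := by
  classical
  obtain ⟨q, hq⟩ := CharP.exists (RF w)
  have hqp : q.Prime := (CharP.char_is_prime_or_zero (RF w) q).resolve_right
    (CharP.char_ne_zero_of_finite (RF w) q)
  have : Fact q.Prime := ⟨hqp⟩
  let _ : Algebra (ZMod q) (RF w) := ZMod.algebra (RF w) q
  have hcard : Ideal.absNorm w.asIdeal = q ^ Module.finrank (ZMod q) (RF w) := by
    rw [Ideal.absNorm_apply, Submodule.cardQuot_apply]
    have := Module.natCard_eq_pow_finrank (K := ZMod q) (V := RF w)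
    rw [Nat.card_zmod] at this
    exact this
  have hqr : ¬ q ∣ r := by
    rintro ⟨k, hk⟩
    apply hrw
    rw [← Ideal.Quotient.eq_zero_iff_mem, hk, Nat.cast_mul, map_mul, map_natCast, CharP.cast_eq_zero (RF w) q, zero_mul]
  have hco : Nat.Coprime q r := (Nat.Prime.coprime_iff_not_dvd hqp).2 hqr
  constructor
  · rw [hcard]
    exact_mod_cast Nat.Coprime.pow_left _ hco
  · intro h
    rw [hcard, Nat.cast_pow, jacobiSym.pow_left]
    have hodd : Odd r := Nat.odd_iff.2 (by omega)
    by_cases h2 : q = 2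
    · have : J((2 : ℤ) | r) = 1 := by
        rw [jacobiSym.at_two hodd, ZMod.χ₈_nat_eq_if_mod_eight]
        simp [hr, show r % 2 ≠ 0 by omega]
      rw [show ((q : ℕ) : ℤ) = 2 by rw [h2]; rfl, this, one_pow]
    · have hsq : IsSquare (Ideal.Quotient.mk w.asIdeal (r : 𝓞 K) : RF w) := by
        rcases h with h | h
        · exfalso
          rw [← Ideal.Quotient.eq_zero_iff_mem, map_ofNat] at h
          have := (CharP.cast_eq_zero_iff (RF w) q 2).1 (by exact_mod_cast h)
          exact h2 ((Nat.prime_dvd_prime_iff_eq hqp Nat.prime_two).1 this)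
        · exact h
      have hqo : Odd q := hqp.odd_of_ne_two h2
      rw [← jacobiSym.quadratic_reciprocity_one_mod_four (a := r) (b := q) (by omega) hqo, ← jacobiSym.pow_left]
      obtain ⟨s, hs⟩ := hsq
      have hn := congrArg (Algebra.norm (ZMod q)) hs
      rw [map_natCast, map_mul, ← map_natCast (algebraMap (ZMod q) (RF w)), Algebra.norm_algebraMap] at hn
      rw [← jacobiSym.legendreSym.to_jacobiSym, legendreSym.eq_one_iff]
      · push_cast
        exact ⟨_, hn⟩
      · push_cast
        apply pow_ne_zero
        rwa [Ne, ZMod.natCast_eq_zero_iff]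
end
end TAD

namespace TAD
open Subgroup WithZero IsDedekindDomain NumberField
open scoped WithZero NumberTheorySymbols

section
variable {K : Type*} [Field K] [NumberField K]

lemma jac_one (r : ℕ) (hr : r % 8 = 1) (c : 𝓞 K) (hc : c ≠ 0)
    (h1 : ∀ w : HeightOneSpectrum (𝓞 K), (r : 𝓞 K) ∈ w.asIdeal → c ∉ w.asIdeal)
    (h2 : ∀ w : HeightOneSpectrum (𝓞 K), (r : 𝓞 K) ∉ w.asIdeal → (∃ k : ℤ, Even k ∧ vl w (c : K) = exp k) ∨ 
      ((2 : 𝓞 K) ∈ w.asIdeal ∨ IsSquare (Ideal.Quotient.mk w.asIdeal (r : 𝓞 K) : RF w))) :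
    J(Algebra.norm ℤ c | r) = 1 := by
  classical
  have hodd : Odd r := Nat.odd_iff.2 (by omega)
  have hJ : ∀ n : ℤ, J(n | r) = J((n.natAbs : ℤ) | r) := by
    intro n
    rcases Int.natAbs_eq n with h | h
    · rw [← h]
    · conv_lhs => rw [h]
      rw [jacobiSym.neg _ hodd, ZMod.χ₄_nat_one_mod_four (by omega), one_mul]
  rw [hJ, ← Ideal.absNorm_span_singleton]
  let φ : Ideal (𝓞 K) →* ℤ :=
    { toFun := fun I => J((Ideal.absNorm I : ℤ) | r)
      map_one' := by simp
      map_mul' := by intro I J; simp [jacobiSym.mul_left] }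
  change φ (Ideal.span {c}) = 1
  have hI : Ideal.span {c} ≠ 0 := by simpa using hc
  rw [← Ideal.finprod_heightOneSpectrum_factorization hI, MonoidHom.map_finprod _ (Ideal.hasFiniteMulSupport hI)]
  apply finprod_eq_one_of_forall_eq_one
  intro w
  rw [HeightOneSpectrum.maxPowDividing, map_pow]
  obtain ⟨n, hn⟩ : ∃ n, n = (Associates.mk w.asIdeal).count (Associates.mk (Ideal.span {c})).factors := ⟨_, rfl⟩
  have hv : vl w (c : K) = exp (-(n : ℤ)) := by
    rw [hn, ← w.intValuation_if_neg hc]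
    exact w.valuation_of_algebraMap c
  rw [← hn]
  change J((Ideal.absNorm w.asIdeal : ℤ) | r) ^ n = 1
  by_cases hw : (r : 𝓞 K) ∈ w.asIdeal
  · have := h1 w hw
    rw [← w.valuation_eq_one_iff_notMem (K := K)] at this
    have h3 : vl w (c : K) = exp 0 := this
    rw [hv, exp_inj] at h3
    rw [show n = 0 by omega, pow_zero]
  · obtain ⟨hg, hs⟩ := jac_norm w r hr hw
    rcases h2 w hw with ⟨k, ⟨j, hk⟩, hk'⟩ | h
    · rw [hv, exp_inj] at hk'
      obtain ⟨m, hm⟩ : ∃ m, n = 2 * m := ⟨n / 2, by omega⟩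
      rw [hm, pow_mul, jacobiSym.sq_one hg, one_pow]
    · rw [hs h, one_pow]

lemma coprime_denom (b : K) (r : 𝓞 K) (hr : r ≠ 0) (h : ∀ w : HeightOneSpectrum (𝓞 K), r ∈ w.asIdeal → vl w b ≤ 1) :
    ∃ y t c : 𝓞 K, y = 1 - r * t ∧ algebraMap (𝓞 K) K c = algebraMap (𝓞 K) K y ^ 2 * b := by
  let I : Ideal (𝓞 K) :=
    { carrier := {y | ∃ c : 𝓞 K, algebraMap (𝓞 K) K c = algebraMap (𝓞 K) K y * b}
      zero_mem' := ⟨0, by simp⟩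
      add_mem' := by
        rintro x y ⟨c, hc⟩ ⟨d, hd⟩
        exact ⟨c + d, by rw [map_add, map_add, hc, hd]; ring⟩
      smul_mem' := by
        rintro x y ⟨c, hc⟩
        exact ⟨x * c, by rw [smul_eq_mul, map_mul, map_mul, hc]; ring⟩ }
  have htop : I ⊔ Ideal.span {r} = ⊤ := by
    by_contra hne
    obtain ⟨M, hM, hle⟩ := Ideal.exists_le_maximal _ hne
    have hrM : r ∈ M := hle (Ideal.mem_sup_right (Ideal.mem_span_singleton_self r))
    have hM0 : M ≠ ⊥ := by
      rintro rfl; exact hr (by simpa using hrM)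
    let w : HeightOneSpectrum (𝓞 K) := ⟨M, hM.isPrime, hM0⟩
    obtain ⟨n, d, hnd⟩ := w.exists_primeCompl_mul_eq_of_integer b (h w hrM)
    have : (d : 𝓞 K) ∈ I := ⟨n, by rw [← hnd]; exact mul_comm _ _⟩
    exact d.2 (hle (Ideal.mem_sup_left this))
  have h1 : (1 : 𝓞 K) ∈ I ⊔ Ideal.span {r} := by rw [htop]; trivial
  obtain ⟨y, ⟨c, hc⟩, z, hz, hyz⟩ := Submodule.mem_sup.1 h1
  obtain ⟨t, rfl⟩ := Ideal.mem_span_singleton'.1 hz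
  refine ⟨y, t, y * c, by rw [← hyz]; ring, by rw [map_mul, hc]; ring⟩

lemma sq_adjust (T : Finset (HeightOneSpectrum (𝓞 K))) (b r : Kˣ) (s : HeightOneSpectrum (𝓞 K) → Kˣ)
    (hr : ∀ w ∈ T, vl w (r : K) ≤ 1) :
    ∃ t : Kˣ, ∀ w ∈ T, vl w ((b * t ^ 2 : K) - b * (s w : K) ^ 2) < vl w ((b * s w ^ 2 : K)) * vl w (r : K) := by
  classical
  rcases T.eq_empty_or_nonempty with rfl | ⟨w0, hw0⟩
  · exact ⟨1, by simp⟩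
  have hinf : ∃ ε : ℝ, 0 < ε ∧ ∀ w ∈ T, ε ≤ abv (.inl w) ((s w * r : Kˣ) : K) :=
    exists_pos_le T (fun w => abv (.inl w) ((s w * r : Kˣ) : K)) (fun w => (abv (.inl w)).pos (Units.ne_zero _))
  obtain ⟨ε, hε, hle⟩ := hinf
  obtain ⟨t, ht⟩ := weak_approx (T.map ⟨Sum.inl, Sum.inl_injective⟩) (fun v => v.elim (fun w => (s w : K)) (fun _ => 1)) hε
  have ht' : ∀ w ∈ T, vl w (t - s w) < vl w (s w : K) * vl w (r : K) := by
    intro w hw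
    have := (ht (.inl w) (by simpa using hw)).trans_le (hle w hw)
    rw [abv_fin_lt] at this
    rw [← (vl w).map_mul]; exact this
  have hs1 : ∀ w ∈ T, vl w (s w : K) * vl w (r : K) ≤ vl w (s w : K) := fun w hw => mul_le_of_le_one_right' (hr w hw)
  have ht0 : t ≠ 0 := by
    rintro rfl
    have := (ht' w0 hw0).trans_le (hs1 w0 hw0)
    rw [zero_sub, Valuation.map_neg] at this
    exact lt_irrefl _ this
  refine ⟨Units.mk0 t ht0, fun w hw => ?_⟩
  rw [Units.val_mk0, show (b * t ^ 2 : K) - b * (s w : K) ^ 2 = (t - s w) * ((t - s w + 2 * s w) * b) by ring,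
    show (b * s w ^ 2 : K) = s w * (s w * b) by ring, (vl w).map_mul, (vl w).map_mul (s w : K), mul_right_comm, 
    (vl w).map_mul _ (b : K), (vl w).map_mul _ (b : K)]
  have h2 : vl w (t - s w + 2 * s w) ≤ vl w (s w : K) := by
    refine ((vl w).map_add _ _).trans (max_le ((ht' w hw).le.trans (hs1 w hw)) ?_)
    rw [(vl w).map_mul]
    exact mul_le_of_le_one_left' (by exact_mod_cast w.valuation_le_one (K := K) 2)
  refine lt_of_le_of_lt (mul_le_mul' le_rfl (mul_le_mul' h2 le_rfl)) ?_
  exact mul_lt_mul_of_pos_right (ht' w hw) (mul_pos (vl_pos _) (vl_pos _))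
end
end TAD

namespace TAD
open Subgroup WithZero IsDedekindDomain NumberField
open scoped WithZero NumberTheorySymbols

section
variable {K : Type*} [Field K] [NumberField K]

lemma int_dvd {x m : 𝓞 K} (hm : m ≠ 0) (h : ∀ w : HeightOneSpectrum (𝓞 K), vl w (algebraMap (𝓞 K) K x) ≤ vl w (algebraMap (𝓞 K) K m)) :
    ∃ d : 𝓞 K, x = m * d := by
  have hm' : algebraMap (𝓞 K) K m ≠ 0 := by simpa using hm
  obtain ⟨d, hd⟩ := HeightOneSpectrum.mem_integers_of_valuation_le_one (R := 𝓞 K) K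
    (algebraMap (𝓞 K) K x / algebraMap (𝓞 K) K m) (by
      intro w
      rw [map_div₀]
      exact div_le_one_of_le₀ (h w) zero_le)
  refine ⟨d, ?_⟩
  apply FaithfulSMul.algebraMap_injective (𝓞 K) K
  rw [map_mul, hd]
  field_simp

lemma red_sq_of_D {w : HeightOneSpectrum (𝓞 K)} (h2 : vl w 2 = 1) {a : Kˣ} (ha : vl w (a : K) = 1)
    (h : a ∈ Dval (vl w)) : IsSquare (red w (a : K)) := by
  obtain ⟨s, hs⟩ := h
  rw [v4_eq, h2, mul_one] at hs
  have hs1 : vl w ((a : K) * s ^ 2) = 1 := by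
    have := (vl w).map_add_eq_of_lt_right (x := (a : K) * s ^ 2 - 1) (y := 1) (by simpa using hs)
    simpa using this
  have hs2 : vl w (s : K) = 1 := by
    rw [(vl w).map_mul, ha, one_mul, map_pow] at hs1
    exact (pow_eq_one_iff.1 hs1).resolve_right (by norm_num)
  have e : red w ((a : K) * s ^ 2) = red w 1 := (red_eq_iff hs1.le (by simp)).2 hs
  rw [red_mul ha.le (by simp [hs2]), red_sq hs2.le, red_one] at e
  refine ⟨(red w (s : K))⁻¹, ?_⟩
  have h0 := red_ne_zero hs2
  field_simp
  linear_combination e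

/-- change to the slot r -/
lemma Rz_slot {u c r : Kˣ} {T : Set (Pl K)} (h : Rz u c T) (hr : ∀ v ∈ T, r ∉ D v) : ∃ b, Rz r b T := by
  obtain ⟨x, y, z, hg⟩ := thmP (u := u) (c := c) (g := r) (fun v hv => hr v ((h v).1 hv))
  by_cases hn : y ^ 2 - u * z ^ 2 = 0
  · rw [hn, mul_zero, add_zero] at hg
    have hx : x ≠ 0 := by rintro rfl; simp at hg
    refine ⟨c, fun v => ?_⟩
    rw [← h v, show r = u * (Units.mk0 x hx) ^ 2 by ext; simp [hg], NL, Nm_mul_sq]; rfl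
  · refine ⟨-(u * c * Units.mk0 _ hn), fun v => ?_⟩
    rw [← h v, ← hil_ne_iff, ← hil_ne_iff, presentation (n := Units.mk0 _ hn) (a := r) (x := x) ⟨y, z, rfl⟩ (by simpa using hg)]

lemma vl_alg_lt {w : HeightOneSpectrum (𝓞 K)} {x : 𝓞 K} : vl w (algebraMap (𝓞 K) K x) < 1 ↔ x ∈ w.asIdeal :=
  w.valuation_lt_one_iff_mem (K := K) x
lemma vl_alg_le (w : HeightOneSpectrum (𝓞 K)) (x : 𝓞 K) : vl w (algebraMap (𝓞 K) K x) ≤ 1 :=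
  w.valuation_le_one (K := K) x
lemma vl_alg_one {w : HeightOneSpectrum (𝓞 K)} {x : 𝓞 K} : vl w (algebraMap (𝓞 K) K x) = 1 ↔ x ∉ w.asIdeal :=
  w.valuation_eq_one_iff_notMem (K := K)

lemma R0_elt (v : HeightOneSpectrum (𝓞 K)) (r : 𝓞 K) (rU : Kˣ) (hrU : (rU : K) = algebraMap (𝓞 K) K r)
    (hrv : vl v (rU : K) = exp (-1 : ℤ)) (b : Kˣ) (hb : Rz rU b {.inl v}) :
    ∃ (c : 𝓞 K) (cU : Kˣ), (cU : K) = algebraMap (𝓞 K) K c ∧ Rz rU cU {.inl v} ∧ vl v (cU : K) = 1 ∧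
      ∀ w ≠ v, r ∈ w.asIdeal → vl w (algebraMap (𝓞 K) K (c - 1)) ≤ vl w (rU : K) := by
  classical
  obtain ⟨S, hS⟩ := exists_US rU
  have hr1 : ∀ w, vl w (rU : K) ≤ 1 := fun w => by rw [hrU]; exact vl_alg_le w r
  have hrS : ∀ w, r ∈ w.asIdeal → w ∈ S := by
    intro w hw
    by_contra h
    have := hS w h
    rw [hrU, vl_alg_one] at this
    exact this hw
  have hr0 : r ≠ 0 := by
    rintro rfl
    rw [map_zero] at hrU
    exact rU.ne_zero hrU
  have hvr : r ∈ v.asIdeal := by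
    rw [← vl_alg_lt (K := K), ← hrU, hrv, ← exp_zero, exp_lt_exp]; norm_num
  set nv : Kˣ := if EvenV v b then 1 else -rU with hnv
  obtain ⟨z, hz, hzD⟩ := approx_Nm' (S.map ⟨Sum.inl, Sum.inl_injective⟩) rU
    (fun w => if w = .inl v then nv else b) (by
      intro w _
      by_cases hw : w = .inl v
      · simp only [hw, if_true, hnv]
        split_ifs
        · exact one_mem _
        · exact neg_mem_NL _ _
      · simp only [if_neg hw]
        by_contra h
        exact hw ((hb w).1 h))
  have hzv : z / nv ∈ Dval (vl v) := by
    have := hzD (.inl v) (by simpa using hrS v hvr)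
    rw [if_pos rfl] at this; exact this
  have hzw : ∀ w ∈ S, w ≠ v → b * z ∈ Dval (vl w) := by
    intro w hw hne
    have := hzD (.inl w) (by simpa using hw)
    rw [if_neg (by simpa using hne)] at this
    have h2 : b * z = (z / b) * b ^ 2 := by
      rw [sq, ← mul_assoc, div_mul_cancel, mul_comm]
    rw [h2]
    exact mul_mem this (sq_mem_Dval b)
  have hev : EvenV v (b * z) := by
    have h1 : EvenV v (z / nv) := Dval_even hzv
    by_cases he : EvenV v b
    · rw [hnv, if_pos he, div_one] at h1
      exact he.mul v h1
    · rw [hnv, if_neg he] at h1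
      have h2 : EvenV v (b * -rU) := by
        obtain ⟨k, ⟨j, hj⟩, hk⟩ := (even_or v b).resolve_left he
        obtain ⟨π, hπ⟩ := exists_unif v
        refine ⟨π ^ (-j), ?_⟩
        rw [Units.val_mul, (vl v).map_mul, hk, Units.val_neg, Valuation.map_neg, hrv, Units.val_zpow_eq_zpow_val, map_zpow₀, hπ,
          ← exp_add, ← exp_zsmul, ← exp_nsmul, exp_inj]
        simp; omega
      have := EvenV.mul v h1 h2
      have e : z / -rU * (b * -rU) = b * z := by
        rw [mul_left_comm, div_mul_cancel]
      rwa [e] at this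
  have hs : ∀ w, ∃ s : Kˣ, (w ∈ S → w ≠ v → vl w ((b * z : Kˣ) * (s : K) ^ 2 - 1) < vl w (rU : K)) ∧
      (w = v → vl w ((b * z : Kˣ) * (s : K) ^ 2) = 1) := by
    intro w
    by_cases hwv : w = v
    · obtain ⟨s, hs⟩ := hev.scale
      refine ⟨s, fun _ h => absurd hwv h, fun h => ?_⟩
      rw [h, ← hs]; simp
    · by_cases hw : w ∈ S
      · obtain ⟨s, hs⟩ := newton (hzw w hw hwv) (vl_ne rU)
        exact ⟨s, fun _ _ => hs, fun h => absurd h hwv⟩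
      · exact ⟨1, fun h => absurd h hw, fun h => absurd h hwv⟩
  choose s hs1 hs2 using hs
  obtain ⟨t, ht⟩ := sq_adjust S (b * z) rU s (fun w _ => hr1 w)
  set b2 : K := (b * z : Kˣ) * (t : K) ^ 2 with hb2
  have hv2 : vl v b2 = 1 := by
    have h1 := ht v (hrS v hvr)
    rw [hs2 v rfl, one_mul] at h1
    have h3 := hs2 v rfl
    have := (vl v).map_add_eq_of_lt_right (x := b2 - (b * z : Kˣ) * (s v : K) ^ 2) (y := (b * z : Kˣ) * (s v : K) ^ 2)
      (by rw [h3]; exact h1.trans_le (hr1 v))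
    rw [sub_add_cancel, h3] at this
    exact this
  have hw2 : ∀ w ∈ S, w ≠ v → vl w (b2 - 1) < vl w (rU : K) := by
    intro w hw hne
    have h1 := ht w hw
    have h3 := hs1 w hw hne
    have h4 : vl w ((b * z : Kˣ) * (s w : K) ^ 2) ≤ 1 := by
      have := (vl w).map_add ((b * z : Kˣ) * (s w : K) ^ 2 - 1) 1
      rw [sub_add_cancel, map_one] at this
      exact this.trans (max_le (h3.le.trans (hr1 w)) le_rfl)
    have := (vl w).map_add (b2 - (b * z : Kˣ) * (s w : K) ^ 2) ((b * z : Kˣ) * (s w : K) ^ 2 - 1)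
    rw [sub_add_sub_cancel] at this
    exact this.trans_lt (max_lt (h1.trans_le (mul_le_of_le_one_left' h4)) h3)
  have hw1 : ∀ w, r ∈ w.asIdeal → vl w b2 ≤ 1 := by
    intro w hw
    by_cases hwv : w = v
    · rw [hwv, hv2]
    · have := (vl w).map_add (b2 - 1) 1
      rw [sub_add_cancel, map_one] at this
      exact this.trans (max_le ((hw2 w (hrS w hw) hwv).le.trans (hr1 w)) le_rfl)
  obtain ⟨y, t', c, hy, hc⟩ := coprime_denom b2 r hr0 hw1
  have hyv : ∀ w : HeightOneSpectrum (𝓞 K), r ∈ w.asIdeal → y ∉ w.asIdeal := by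
    intro w hw hy'
    apply w.isPrime.ne_top
    rw [Ideal.eq_top_iff_one, show (1 : 𝓞 K) = y + r * t' by rw [hy]; ring]
    exact add_mem hy' (Ideal.mul_mem_right _ _ hw)
  have hy0 : algebraMap (𝓞 K) K y ≠ 0 := by
    have : y ≠ 0 := by
      intro h
      exact hyv v hvr (by rw [h]; exact zero_mem _)
    simpa using this
  refine ⟨c, b * z * (t * Units.mk0 _ hy0) ^ 2, ?_, ?_, ?_, ?_⟩
  · rw [hc, hb2]; push_cast [Units.val_mk0]; ring
  · intro w
    rw [← hb w, mul_assoc]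
    have : z * (t * Units.mk0 _ hy0) ^ 2 ∈ NL w rU := mul_mem (Nm_le_NL w rU hz) (D_le_NL w rU (sq_mem_D w _))
    rw [mul_mem_cancel_right this]
  · have e : ((b * z * (t * Units.mk0 _ hy0) ^ 2 : Kˣ) : K) = b2 * algebraMap (𝓞 K) K y ^ 2 := by
      rw [hb2]; push_cast [Units.val_mk0]; ring
    rw [e, (vl v).map_mul, hv2, map_pow, vl_alg_one.2 (hyv v hvr)]; simp
  · intro w hwv hw
    have e : algebraMap (𝓞 K) K (c - 1) = algebraMap (𝓞 K) K (y ^ 2) * (b2 - 1) + (rU : K) * algebraMap (𝓞 K) K (-(t' * (y + 1))) := by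
      have h1 : algebraMap (𝓞 K) K (c - 1) = algebraMap (𝓞 K) K (y ^ 2) * (b2 - 1) + algebraMap (𝓞 K) K (y ^ 2 - 1) := by
        rw [map_sub, map_sub, hc, map_pow, map_one]; ring
      rw [h1, hrU, ← map_mul]
      congr 2
      rw [hy]; ring
    rw [e]
    refine ((vl w).map_add _ _).trans (max_le ?_ ?_)
    · rw [(vl w).map_mul]
      exact (mul_le_of_le_one_left' (vl_alg_le w _)).trans (hw2 w (hrS w hw) hwv).le
    · rw [(vl w).map_mul]
      exact mul_le_of_le_one_right' (vl_alg_le w _)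

/-- a quaternion algebra is not ramified at exactly one good place -/
theorem R0 (v : HeightOneSpectrum (𝓞 K)) (p : ℕ) (hp : p.Prime) (hpv : vl v ((p : ℕ) : K) = exp (-1 : ℤ)) (h2 : vl v 2 = 1)
    (u c : Kˣ) : ¬ Rz u c {.inl v} := by
  classical
  intro hR
  have hFp : Fact p.Prime := ⟨hp⟩
  have hp2 : p ≠ 2 := by
    rintro rfl
    rw [Nat.cast_ofNat, h2, ← exp_zero, exp_inj] at hpv
    norm_num at hpv
  have hpo := hp.odd_of_ne_two hp2
  obtain ⟨r, hrdef⟩ : ∃ r, r = p * (p + 8) := ⟨_, rfl⟩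
  have hr8 : r % 8 = 1 := by
    obtain ⟨j, hj⟩ := hpo
    have : p % 8 = 1 ∨ p % 8 = 3 ∨ p % 8 = 5 ∨ p % 8 = 7 := by omega
    rw [hrdef, Nat.mul_mod, Nat.add_mod_right]
    rcases this with h | h | h | h <;> rw [h]
  have hp0 : p ≠ 0 := hp.ne_zero
  have hr0 : r ≠ 0 := by omega
  have halg : ∀ n : ℕ, algebraMap (𝓞 K) K (n : 𝓞 K) = (n : K) := fun n => map_natCast _ n
  have hpi : (p : 𝓞 K) ∈ v.asIdeal := by
    rw [← vl_alg_lt (K := K), halg, hpv, ← exp_zero, exp_lt_exp]; norm_num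
  have h2i : (2 : 𝓞 K) ∉ v.asIdeal := by
    rw [← vl_alg_one (K := K), map_ofNat]; exact h2
  have hp8 : ((p + 8 : ℕ) : 𝓞 K) ∉ v.asIdeal := by
    intro h
    have : (2 : 𝓞 K) ^ 3 ∈ v.asIdeal := by
      have e : (2 : 𝓞 K) ^ 3 = ((p + 8 : ℕ) : 𝓞 K) - p := by push_cast; ring
      rw [e]; exact sub_mem h hpi
    exact h2i (v.isPrime.mem_of_pow_mem _ this)
  have hrv : vl v ((r : ℕ) : K) = exp (-1 : ℤ) := by
    rw [hrdef, Nat.cast_mul, (vl v).map_mul, hpv, ← halg, vl_alg_one.2 hp8, mul_one]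
  set rU : Kˣ := Units.mk0 (r : K) (by exact_mod_cast hr0) with hrU
  have hrv' : vl v (rU : K) = exp (-1 : ℤ) := hrv
  have hrD : rU ∉ D (.inl v) := by
    intro h
    have h' : rU ∈ Dval (vl v) := h
    exact not_even_exp v hrv' (by decide) (Dval_even h')
  obtain ⟨b, hb⟩ := Rz_slot hR (r := rU) (by intro w hw; rw [Set.mem_singleton_iff.1 hw]; exact hrD)
  obtain ⟨c, cU, hcU, hRc, hcv, hcw⟩ := R0_elt v (r : 𝓞 K) rU (by rw [halg]; rfl) hrv' b hb
  have hc0 : c ≠ 0 := by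
    rintro rfl
    rw [map_zero] at hcU; exact cU.ne_zero hcU
  have hrw : ∀ w : HeightOneSpectrum (𝓞 K), vl w (rU : K) = vl w (algebraMap (𝓞 K) K (p : 𝓞 K)) * vl w (algebraMap (𝓞 K) K ((p + 8 : ℕ) : 𝓞 K)) := by
    intro w
    rw [← (vl w).map_mul, ← map_mul, ← Nat.cast_mul, ← hrdef, halg]; rfl
  -- congruences
  obtain ⟨d, hd⟩ : ∃ d : 𝓞 K, c - 1 = ((p + 8 : ℕ) : 𝓞 K) * d := by
    apply int_dvd (by exact_mod_cast (by omega : p + 8 ≠ 0))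
    intro w
    by_cases hw : ((p + 8 : ℕ) : 𝓞 K) ∈ w.asIdeal
    · have hwv : w ≠ v := by rintro rfl; exact hp8 hw
      refine (hcw w hwv ?_).trans ?_
      · rw [hrdef, Nat.cast_mul]; exact Ideal.mul_mem_left _ _ hw
      · rw [hrw]; exact mul_le_of_le_one_left' (vl_alg_le w _)
    · rw [vl_alg_one.2 hw]; exact vl_alg_le w _
  have hJ8 : J(Algebra.norm ℤ c | p + 8) = 1 := by
    have h1 := norm_mod_one (K := K) (c := c) (d := d) (m := p + 8) (by rw [← hd]; ring)
    rw [← Int.cast_one, ZMod.intCast_eq_intCast_iff] at h1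
    rw [jacobiSym.mod_left' h1, jacobiSym.one_left]
  have hchar : CharP (RF v) p := by
    refine (CharP.charP_iff_prime_eq_zero hp).2 ?_
    rw [← map_natCast (Ideal.Quotient.mk v.asIdeal), Ideal.Quotient.eq_zero_iff_mem]
    exact hpi
  let _ : Algebra (ZMod p) (RF v) := ZMod.algebra (RF v) p
  have hN := norm_mod_v v p c (by
    intro x hx
    apply int_dvd (by exact_mod_cast hp0)
    intro w
    rw [map_mul, (vl w).map_mul]
    by_cases hwv : w = v
    · rw [hwv, halg, hpv]
      refine (mul_le_of_le_one_left' (vl_alg_le v _)).trans ?_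
      have := lt_imp_le_mul_exp (vl_alg_lt.2 hx)
      rwa [one_mul] at this
    · by_cases hw : (p : 𝓞 K) ∈ w.asIdeal
      · refine (mul_le_of_le_one_right' (vl_alg_le w _)).trans ((hcw w hwv ?_).trans ?_)
        · rw [hrdef, Nat.cast_mul]; exact Ideal.mul_mem_right _ _ hw
        · rw [hrw]; exact mul_le_of_le_one_right' (vl_alg_le w _)
      · rw [vl_alg_one.2 hw]
        exact mul_le_one' (vl_alg_le w _) (vl_alg_le w _))
  have hns : ¬ IsSquare (Ideal.Quotient.mk v.asIdeal c : RF v) := by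
    intro hsq
    have : cU ∈ Dval (vl v) := mem_D_of_red_sq h2 hcv (by rw [hcU]; rw [show red v (algebraMap (𝓞 K) K c) = _ from red_coe c]; exact hsq)
    exact (hRc (.inl v)).2 rfl (D_le_NL (.inl v) rU this)
  have hJp : J(Algebra.norm ℤ c | p) = -1 := by
    rw [ZMod.nonsquare_iff_jacobiSym_eq_neg_one, hN]
    exact norm_nonsq (odd_card h2) hns
  have hJr : J(Algebra.norm ℤ c | r) = -1 := by
    rw [hrdef, jacobiSym.mul_right' _ hp0 (by omega), hJp, hJ8]; rfl
  have := jac_one r hr8 c hc0 (by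
    intro w hw
    by_cases hwv : w = v
    · rw [hwv, ← vl_alg_one (K := K), ← hcU, hcv]
    · intro hcw'
      have h1 := hcw w hwv hw
      have h3 : vl w (rU : K) < 1 := by
        have := vl_alg_lt (K := K).2 hw
        rwa [halg] at this
      have h4 := vl_alg_lt.1 (h1.trans_lt h3)
      apply w.isPrime.ne_top
      rw [Ideal.eq_top_iff_one, show (1 : 𝓞 K) = c - (c - 1) by ring]
      exact sub_mem hcw' h4) (by
    intro w hw
    have hwv : w ≠ v := by
      rintro rfl
      apply hw
      rw [hrdef, Nat.cast_mul]; exact Ideal.mul_mem_right _ _ hpi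
    by_cases hw2 : (2 : 𝓞 K) ∈ w.asIdeal
    · exact Or.inr (Or.inl hw2)
    have hw2' : vl w 2 = 1 := by
      have := vl_alg_one (K := K).2 hw2
      rwa [map_ofNat] at this
    have hwr : vl w (rU : K) = 1 := by
      have := vl_alg_one (K := K).2 hw
      rwa [halg] at this
    by_cases hD : rU ∈ Dval (vl w)
    · right; right
      have := red_sq_of_D hw2' hwr hD
      rw [← red_coe (r : 𝓞 K)]
      have e : ((r : 𝓞 K) : K) = rU := halg r
      rw [e]; exact this
    · left
      have hNL : cU ∈ NL (.inl w) rU := by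
        by_contra h
        have := (hRc (.inl w)).1 h
        exact hwv (by simpa using this)
      obtain ⟨s, hs⟩ := L7 hw2' hD (EvenV.of_one hwr) hNL
      obtain ⟨m, hm⟩ := vl_exp w s
      refine ⟨m + m, ⟨m, rfl⟩, ?_⟩
      have e : (c : K) = cU := hcU.symm
      rw [e, hs, hm, sq, ← exp_add])
  rw [hJr] at this
  norm_num at this
end
end TAD

namespace TAD
open Subgroup WithZero IsDedekindDomain NumberField
open scoped WithZero

/-! ### Closure properties of diophantine predicates -/

section Dio
variable {K : Type*} [Field K]

/-- Diophantine predicate, with an arbitrary finite type of witnesses. -/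
def Dio {ι : Type} (P : (ι → K) → Prop) : Prop :=
  ∃ (κ : Type) (_ : Finite κ) (f : MvPolynomial (ι ⊕ κ) K),
    ∀ a : ι → K, P a ↔ ∃ x : κ → K, MvPolynomial.eval (Sum.elim a x) f = 0

theorem Dio.isDiophantine {ι : Type} [Fintype ι] {P : (ι → K) → Prop} (h : Dio P) :
    IsDiophantine {a | P a} := by
  obtain ⟨κ, _, f, hf⟩ := h
  have := Fintype.ofFinite κ
  let e := Fintype.equivFin κ
  refine ⟨Fintype.card κ, MvPolynomial.rename (Sum.map id e) f, fun a => ?_⟩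
  have key : ∀ x : Fin (Fintype.card κ) → K,
      (Sum.elim a x) ∘ (Sum.map id e) = Sum.elim a (x ∘ e) := by
    intro x; ext i; rcases i with i | i <;> rfl
  simp only [Set.mem_setOf_eq, hf, MvPolynomial.eval_rename, key]
  constructor
  · rintro ⟨x, hx⟩
    refine ⟨x ∘ e.symm, ?_⟩
    rw [Function.comp_assoc, Equiv.symm_comp_self, Function.comp_id, hx]
  · rintro ⟨x, hx⟩; exact ⟨_, hx⟩

theorem Dio.congr {ι : Type} {P Q : (ι → K) → Prop} (h : Dio P) (hPQ : ∀ a, Q a ↔ P a) :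
    Dio Q := by
  obtain ⟨κ, i, f, hf⟩ := h
  exact ⟨κ, i, f, fun a => (hPQ a).trans (hf a)⟩

/-- polynomial functions -/
def PF {ι : Type} (f : (ι → K) → K) : Prop := ∃ p : MvPolynomial ι K, ∀ a, MvPolynomial.eval a p = f a

theorem PF.var {ι : Type} (i : ι) : PF (fun a : ι → K => a i) := ⟨.X i, by simp⟩
theorem PF.const {ι : Type} (c : K) : PF (fun _ : ι → K => c) := ⟨.C c, by simp⟩
theorem PF.add {ι : Type} {f g : (ι → K) → K} (hf : PF f) (hg : PF g) :
    PF (fun a => f a + g a) := by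
  obtain ⟨p, hp⟩ := hf; obtain ⟨q, hq⟩ := hg
  exact ⟨p + q, by simp [hp, hq]⟩
theorem PF.mul {ι : Type} {f g : (ι → K) → K} (hf : PF f) (hg : PF g) :
    PF (fun a => f a * g a) := by
  obtain ⟨p, hp⟩ := hf; obtain ⟨q, hq⟩ := hg
  exact ⟨p * q, by simp [hp, hq]⟩
theorem PF.neg {ι : Type} {f : (ι → K) → K} (hf : PF f) :
    PF (fun a => - f a) := by
  obtain ⟨p, hp⟩ := hf
  exact ⟨- p, by simp [hp]⟩
theorem PF.sub {ι : Type} {f g : (ι → K) → K} (hf : PF f) (hg : PF g) :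
    PF (fun a => f a - g a) := by
  obtain ⟨p, hp⟩ := hf; obtain ⟨q, hq⟩ := hg
  exact ⟨p - q, by simp [hp, hq]⟩
theorem PF.pow {ι : Type} {f : (ι → K) → K} (hf : PF f) (n : ℕ) :
    PF (fun a => f a ^ n) := by
  obtain ⟨p, hp⟩ := hf
  exact ⟨p ^ n, by simp [hp]⟩

theorem Dio.zero {ι : Type} {f : (ι → K) → K} (hf : PF f) : Dio (fun a => f a = 0) := by
  obtain ⟨p, hp⟩ := hf
  refine ⟨Empty, inferInstance, MvPolynomial.rename Sum.inl p, fun a => ?_⟩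
  simp only [MvPolynomial.eval_rename, Sum.elim_comp_inl, hp, exists_const]

theorem Dio.eq {ι : Type} {f g : (ι → K) → K} (hf : PF f) (hg : PF g) :
    Dio (fun a => f a = g a) := (Dio.zero (hf.sub hg)).congr fun a => sub_eq_zero.symm

theorem Dio.or {ι : Type} {P Q : (ι → K) → Prop} (h : Dio P) (h' : Dio Q) :
    Dio (fun a => P a ∨ Q a) := by
  obtain ⟨κ, _, f, hf⟩ := h
  obtain ⟨κ', _, f', hf'⟩ := h'
  refine ⟨κ ⊕ κ', inferInstance, MvPolynomial.rename (Sum.map id Sum.inl) f *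
    MvPolynomial.rename (Sum.map id Sum.inr) f', fun a => ?_⟩
  simp only [map_mul, MvPolynomial.eval_rename, mul_eq_zero, hf, hf', Sum.elim_comp_map,
    Function.comp_id]
  constructor
  · rintro (⟨x, hx⟩ | ⟨x, hx⟩)
    · exact ⟨Sum.elim x 0, Or.inl (by simpa using hx)⟩
    · exact ⟨Sum.elim 0 x, Or.inr (by simpa using hx)⟩
  · rintro ⟨x, hx | hx⟩
    · exact Or.inl ⟨_, hx⟩
    · exact Or.inr ⟨_, hx⟩

theorem Dio.ex {ι κ : Type} [Finite κ] {P : (ι → K) → (κ → K) → Prop}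
    (h : Dio (fun b : ι ⊕ κ → K => P (fun i => b (.inl i)) (fun j => b (.inr j)))) :
    Dio (fun a => ∃ x, P a x) := by
  obtain ⟨κ', _, f, hf⟩ := h
  refine ⟨κ ⊕ κ', inferInstance, MvPolynomial.rename (Equiv.sumAssoc ι κ κ') f, fun a => ?_⟩
  have key : ∀ (x : κ → K) (y : κ' → K), Sum.elim a (Sum.elim x y) ∘ (Equiv.sumAssoc ι κ κ')
      = Sum.elim (Sum.elim a x) y := by
    intro x y; ext i; rcases i with (i | i) | i <;> rfl
  simp only [MvPolynomial.eval_rename]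
  constructor
  · rintro ⟨x, hx⟩
    obtain ⟨y, hy⟩ := (hf (Sum.elim a x)).1 (by simpa using hx)
    exact ⟨Sum.elim x y, by rw [key, hy]⟩
  · rintro ⟨z, hz⟩
    refine ⟨z ∘ Sum.inl, ?_⟩
    have := (hf (Sum.elim a (z ∘ Sum.inl))).2 ⟨z ∘ Sum.inr, by
      rw [← key, Sum.elim_comp_inl_inr, hz]⟩
    exact this

theorem Dio.subst {ι κ : Type} {P : (κ → K) → Prop} (h : Dio P) {g : κ → (ι → K) → K}
    (hg : ∀ k, PF (g k)) : Dio (fun a => P (fun k => g k a)) := by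
  obtain ⟨κ', i', f, hf⟩ := h
  choose q hq using hg
  refine ⟨κ', i', MvPolynomial.bind₁ (Sum.elim (fun k => MvPolynomial.rename Sum.inl (q k))
    (fun j => MvPolynomial.X (Sum.inr j))) f, fun a => ?_⟩
  refine (hf _).trans (exists_congr fun x => ?_)
  have : MvPolynomial.eval (Sum.elim a x) (MvPolynomial.bind₁ (Sum.elim
      (fun k => MvPolynomial.rename Sum.inl (q k)) (fun j => MvPolynomial.X (Sum.inr j))) f)
      = MvPolynomial.eval (Sum.elim (fun k => g k a) x) f := by
    rw [MvPolynomial.eval, MvPolynomial.eval₂Hom_bind₁]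
    congr 2
    ext i
    rcases i with k | j
    · simp only [Sum.elim_inl]
      have := hq k a
      rw [← this]
      change MvPolynomial.eval _ _ = _
      rw [MvPolynomial.eval_rename, Sum.elim_comp_inl]
    · simp
  rw [this]

theorem Dio.and {d : K} (hd : ∀ s, s ^ 2 ≠ d) {ι : Type} {P Q : (ι → K) → Prop}
    (h : Dio P) (h' : Dio Q) :
    Dio (fun a => P a ∧ Q a) := by
  obtain ⟨κ, _, f, hf⟩ := h
  obtain ⟨κ', _, f', hf'⟩ := h'
  refine ⟨κ ⊕ κ', inferInstance, MvPolynomial.rename (Sum.map id Sum.inl) f ^ 2 - .C d *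
    MvPolynomial.rename (Sum.map id Sum.inr) f' ^ 2, fun a => ?_⟩
  simp only [map_sub, map_pow, map_mul, MvPolynomial.eval_rename, hf, hf', Sum.elim_comp_map,
    Function.comp_id, MvPolynomial.eval_C]
  constructor
  · rintro ⟨⟨x, hx⟩, y, hy⟩
    exact ⟨Sum.elim x y, by simp [hx, hy]⟩
  · rintro ⟨z, hz⟩
    have h0 : MvPolynomial.eval (Sum.elim a (z ∘ Sum.inr)) f' = 0 := by
      by_contra h
      apply hd (MvPolynomial.eval (Sum.elim a (z ∘ Sum.inl)) f /
        MvPolynomial.eval (Sum.elim a (z ∘ Sum.inr)) f')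
      rw [div_pow, div_eq_iff (pow_ne_zero 2 h)]
      exact sub_eq_zero.1 hz
    refine ⟨⟨z ∘ Sum.inl, ?_⟩, _, h0⟩
    rw [h0] at hz
    simpa using hz

theorem Dio.true {ι : Type} : Dio (fun _ : ι → K => True) :=
  (Dio.eq (PF.const 0) (PF.const 0)).congr (by simp)

theorem Dio.false {ι : Type} : Dio (fun _ : ι → K => False) :=
  (Dio.eq (PF.const 0) (PF.const 1)).congr (by simp)

theorem Dio.biUnion {T : Type*} {ι : Type} (s : Finset T) {P : T → (ι → K) → Prop}
    (h : ∀ t ∈ s, Dio (P t)) : Dio (fun a => ∃ t ∈ s, P t a) := by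
  classical
  induction s using Finset.induction_on with
  | empty => exact Dio.false.congr (by simp)
  | insert t s _ ih =>
    refine ((h t (by simp)).or (ih fun t' ht' => h t' (by simp [ht']))).congr fun a => ?_
    simp

theorem Dio.biInter {d : K} (hd : ∀ s, s ^ 2 ≠ d) {T : Type*} {ι : Type} (s : Finset T)
    {P : T → (ι → K) → Prop}
    (h : ∀ t ∈ s, Dio (P t)) : Dio (fun a => ∀ t ∈ s, P t a) := by
  classical
  induction s using Finset.induction_on with
  | empty => exact Dio.true.congr (by simp)
  | insert t s _ ih =>
    refine (Dio.and hd (h t (by simp)) (ih fun t' ht' => h t' (by simp [ht']))).congr fun a => ?_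
    simp

theorem Dio.ne {ι : Type} {f : (ι → K) → K} (hf : PF f) : Dio (fun a => f a ≠ 0) := by
  have : Dio (fun a : Unit → K => a () ≠ 0) := by
    have h : Dio (fun a : Unit → K => ∃ x : Unit → K, a () * x () = 1) :=
      Dio.ex (Dio.eq ((PF.var (Sum.inl ())).mul (PF.var (Sum.inr ()))) (PF.const 1))
    refine h.congr fun a => ⟨fun h => ⟨fun _ => (a ())⁻¹, mul_inv_cancel₀ h⟩, ?_⟩
    rintro ⟨x, hx⟩ h
    simp [h] at hx
  exact this.subst (g := fun _ => f) fun _ => hf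

end Dio

end TAD

namespace TAD
open Subgroup WithZero IsDedekindDomain NumberField
open scoped WithZero

section
variable {K : Type*} [Field K] [NumberField K]

theorem exists_nonsq : ∃ d : K, ∀ s, s ^ 2 ≠ d := by
  obtain ⟨v⟩ : Nonempty (HeightOneSpectrum (𝓞 K)) := by
    obtain ⟨P, hP, h⟩ := Ring.not_isField_iff_exists_prime.1 (RingOfIntegers.not_isField K)
    exact ⟨⟨P, h, hP⟩⟩
  obtain ⟨π, hπ⟩ := exists_unif (K := K) v
  refine ⟨π, fun s hs => ?_⟩
  have hs0 : s ≠ 0 := by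
    rintro rfl
    apply π.ne_zero
    rw [← hs]; simp
  apply not_even_exp v hπ (by decide)
  exact ⟨Units.mk0 s hs0, by rw [← hs]; simp⟩

theorem Dio.and' {ι : Type} {P Q : (ι → K) → Prop} (h : Dio P) (h' : Dio Q) :
    Dio (fun a => P a ∧ Q a) := by
  obtain ⟨d, hd⟩ := exists_nonsq (K := K)
  exact h.and hd h'

theorem Dio.biInter' {T : Type*} {ι : Type} (s : Finset T)
    {P : T → (ι → K) → Prop}
    (h : ∀ t ∈ s, Dio (P t)) : Dio (fun a => ∀ t ∈ s, P t a) := by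
  obtain ⟨d, hd⟩ := exists_nonsq (K := K)
  exact Dio.biInter hd s h

theorem ram_finite (u c : Kˣ) : ∃ S : Finset (Pl K), ∀ v ∉ S, c ∈ NL v u := by
  classical
  obtain ⟨S1, h1⟩ := exists_US u
  obtain ⟨S2, h2⟩ := exists_US c
  obtain ⟨S3, h3⟩ := exists_US (Units.mk0 (2 : K) two_ne_zero)
  refine ⟨SI (S1 ∪ S2 ∪ S3), fun v hv => ?_⟩
  rcases v with p | w
  · have hp : p ∉ S1 ∪ S2 ∪ S3 := fun h => hv (inl_mem_SI.2 h)
    simp only [Finset.mem_union, not_or] at hp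
    have e1 := (mem_US.1 h1) p hp.1.1
    have e2 := (mem_US.1 h2) p hp.1.2
    have e3 := (mem_US.1 h3) p hp.2
    exact L8' (by simpa using e3) (EvenV.of_one e1) e2
  · exact absurd inr_mem_SI hv

/-- `K`-valued version of `D`. -/
def DK (v : Pl K) (x : K) : Prop := ∃ g : Kˣ, (g : K) = x ∧ g ∈ D v

theorem DK_coe {v : Pl K} {g : Kˣ} : DK v (g : K) ↔ g ∈ D v :=
  ⟨fun ⟨h, e, hh⟩ => by rwa [← Units.ext e], fun h => ⟨g, rfl, h⟩⟩

/-- `K`-valued version of `Pg`. -/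
def PK (u c g : K) : Prop := ∃ x y z : K, g = u * x ^ 2 + c * (y ^ 2 - u * z ^ 2)

theorem Dio.pk {ι : Type} {u c g : (ι → K) → K} (hu : PF u) (hc : PF c) (hg : PF g) :
    Dio (fun a => PK (u a) (c a) (g a)) := by
  have h : Dio (fun a : Fin 3 → K => ∃ x : Fin 3 → K,
      a 2 = a 0 * x 0 ^ 2 + a 1 * (x 1 ^ 2 - a 0 * x 2 ^ 2)) :=
    Dio.ex (P := fun a x => a 2 = a 0 * x 0 ^ 2 + a 1 * (x 1 ^ 2 - a 0 * x 2 ^ 2))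
      (Dio.eq (PF.var _) (((PF.var _).mul ((PF.var _).pow 2)).add ((PF.var _).mul
        (((PF.var _).pow 2).sub ((PF.var _).mul ((PF.var _).pow 2))))))
  refine (h.subst (g := ![u, c, g]) fun k => ?_).congr fun a => ?_
  · fin_cases k
    exacts [hu, hc, hg]
  · constructor
    · rintro ⟨x, y, z, h⟩
      exact ⟨![x, y, z], by simpa using h⟩
    · rintro ⟨x, h⟩
      exact ⟨x 0, x 1, x 2, by simpa using h⟩

theorem Dio.fixedD (v : Pl K) {ι : Type} {f : (ι → K) → K} (hf : PF f) :
    Dio (fun a => DK v (f a)) := by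
  classical
  by_cases htop : D v = ⊤
  · refine (Dio.ne hf).congr fun a => ⟨?_, fun h => ⟨Units.mk0 _ h, rfl, by rw [htop]; trivial⟩⟩
    rintro ⟨g, hg, -⟩
    rw [← hg]; exact g.ne_zero
  obtain ⟨u, hu⟩ : ∃ u, u ∉ D v := by
    by_contra! h
    exact htop (eq_top_iff.2 fun x _ => h x)
  obtain ⟨c, hc⟩ := NL_ne_top hu
  obtain ⟨T, hT⟩ := ram_finite u c
  let M : Subgroup Kˣ := ⨅ w : T, D (w : Pl K)
  have hM : M.FiniteIndex := by
    have : ∀ w : T, (D (w : Pl K)).FiniteIndex := fun w => ⟨D_index _⟩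
    exact Subgroup.finiteIndex_iInf this
  have : Fintype (Kˣ ⧸ M) := Fintype.ofFinite _
  have hMw : ∀ w ∈ T, M ≤ D w := fun w hw => iInf_le (fun w : T => D (w : Pl K)) ⟨w, hw⟩
  have hvT : v ∈ T := by
    by_contra h; exact hc (hT v h)
  let valid : Finset (Finset (Kˣ ⧸ M)) :=
    Finset.univ.filter fun G => ∀ i : Kˣ, i ∉ D v → ∃ q ∈ G, i / q.out ∈ D v
  have hd : Dio (fun a => f a ≠ 0 ∧ ∃ G ∈ valid, ∀ q ∈ G, PK (u : K) c (f a * (q.out : Kˣ))) :=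
    (Dio.ne hf).and' (Dio.biUnion valid fun G _ => Dio.biInter' G fun q _ =>
      Dio.pk (PF.const _) (PF.const _) (hf.mul (PF.const _)))
  refine hd.congr fun a => ⟨?_, ?_⟩
  · rintro ⟨x, hx, hxD⟩
    rw [← hx]
    refine ⟨x.ne_zero, Finset.univ.filter (fun q => PK (u : K) c (x * (q.out : Kˣ))), ?_, ?_⟩
    · simp only [valid, Finset.mem_filter, Finset.mem_univ, true_and]
      intro i hi
      obtain ⟨g, hg⟩ := approx T (fun w => if w = v then i else x⁻¹ * u)
      obtain ⟨⟨m, hm⟩, hq⟩ := QuotientGroup.mk_out_eq_mul M g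
      simp only at hq
      refine ⟨(g : Kˣ ⧸ M), ?_, ?_⟩
      · rw [hq]
        have : Pg u c (x * (g * m)) := by
          apply thmP
          intro w hw hD
          have hwT : w ∈ T := by
            by_contra h; exact hw (hT w h)
          have h1 := hg w hwT
          have h2 := hMw w hwT hm
          by_cases hwv : w = v
          · subst hwv
            simp only [if_true] at h1
            apply hi
            have := mul_mem (mul_mem hD (inv_mem (mul_mem hxD h2))) (inv_mem h1)
            convert this using 1
            simp only [div_eq_mul_inv, mul_inv_rev, inv_inv]
            rw [show x * (g * m) * (m⁻¹ * x⁻¹) * (i * g⁻¹) = (x * x⁻¹) * (g * g⁻¹) * (m * m⁻¹) * i by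
              simp only [mul_comm, mul_left_comm, mul_assoc]]
            simp
          · simp only [if_neg hwv] at h1
            apply hw
            rw [NL_top (a := u)]
            · trivial
            have := mul_mem (mul_mem hD (inv_mem h2)) (inv_mem h1)
            convert this using 1
            simp only [div_eq_mul_inv, mul_inv_rev, inv_inv]
            rw [show x * (g * m) * m⁻¹ * (x⁻¹ * u * g⁻¹) = (x * x⁻¹) * (g * g⁻¹) * (m * m⁻¹) * u by
              simp only [mul_comm, mul_left_comm, mul_assoc]]
            simp
        obtain ⟨X, Y, Z, h⟩ := this
        exact ⟨X, Y, Z, by rw [← h]; simp⟩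
      · rw [hq]
        have h1 := hg v hvT
        simp only [if_true] at h1
        have := inv_mem (mul_mem h1 (hMw v hvT hm))
        convert this using 1
        simp only [div_eq_mul_inv, mul_inv_rev, inv_inv]
        simp only [mul_comm, mul_left_comm, mul_assoc]
    · intro q hq
      exact (Finset.mem_filter.1 hq).2
  · rintro ⟨h0, G, hG, h⟩
    refine ⟨Units.mk0 _ h0, rfl, ?_⟩
    by_contra hx
    obtain ⟨q, hq, hqD⟩ := (Finset.mem_filter.1 hG).2 (Units.mk0 _ h0)⁻¹ (fun h => hx (by simpa using inv_mem h))
    obtain ⟨X, Y, Z, hh⟩ := h q hq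
    have : Pg u c (Units.mk0 _ h0 * q.out) := ⟨X, Y, Z, by rw [← hh]; simp⟩
    apply hc
    refine Pg_conv this ?_
    have := inv_mem hqD
    convert this using 1
    simp [div_eq_mul_inv, mul_comm]

/-- split at `v`, `K`-valued -/
def SpK (v : Pl K) (x y : K) : Prop := ∃ a b : Kˣ, (a : K) = x ∧ (b : K) = y ∧ b ∈ NL v a
/-- nonsplit at `v`, `K`-valued -/
def NsK (v : Pl K) (x y : K) : Prop := ∃ a b : Kˣ, (a : K) = x ∧ (b : K) = y ∧ b ∉ NL v a

theorem Dio.classes (v : Pl K) (R : Kˣ → Kˣ → Prop)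
    (hR : ∀ a b a' b', a / a' ∈ D v → b / b' ∈ D v → R a' b' → R a b) {ι : Type} {f g : (ι → K) → K}
    (hf : PF f) (hg : PF g) :
    Dio (fun t => ∃ a b : Kˣ, (a : K) = f t ∧ (b : K) = g t ∧ R a b) := by
  classical
  have : (D v).FiniteIndex := ⟨D_index _⟩
  have : Fintype (Kˣ ⧸ D v) := Fintype.ofFinite _
  let s : Finset ((Kˣ ⧸ D v) × (Kˣ ⧸ D v)) := Finset.univ.filter fun q => R q.1.out q.2.out
  have hd : Dio (fun t => ∃ q ∈ s, DK v (f t * ((q.1.out⁻¹ : Kˣ) : K)) ∧ DK v (g t * ((q.2.out⁻¹ : Kˣ) : K))) :=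
    Dio.biUnion s fun q _ => (Dio.fixedD v (hf.mul (PF.const _))).and'
      (Dio.fixedD v (hg.mul (PF.const _)))
  have hout : ∀ a : Kˣ, a / (a : Kˣ ⧸ D v).out ∈ D v := by
    intro a
    obtain ⟨⟨m, hm⟩, hq⟩ := QuotientGroup.mk_out_eq_mul (D v) a
    rw [hq]
    simpa using hm
  have hout' : ∀ a : Kˣ, (a : Kˣ ⧸ D v).out / a ∈ D v := by
    intro a
    obtain ⟨⟨m, hm⟩, hq⟩ := QuotientGroup.mk_out_eq_mul (D v) a
    rw [hq]
    simpa using hm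
  refine hd.congr fun t => ⟨?_, ?_⟩
  · rintro ⟨a, b, ha, hb, h⟩
    refine ⟨((a : Kˣ ⧸ D v), (b : Kˣ ⧸ D v)), ?_, ?_, ?_⟩
    · exact Finset.mem_filter.2 ⟨Finset.mem_univ _, hR _ _ _ _ (hout' a) (hout' b) h⟩
    · exact ⟨a / (a : Kˣ ⧸ D v).out, by rw [← ha, div_eq_mul_inv, Units.val_mul], hout a⟩
    · exact ⟨b / (b : Kˣ ⧸ D v).out, by rw [← hb, div_eq_mul_inv, Units.val_mul], hout b⟩
  · rintro ⟨⟨q, r⟩, hq, ⟨a, ha, haD⟩, b, hb, hbD⟩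
    refine ⟨a * q.out, b * r.out, ?_, ?_, hR _ _ q.out r.out (by simpa using haD) (by simpa using hbD)
      (Finset.mem_filter.1 hq).2⟩
    · rw [Units.val_mul, ha, mul_assoc, ← Units.val_mul]; simp
    · rw [Units.val_mul, hb, mul_assoc, ← Units.val_mul]; simp

theorem NL_classes {v : Pl K} {a b a' b' : Kˣ} (ha : a / a' ∈ D v) (hb : b / b' ∈ D v) :
    b ∈ NL v a ↔ b' ∈ NL v a' := by
  rw [NL_congr ha]
  have h := D_le_NL v a' hb
  constructor
  · intro h'
    have := mul_mem (inv_mem h) h'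
    simpa using this
  · intro h'
    have := mul_mem h h'
    simpa using this

theorem Dio.Sp (v : Pl K) {ι : Type} {f g : (ι → K) → K} (hf : PF f) (hg : PF g) :
    Dio (fun t => SpK v (f t) (g t)) :=
  Dio.classes v (fun a b => b ∈ NL v a) (fun _ _ _ _ h h' => (NL_classes h h').2) hf hg

theorem Dio.Ns (v : Pl K) {ι : Type} {f g : (ι → K) → K} (hf : PF f) (hg : PF g) :
    Dio (fun t => NsK v (f t) (g t)) :=
  Dio.classes v (fun a b => b ∉ NL v a) (fun _ _ _ _ h h' => fun h1 h2 => h1 ((NL_classes h h').1 h2)) hf hg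

end
end TAD

namespace TAD
open Subgroup WithZero IsDedekindDomain NumberField
open scoped WithZero

section
variable {K : Type*} [Field K] [NumberField K]

/-- Good places: odd and unramified over the rationals. -/
def Gd (v : HeightOneSpectrum (𝓞 K)) : Prop :=
  vl v (2 : K) = 1 ∧ ∃ p : ℕ, p.Prime ∧ vl v ((p : ℕ) : K) = exp (-1 : ℤ)

theorem Gd.noR {v : HeightOneSpectrum (𝓞 K)} (h : Gd v) (u : Kˣ) : ¬ ∃ c, Rz u c {.inl v} := by
  obtain ⟨h2, p, hp, hpv⟩ := h
  rintro ⟨c, hc⟩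
  exact R0 v p hp hpv h2 u c hc

theorem exists_prime_mem (v : HeightOneSpectrum (𝓞 K)) : ∃ p : ℕ, p.Prime ∧ ((p : ℕ) : 𝓞 K) ∈ v.asIdeal := by
  obtain ⟨p, hp⟩ := CharP.exists (RF v)
  refine ⟨p, (CharP.char_is_prime (RF v) p), ?_⟩
  rw [← Ideal.Quotient.eq_zero_iff_mem, map_natCast]
  exact CharP.cast_eq_zero (RF v) p

theorem bad_finite : ∃ B : Finset (HeightOneSpectrum (𝓞 K)), ∀ v ∉ B, Gd v := by
  classical
  obtain ⟨S, hS⟩ := exists_US (Units.mk0 (2 : K) two_ne_zero)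
  have hd : differentIdeal ℤ (𝓞 K) ≠ ⊥ := differentIdeal_ne_bot
  have hfin := Ideal.finite_factors (I := differentIdeal ℤ (𝓞 K)) hd
  refine ⟨S ∪ hfin.toFinset, fun v hv => ?_⟩
  simp only [Finset.mem_union, not_or, Set.Finite.mem_toFinset] at hv
  refine ⟨by simpa using (mem_US.1 hS) v hv.1, ?_⟩
  obtain ⟨p, hp, hpv⟩ := exists_prime_mem v
  refine ⟨p, hp, ?_⟩
  have hp0 : ((p : ℕ) : K) ≠ 0 := by exact_mod_cast hp.ne_zero
  obtain ⟨m, hm⟩ := vl_exp v (Units.mk0 ((p : ℕ) : K) hp0)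
  rw [Units.val_mk0] at hm
  have h1 : ((p : ℕ) : 𝓞 K) ∈ v.asIdeal ^ 1 := by simpa using hpv
  rw [mem_pow_iff] at h1
  have h2 : ((p : ℕ) : 𝓞 K) ∉ v.asIdeal ^ 2 := by
    intro h
    apply hv.2
    have : (Ideal.span {(p : ℤ)}).IsMaximal :=
      PrincipalIdealRing.isMaximal_of_irreducible (Nat.prime_iff_prime_int.1 hp).irreducible
    have := pow_sub_one_dvd_differentIdeal ℤ (p := Ideal.span {(p : ℤ)}) v.asIdeal 2
      (by simpa using hp.ne_zero) (by
        rw [Ideal.map_span, Set.image_singleton, Ideal.dvd_span_singleton]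
        simpa using h)
    simpa using this
  rw [mem_pow_iff] at h2
  have e : ((((p : ℕ) : 𝓞 K)) : K) = ((p : ℕ) : K) := by simp
  rw [e, hm] at h1 h2
  rw [hm]
  rw [exp_le_exp] at h1 h2
  congr 1
  push_cast at h1 h2
  omega

theorem D_even {v : HeightOneSpectrum (𝓞 K)} {x : Kˣ} (h : x ∈ D (.inl v : Pl K)) : EvenV v x :=
  Dval_even (v := vl v) h

theorem EvenV.of_mul_sq {v : HeightOneSpectrum (𝓞 K)} {x y : Kˣ} (h : EvenV v x) (hy : EvenV v (x * y)) :
    EvenV v y := by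
  simpa using EvenV.mul v (EvenV.inv v h) hy

theorem odd_mul {v : HeightOneSpectrum (𝓞 K)} {x y : Kˣ} (hx : ¬ EvenV v x) (hy : ¬ EvenV v y) :
    EvenV v (x * y) := by
  rcases even_or v x with h | ⟨k, hk, hk'⟩
  · exact absurd h hx
  rcases even_or v y with h | ⟨l, hl, hl'⟩
  · exact absurd h hy
  rcases even_or v (x * y) with h | ⟨n, hn, hn'⟩
  · exact h
  rw [Units.val_mul, map_mul, hk', hl', ← exp_add, exp_inj] at hn'
  exfalso
  have := hk.add_odd hl
  rw [hn'] at this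
  exact (Int.not_even_iff_odd.2 hn) this

theorem even_even {v : HeightOneSpectrum (𝓞 K)} (h2 : vl v (2 : K) = 1) {x y : Kˣ} (hx : EvenV v x)
    (hy : EvenV v y) (hxD : x ∉ D (.inl v : Pl K)) (hyD : y ∉ D (.inl v : Pl K)) :
    x * y ∈ D (.inl v : Pl K) := by
  obtain ⟨s, hs⟩ := hx.scale
  obtain ⟨t, ht⟩ := hy.scale
  have := odd_units h2 hs ht
    (fun h => hxD ((mul_mem_cancel_right (sq_mem_Dval s)).1 h))
    (fun h => hyD ((mul_mem_cancel_right (sq_mem_Dval t)).1 h))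
  rw [mul_mul_mul_comm] at this
  exact (mul_mem_cancel_right (mul_mem (sq_mem_Dval s) (sq_mem_Dval t))).1 this

theorem klein_core {v : HeightOneSpectrum (𝓞 K)} (h2 : vl v (2 : K) = 1) {g h f : Kˣ} (hg : ¬ EvenV v g)
    (hh : ¬ EvenV v h) (hgh : g * h ∉ D (.inl v : Pl K)) (hf : f ∉ D (.inl v : Pl K)) :
    f * g ∈ D (.inl v : Pl K) ∨ f * h ∈ D (.inl v : Pl K) ∨ f * (g * h) ∈ D (.inl v : Pl K) := by
  by_cases hfe : EvenV v f
  · exact Or.inr (Or.inr (even_even h2 hfe (odd_mul hg hh) hf hgh))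
  · by_cases hfg : f * g ∈ D (.inl v : Pl K)
    · exact Or.inl hfg
    · refine Or.inr (Or.inl ?_)
      have := even_even h2 (odd_mul hfe hg) (odd_mul hg hh) hfg hgh
      rw [show f * g * (g * h) = f * h * g ^ 2 by rw [sq]; simp only [mul_comm, mul_left_comm]] at this
      exact (mul_mem_cancel_right (sq_mem_D (.inl v) g)).1 this

theorem klein {v : HeightOneSpectrum (𝓞 K)} (h2 : vl v (2 : K) = 1) {g h f : Kˣ}
    (hg : g ∉ D (.inl v : Pl K)) (hh : h ∉ D (.inl v : Pl K))
    (hgh : g * h ∉ D (.inl v : Pl K)) (hf : f ∉ D (.inl v : Pl K)) :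
    f * g ∈ D (.inl v : Pl K) ∨ f * h ∈ D (.inl v : Pl K) ∨ f * (g * h) ∈ D (.inl v : Pl K) := by
  by_cases eg : EvenV v g
  · by_cases eh : EvenV v h
    · exact absurd (even_even h2 eg eh hg hh) hgh
    · have e1 : ¬ EvenV v (g * h) := fun hh' => eh (eg.of_mul_sq hh')
      have e2 : h * (g * h) = g * h ^ 2 := by rw [sq]; simp only [mul_comm, mul_left_comm]
      have := klein_core h2 eh e1 (by rw [e2]; exact fun h' => hg ((mul_mem_cancel_right (sq_mem_D (.inl v) h)).1 h')) hf
      rw [e2, ← mul_assoc f g (h ^ 2), mul_mem_cancel_right (sq_mem_D (.inl v) h)] at this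
      tauto
  · by_cases eh : EvenV v h
    · have e1 : ¬ EvenV v (g * h) := fun hh' => eg (eh.of_mul_sq (by rwa [mul_comm]))
      have e2 : g * (g * h) = h * g ^ 2 := by rw [sq]; simp only [mul_comm, mul_left_comm]
      have := klein_core h2 eg e1 (by rw [e2]; exact fun h' => hh ((mul_mem_cancel_right (sq_mem_D (.inl v) g)).1 h')) hf
      rw [e2, ← mul_assoc f h (g ^ 2), mul_mem_cancel_right (sq_mem_D (.inl v) g)] at this
      tauto
    · exact klein_core h2 eg eh hgh hf

theorem klein_exists (v : HeightOneSpectrum (𝓞 K)) : ∃ g h : Kˣ, g ∉ D (.inl v : Pl K) ∧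
    h ∉ D (.inl v : Pl K) ∧ g * h ∉ D (.inl v : Pl K) := by
  obtain ⟨π, hπ⟩ := exists_unif (K := K) v
  have hπe := unif_not_even hπ
  have hπD : π ∉ D (.inl v : Pl K) := fun h => hπe (D_even h)
  obtain ⟨b, hb⟩ := NL_ne_top hπD
  have key : ∃ b, b ∉ NL (.inl v) π ∧ EvenV v b := by
    by_cases hbe : EvenV v b
    · exact ⟨b, hb, hbe⟩
    · refine ⟨-π * b, fun h => hb ((mul_mem_cancel_left (neg_mem_NL _ π)).1 h), odd_mul (fun h => hπe ?_) hbe⟩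
      obtain ⟨s, hs⟩ := h
      exact ⟨s, by simpa using hs⟩
  obtain ⟨b, hb, hbe⟩ := key
  refine ⟨π, b, hπD, fun h => hb (D_le_NL _ _ h), fun h => hπe ?_⟩
  exact hbe.of_mul_sq (by rw [mul_comm]; exact D_even h)

theorem klein_avoid (v : HeightOneSpectrum (𝓞 K)) (A : Kˣ) : ∃ a : Kˣ, a ∉ D (.inl v : Pl K) ∧
    a / A ∉ D (.inl v : Pl K) := by
  obtain ⟨g, h, hg, hh, hgh⟩ := klein_exists (K := K) v
  by_cases h1 : g / A ∈ D (.inl v : Pl K)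
  · refine ⟨h, hh, fun h2 => hgh ?_⟩
    have := mul_mem (div_mem h1 h2) (sq_mem_D (.inl v) h)
    rwa [div_div_div_cancel_right, sq, ← mul_assoc, div_mul_cancel] at this
  · exact ⟨g, hg, h1⟩

theorem exists_good (B : Finset (HeightOneSpectrum (𝓞 K))) : ∃ v ∉ B, Gd v := by
  classical
  obtain ⟨B', hB'⟩ := bad_finite (K := K)
  obtain ⟨v, hv⟩ : ∃ v, v ∉ B ∪ B' := by
    have : ∃ a : Kˣ, a ∉ Sq K := by
      obtain ⟨d, hd⟩ := exists_nonsq (K := K)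
      have h0 : d ≠ 0 := fun h => hd 0 (by simp [h])
      refine ⟨Units.mk0 d h0, fun h => ?_⟩
      obtain ⟨s, hs⟩ := mem_Sq.1 h
      exact hd s (by have := congrArg Units.val hs; simpa using this.symm)
    obtain ⟨a, ha⟩ := this
    obtain ⟨v, hv, -⟩ := lemmaF ha (B ∪ B')
    exact ⟨v, hv⟩
  simp only [Finset.mem_union, not_or] at hv
  exact ⟨v, hv.1, hB' v hv.2⟩

end
end TAD

namespace TAD
open Subgroup WithZero IsDedekindDomain NumberField
open scoped WithZero

section
variable {K : Type*} [Field K] [NumberField K]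

/-- The auxiliary data fixed once and for all. -/
structure Aux (K : Type*) [Field K] [NumberField K] where
  FB : Finset (Pl K)
  v0 : HeightOneSpectrum (𝓞 K)
  v1 : HeightOneSpectrum (𝓞 K)
  u : Kˣ
  c : Kˣ
  hne : v0 ≠ v1
  g0 : Gd v0
  hv0 : (.inl v0 : Pl K) ∈ FB
  hv1 : (.inl v1 : Pl K) ∈ FB
  hFB : ∀ v ∉ FB, ∃ l : HeightOneSpectrum (𝓞 K), v = .inl l ∧ Gd l
  hR : Rz u c {.inl v0, .inl v1}

theorem exists_Aux : Nonempty (Aux K) := by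
  classical
  obtain ⟨B, hB⟩ := bad_finite (K := K)
  obtain ⟨v0, -, g0⟩ := exists_good (K := K) ∅
  obtain ⟨v1, h1, g1⟩ := exists_good (K := K) {v0}
  have hne : v0 ≠ v1 := fun h => h1 (by simp [h])
  have hne' : (.inl v0 : Pl K) ≠ .inl v1 := fun h => hne (Sum.inl_injective h)
  obtain ⟨a0, -, h0, -, -⟩ := klein_exists (K := K) v0
  obtain ⟨a1, -, h1, -, -⟩ := klein_exists (K := K) v1
  obtain ⟨u, hu⟩ := approx {.inl v0, .inl v1} (fun v => if v = .inl v0 then a0 else a1)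
  have hu0 := hu (.inl v0) (by simp)
  have hu1 := hu (.inl v1) (by simp)
  rw [if_pos rfl] at hu0
  rw [if_neg hne'.symm] at hu1
  have hu0' : u ∉ D (.inl v0 : Pl K) := fun h => h0 (by simpa using div_mem h hu0)
  have hu1' : u ∉ D (.inl v1 : Pl K) := fun h => h1 (by simpa using div_mem h hu1)
  obtain ⟨c, hc⟩ := lemmaE hu0' hu1' hne' (g0.noR u) (g1.noR u)
  refine ⟨⟨SI (B ∪ {v0, v1}), v0, v1, u, c, hne, g0, inl_mem_SI.2 (by simp), inl_mem_SI.2 (by simp), ?_, hc⟩⟩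
  intro v hv
  rcases v with l | w
  · refine ⟨l, rfl, hB l fun h => hv (inl_mem_SI.2 (by simp [h]))⟩
  · exact absurd inr_mem_SI hv

/-- The main existential certificate. -/
def Aux.Cert (X : Aux K) (A B : Kˣ) : Prop :=
  ∃ a n n0 c e1 e2 : Kˣ, ∃ x x0 : K, n ∈ Nm A ∧ (a : K) = A * x ^ 2 + B * n ∧
    n0 ∈ Nm X.u ∧ (a : K) = X.u * x0 ^ 2 + X.c * n0 ∧
    c ∉ NL (.inl X.v0) a ∧ (∀ v ∈ X.FB, v ≠ .inl X.v0 → c ∈ NL v a) ∧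
    (∀ e ∈ [e1, e2, e1 * e2, (-(A * B * n)) * c * e1, (-(A * B * n)) * c * e2,
      (-(A * B * n)) * c * (e1 * e2)], Pg a (c * (-(X.u * X.c * n0))) e)

theorem Aux.sound (X : Aux K) {A B : Kˣ} (h : X.Cert A B) : B ∉ Nm A := by
  intro hB
  obtain ⟨a, n, n0, c, e1, e2, x, x0, hn, ha, hn0, ha0, hc0, hcF, hP⟩ := h
  have hb : ∀ v, hil v a (-(A * B * n)) = 1 := fun v => by
    rw [← presentation hn ha v]; exact hil_Nm v hB
  obtain ⟨f, hf⟩ : ∃ f, f = (-(A * B * n)) * c := ⟨_, rfl⟩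
  rw [← hf] at hP
  obtain ⟨w, hw, hwv⟩ : ∃ w, c ∉ NL w a ∧ w ≠ .inl X.v0 := by
    by_contra! hcon
    refine X.g0.noR a ⟨c, fun v => ⟨fun h => hcon v h, ?_⟩⟩
    rintro rfl
    exact hc0
  have hwF : w ∉ X.FB := fun h => hw (hcF w h hwv)
  obtain ⟨l, rfl, gl⟩ := X.hFB w hwF
  have hu : hil (.inl l) X.u X.c = 1 := by
    rw [hil_one_iff]
    by_contra h
    rcases (X.hR _).1 h with h | h
    · exact hwv h
    · exact hwF (by rw [show (Sum.inl l : Pl K) = .inl X.v1 from h]; exact X.hv1)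
  have hy : hil (.inl l) a (-(X.u * X.c * n0)) = 1 := by rw [← presentation hn0 ha0]; exact hu
  have hns : c * (-(X.u * X.c * n0)) ∉ NL (.inl l) a := by
    rw [← hil_ne_iff, hil_mul_right, hy, mul_one, hil_ne_iff]; exact hw
  have hfD : f ∉ D (.inl l : Pl K) := by
    intro h
    have := hil_D_right h a
    rw [hf, hil_mul_right, hb, one_mul, hil_one_iff] at this
    exact hw this
  have hnD : ∀ e, Pg a (c * (-(X.u * X.c * n0))) e → e ∉ D (.inl l : Pl K) := fun e he h =>
    hns (Pg_conv he h)
  rcases klein gl.1 (hnD _ (hP e1 (by simp))) (hnD _ (hP e2 (by simp))) (hnD _ (hP (e1 * e2) (by simp))) hfD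
    with h | h | h
  · exact hnD _ (hP (f * e1) (by simp)) h
  · exact hnD _ (hP (f * e2) (by simp)) h
  · exact hnD _ (hP (f * (e1 * e2)) (by simp)) h

/-- From membership in `Pg` extract an honest presentation. -/
theorem Pg_unit {u c g : Kˣ} (h : Pg u c g) {v : Pl K} (hv : g / u ∉ D v) :
    ∃ (n : Kˣ) (x : K), n ∈ Nm u ∧ (g : K) = u * x ^ 2 + c * n := by
  obtain ⟨x, y, z, h⟩ := h
  by_cases hn : y ^ 2 - u * z ^ 2 = 0
  · exfalso
    rw [hn, mul_zero, add_zero] at h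
    have hx : x ≠ 0 := by rintro rfl; simp at h
    apply hv
    have : g / u = (Units.mk0 x hx) ^ 2 := by
      rw [div_eq_iff_eq_mul]
      ext
      rw [h]; push_cast [Units.val_mk0]; ring
    rw [this]
    exact sq_mem_D v _
  · exact ⟨Units.mk0 _ hn, x, ⟨y, z, rfl⟩, h⟩

theorem Aux.complete (X : Aux K) {A B : Kˣ} (h : B ∉ Nm A) :
    (∃ v ∈ X.FB, B ∉ NL v A) ∨ X.Cert A B := by
  classical
  by_cases hF : ∃ v ∈ X.FB, B ∉ NL v A
  · exact Or.inl hF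
  push Not at hF
  right
  obtain ⟨w, hw⟩ : ∃ w : Pl K, B ∉ NL w A := by
    by_contra! hcon
    exact h (HM3 hcon)
  have hwF : w ∉ X.FB := fun hh => hw (hF w hh)
  obtain ⟨l, rfl, gl⟩ := X.hFB w hwF
  have hl0 : (.inl l : Pl K) ≠ .inl X.v0 := fun e => hwF (e ▸ X.hv0)
  have hl1 : (.inl l : Pl K) ≠ .inl X.v1 := fun e => hwF (e ▸ X.hv1)
  have h01 : (.inl X.v1 : Pl K) ≠ .inl X.v0 := fun e => X.hne (Sum.inl_injective e).symm
  obtain ⟨T, hT⟩ := ram_finite A B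
  -- choice of `a`
  obtain ⟨al, hal, hal'⟩ := klein_avoid l A
  obtain ⟨a0, ha0, ha0'⟩ := klein_avoid X.v0 X.u
  obtain ⟨a1, ha1, -⟩ := klein_avoid X.v1 X.u
  obtain ⟨a, ha⟩ := approx (T ∪ {.inl l, .inl X.v0, .inl X.v1}) (fun v => if v = .inl l then al else
    if v = .inl X.v0 then a0 else if v = .inl X.v1 then a1 else A)
  have hL := ha (.inl l) (by simp)
  have hV0 := ha (.inl X.v0) (by simp)
  have hV1 := ha (.inl X.v1) (by simp)
  simp only [if_true] at hL
  simp only [if_neg hl0.symm, if_true] at hV0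
  simp only [if_neg hl1.symm, if_neg h01, if_true] at hV1
  have haL : a ∉ D (.inl l : Pl K) := fun h => hal (by simpa using div_mem h hL)
  have haV0 : a ∉ D (.inl X.v0 : Pl K) := fun h => ha0 (by simpa using div_mem h hV0)
  have haV1 : a ∉ D (.inl X.v1 : Pl K) := fun h => ha1 (by simpa using div_mem h hV1)
  have haL' : a / A ∉ D (.inl l : Pl K) := fun h => hal' (by
    have := div_mem h hL
    rwa [div_div_div_cancel_left] at this)
  have haV0' : a / X.u ∉ D (.inl X.v0 : Pl K) := fun h => ha0' (by
    have := div_mem h hV0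
    rwa [div_div_div_cancel_left] at this)
  have hPA : Pg A B a := by
    apply thmP
    intro v hv
    by_cases e1 : v = .inl l
    · rw [e1]; exact haL
    by_cases e2 : v = .inl X.v0
    · rw [e2]; exact haV0
    by_cases e3 : v = .inl X.v1
    · rw [e3]; exact haV1
    have hvT : v ∈ T := by
      by_contra hh; exact hv (hT v hh)
    have := ha v (by simp [hvT])
    simp only [if_neg e1, if_neg e2, if_neg e3] at this
    intro h
    apply hv
    rw [NL_top (a := A)]
    · trivial
    · simpa using div_mem h this
  have hPu : Pg X.u X.c a := by
    apply thmP
    intro v hv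
    rcases (X.hR v).1 hv with h | h
    · rw [h]; exact haV0
    · rw [show v = .inl X.v1 from h]; exact haV1
  obtain ⟨n, x, hn, hx⟩ := Pg_unit hPA haL'
  obtain ⟨n0, x0, hn0, hx0⟩ := Pg_unit hPu haV0'
  obtain ⟨c1, hc1⟩ := lemmaE haV0 haL hl0.symm (X.g0.noR a) (gl.noR a)
  have hbl : hil (.inl l) a (-(A * B * n)) = -1 := by
    rw [← presentation hn hx, hil_ne_iff]; exact hw
  have hb1 : hil (.inl X.v1) a (-(A * B * n)) = 1 := by
    rw [← presentation hn hx, hil_one_iff]; exact hF _ X.hv1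
  obtain ⟨b, hbdef⟩ : ∃ b, b = -(A * B * n) := ⟨_, rfl⟩
  rw [← hbdef] at hbl hb1
  have hcl : hil (.inl l) a c1 = -1 := by rw [hil_ne_iff, hc1]; simp
  have hcv1 : hil (.inl X.v1) a c1 = 1 := by
    rw [hil_one_iff]
    by_contra hh
    rcases (hc1 _).1 hh with h | h
    · exact h01 h
    · exact hl1 h.symm
  -- adjust `c`
  obtain ⟨z, hz, hzD⟩ := approx_Nm' {.inl l, .inl X.v1} a (fun _ => (b * c1)⁻¹) (by
    intro v hv
    simp only [Finset.mem_insert, Finset.mem_singleton] at hv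
    apply inv_mem
    rw [← hil_one_iff, hil_mul_right]
    rcases hv with rfl | rfl
    · rw [hbl, hcl]; decide
    · rw [hb1, hcv1]; decide)
  have hil_c : ∀ v, hil v a (c1 * z) = hil v a c1 := fun v => by
    rw [hil_mul_right, hil_Nm v hz, mul_one]
  have hmem_c : ∀ v, c1 * z ∈ NL v a ↔ c1 ∈ NL v a := fun v => by
    rw [← hil_one_iff, hil_c, hil_one_iff]
  have hfD : ∀ v ∈ ({.inl l, .inl X.v1} : Finset (Pl K)), b * (c1 * z) ∈ D v := by
    intro v hv
    have := hzD v hv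
    rw [div_inv_eq_mul] at this
    convert this using 1
    simp only [mul_comm, mul_left_comm]
  obtain ⟨f, hf⟩ : ∃ f, f = b * (c1 * z) := ⟨_, rfl⟩
  rw [← hf] at hfD
  -- choice of `e1`, `e2`
  obtain ⟨gL, kL, k1, k2, k3⟩ := klein_exists (K := K) l
  obtain ⟨gV, kV, m1, m2, m3⟩ := klein_exists (K := K) X.v1
  obtain ⟨e1, he1⟩ := approx {.inl l, .inl X.v1} (fun v => if v = .inl l then gL else gV)
  obtain ⟨e2, he2⟩ := approx {.inl l, .inl X.v1} (fun v => if v = .inl l then kL else kV)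
  have E1L := he1 (.inl l) (by simp)
  have E1V := he1 (.inl X.v1) (by simp)
  have E2L := he2 (.inl l) (by simp)
  have E2V := he2 (.inl X.v1) (by simp)
  rw [if_pos rfl] at E1L E2L
  rw [if_neg hl1.symm] at E1V E2V
  have hE : ∀ v ∈ ({.inl l, .inl X.v1} : Finset (Pl K)), e1 ∉ D v ∧ e2 ∉ D v ∧ e1 * e2 ∉ D v := by
    intro v hv
    simp only [Finset.mem_insert, Finset.mem_singleton] at hv
    rcases hv with rfl | rfl
    · refine ⟨fun h => k1 (by simpa using div_mem h E1L), fun h => k2 (by simpa using div_mem h E2L),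
        fun h => k3 ?_⟩
      have := div_mem h (mul_mem E1L E2L)
      rwa [div_mul_div_comm, div_div_self'] at this
    · refine ⟨fun h => m1 (by simpa using div_mem h E1V), fun h => m2 (by simpa using div_mem h E2V),
        fun h => m3 ?_⟩
      have := div_mem h (mul_mem E1V E2V)
      rwa [div_mul_div_comm, div_div_self'] at this
  have hram : ∀ v, (c1 * z) * (-(X.u * X.c * n0)) ∉ NL v a →
      v ∈ ({.inl l, .inl X.v1} : Finset (Pl K)) := by
    intro v hv
    rw [← hil_ne_iff, hil_mul_right, hil_c, ← presentation hn0 hx0] at hv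
    simp only [Finset.mem_insert, Finset.mem_singleton]
    by_contra! hcon
    by_cases hv0 : v = .inl X.v0
    · have q1 : hil v a c1 = -1 := by rw [hil_ne_iff, hc1, hv0]; simp
      have q2 : hil v X.u X.c = -1 := by rw [hil_ne_iff, X.hR, hv0]; simp
      rw [q1, q2] at hv
      exact absurd hv (by decide)
    · have q1 : hil v a c1 = 1 := by
        rw [hil_one_iff]; by_contra hh
        rcases (hc1 _).1 hh with h | h
        · exact hv0 h
        · exact hcon.1 h
      have q2 : hil v X.u X.c = 1 := by
        rw [hil_one_iff]; by_contra hh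
        rcases (X.hR _).1 hh with h | h
        · exact hv0 h
        · exact hcon.2 h
      rw [q1, q2] at hv
      exact absurd hv (by decide)
  refine ⟨a, n, n0, c1 * z, e1, e2, x, x0, hn, hx, hn0, hx0, ?_, ?_, ?_⟩
  · rw [hmem_c, hc1]; simp
  · intro v hv hv0
    rw [hmem_c]
    by_contra hh
    rcases (hc1 _).1 hh with h | h
    · exact hv0 h
    · exact hwF (by rw [← show v = .inl l from h]; exact hv)
  · rw [← hbdef, ← hf]
    intro e he
    apply thmP
    intro v hv
    have hv' := hram v hv
    obtain ⟨r1, r2, r3⟩ := hE v hv'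
    have r4 := hfD v hv'
    simp only [List.mem_cons, List.not_mem_nil, or_false] at he
    rcases he with rfl | rfl | rfl | rfl | rfl | rfl
    · exact r1
    · exact r2
    · exact r3
    · rwa [mul_mem_cancel_left r4]
    · rwa [mul_mem_cancel_left r4]
    · rwa [mul_mem_cancel_left r4]

theorem Aux.main (X : Aux K) (A B : Kˣ) :
    B ∉ Nm A ↔ (∃ v ∈ X.FB, B ∉ NL v A) ∨ X.Cert A B := by
  refine ⟨X.complete, ?_⟩
  rintro (⟨v, -, hv⟩ | h)
  · exact fun h => hv (Nm_le_NL v A h)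
  · exact X.sound h

end
end TAD

namespace TAD
open Subgroup WithZero IsDedekindDomain NumberField
open scoped WithZero

section
variable {K : Type*} [Field K] [NumberField K]

/-- `K`-valued certificate: the variables `t` are
`a, n, n0, c, e1, e2, x, x0, y, z, y0, z0`. -/
def Aux.CK (X : Aux K) (p : Fin 2 → K) (t : Fin 12 → K) : Prop :=
  (∀ i ∈ ([0, 1, 2, 3, 4, 5] : List (Fin 12)).toFinset, t i ≠ 0) ∧
  t 1 = t 8 ^ 2 - p 0 * t 9 ^ 2 ∧
  t 0 = p 0 * t 6 ^ 2 + p 1 * t 1 ∧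
  t 2 = t 10 ^ 2 - X.u * t 11 ^ 2 ∧
  t 0 = X.u * t 7 ^ 2 + X.c * t 2 ∧
  NsK (.inl X.v0) (t 0) (t 3) ∧
  (∀ v ∈ X.FB, v ≠ .inl X.v0 → SpK v (t 0) (t 3)) ∧
  PK (t 0) (t 3 * (-(X.u * X.c * t 2))) (t 4) ∧
  PK (t 0) (t 3 * (-(X.u * X.c * t 2))) (t 5) ∧
  PK (t 0) (t 3 * (-(X.u * X.c * t 2))) (t 4 * t 5) ∧
  PK (t 0) (t 3 * (-(X.u * X.c * t 2))) (-(p 0 * p 1 * t 1) * t 3 * t 4) ∧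
  PK (t 0) (t 3 * (-(X.u * X.c * t 2))) (-(p 0 * p 1 * t 1) * t 3 * t 5) ∧
  PK (t 0) (t 3 * (-(X.u * X.c * t 2))) (-(p 0 * p 1 * t 1) * t 3 * (t 4 * t 5))

theorem Dio.CK (X : Aux K) : Dio (fun p => ∃ t, X.CK p t) := by
  classical
  apply Dio.ex
  have V : ∀ i : Fin 2 ⊕ Fin 12, PF (fun a : Fin 2 ⊕ Fin 12 → K => a i) := PF.var
  have hy := (V (.inr 3)).mul ((((PF.const (X.u : K)).mul (PF.const (X.c : K))).mul (V (.inr 2))).neg)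
  have hf := ((((V (.inl 0)).mul (V (.inl 1))).mul (V (.inr 1))).neg).mul (V (.inr 3))
  refine Dio.and' (Dio.biInter' _ fun i _ => Dio.ne (V (.inr i))) ?_
  refine Dio.and' (Dio.eq (V _) (((V _).pow 2).sub ((V _).mul ((V _).pow 2)))) ?_
  refine Dio.and' (Dio.eq (V _) (((V _).mul ((V _).pow 2)).add ((V _).mul (V _)))) ?_
  refine Dio.and' (Dio.eq (V _) (((V _).pow 2).sub ((PF.const _).mul ((V _).pow 2)))) ?_
  refine Dio.and' (Dio.eq (V _) (((PF.const _).mul ((V _).pow 2)).add ((PF.const _).mul (V _)))) ?_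
  refine Dio.and' (Dio.Ns _ (V _) (V _)) ?_
  refine Dio.and' (Dio.biInter' _ fun v _ => ?_) ?_
  · by_cases h : v = .inl X.v0
    · exact Dio.true.congr fun a => by simp [h]
    · exact (Dio.Sp v (V (.inr 0)) (V (.inr 3))).congr fun a => by simp [h]
  refine Dio.and' (Dio.pk (V _) hy (V _)) ?_
  refine Dio.and' (Dio.pk (V _) hy (V _)) ?_
  refine Dio.and' (Dio.pk (V _) hy ((V _).mul (V _))) ?_
  refine Dio.and' (Dio.pk (V _) hy (hf.mul (V _))) ?_
  refine Dio.and' (Dio.pk (V _) hy (hf.mul (V _))) ?_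
  exact Dio.pk (V _) hy (hf.mul ((V _).mul (V _)))

theorem PK_coe {u c g : Kˣ} {u' c' g' : K} (hu : u' = u) (hc : c' = c) (hg : g' = g) :
    PK u' c' g' ↔ Pg u c g := by
  subst hu hc hg; exact Iff.rfl

theorem NsK_coe {v : Pl K} {a b : Kˣ} : NsK v (a : K) (b : K) ↔ b ∉ NL v a :=
  ⟨fun ⟨a', b', ha, hb, h⟩ => by rwa [← Units.ext ha, ← Units.ext hb], fun h => ⟨a, b, rfl, rfl, h⟩⟩

theorem SpK_coe {v : Pl K} {a b : Kˣ} : SpK v (a : K) (b : K) ↔ b ∈ NL v a :=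
  ⟨fun ⟨a', b', ha, hb, h⟩ => by rwa [← Units.ext ha, ← Units.ext hb], fun h => ⟨a, b, rfl, rfl, h⟩⟩

theorem Aux.CK_iff (X : Aux K) (A B : Kˣ) : X.Cert A B ↔ ∃ t, X.CK ![(A : K), (B : K)] t := by
  constructor
  · rintro ⟨a, n, n0, c, e1, e2, x, x0, ⟨y, z, hn⟩, ha, ⟨y0, z0, hn0⟩, ha0, hc0, hcF, hP⟩
    refine ⟨![a, n, n0, c, e1, e2, x, x0, y, z, y0, z0], ?_, hn, ha, hn0, ha0, NsK_coe.2 hc0,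
      fun v hv h => SpK_coe.2 (hcF v hv h), ?_, ?_, ?_, ?_, ?_, ?_⟩
    · intro i hi
      simp only [List.mem_toFinset, List.mem_cons, List.not_mem_nil, or_false] at hi
      rcases hi with rfl | rfl | rfl | rfl | rfl | rfl
      exacts [a.ne_zero, n.ne_zero, n0.ne_zero, c.ne_zero, e1.ne_zero, e2.ne_zero]
    · exact (PK_coe (u := a) (c := c * (-(X.u * X.c * n0))) (g := e1) rfl (by simp) (by simp)).2 (hP _ (by simp))
    · exact (PK_coe (u := a) (c := c * (-(X.u * X.c * n0))) (g := e2) rfl (by simp) (by simp)).2 (hP _ (by simp))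
    · exact (PK_coe (u := a) (c := c * (-(X.u * X.c * n0))) (g := e1 * e2) rfl (by simp) (by simp)).2 (hP _ (by simp))
    · exact (PK_coe (u := a) (c := c * (-(X.u * X.c * n0))) (g := (-(A * B * n)) * c * e1) rfl (by simp) (by simp)).2 (hP _ (by simp))
    · exact (PK_coe (u := a) (c := c * (-(X.u * X.c * n0))) (g := (-(A * B * n)) * c * e2) rfl (by simp) (by simp)).2 (hP _ (by simp))
    · exact (PK_coe (u := a) (c := c * (-(X.u * X.c * n0))) (g := (-(A * B * n)) * c * (e1 * e2)) rfl (by simp) (by simp)).2 (hP _ (by simp))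
  · rintro ⟨t, h0, h1, h2, h3, h4, h5, h6, p1, p2, p3, p4, p5, p6⟩
    obtain ⟨a, ha⟩ : ∃ a : Kˣ, (a : K) = t 0 := ⟨Units.mk0 _ (h0 0 (by simp)), rfl⟩
    obtain ⟨n, hn⟩ : ∃ a : Kˣ, (a : K) = t 1 := ⟨Units.mk0 _ (h0 1 (by simp)), rfl⟩
    obtain ⟨n0, hn0⟩ : ∃ a : Kˣ, (a : K) = t 2 := ⟨Units.mk0 _ (h0 2 (by simp)), rfl⟩
    obtain ⟨c, hc⟩ : ∃ a : Kˣ, (a : K) = t 3 := ⟨Units.mk0 _ (h0 3 (by simp)), rfl⟩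
    obtain ⟨e1, he1⟩ : ∃ a : Kˣ, (a : K) = t 4 := ⟨Units.mk0 _ (h0 4 (by simp)), rfl⟩
    obtain ⟨e2, he2⟩ : ∃ a : Kˣ, (a : K) = t 5 := ⟨Units.mk0 _ (h0 5 (by simp)), rfl⟩
    rw [← ha, ← hc] at h5 h6
    refine ⟨a, n, n0, c, e1, e2, t 6, t 7, ⟨t 8, t 9, hn.trans h1⟩, ?_, ⟨t 10, t 11, hn0.trans h3⟩, ?_,
      NsK_coe.1 h5, fun v hv h => SpK_coe.1 (h6 v hv h), ?_⟩
    · rw [ha, hn]; exact h2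
    · rw [ha, hn0]; exact h4
    · intro e he
      have hyy : t 3 * (-(X.u * X.c * t 2)) = ((c * (-(X.u * X.c * n0)) : Kˣ) : K) := by
        simp [← hc, ← hn0]
      simp only [List.mem_cons, List.not_mem_nil, or_false] at he
      rcases he with rfl | rfl | rfl | rfl | rfl | rfl
      · exact (PK_coe ha.symm hyy he1.symm).1 p1
      · exact (PK_coe ha.symm hyy he2.symm).1 p2
      · exact (PK_coe ha.symm hyy (by simp [← he1, ← he2])).1 p3
      · exact (PK_coe ha.symm hyy (by simp [← he1, ← hn, ← hc])).1 p4
      · exact (PK_coe ha.symm hyy (by simp [← he2, ← hn, ← hc])).1 p5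
      · exact (PK_coe ha.symm hyy (by simp [← he1, ← he2, ← hn, ← hc])).1 p6

theorem anisotropic_iff {a : Fin 3 → K} (h : ∀ i, a i ≠ 0) {A B : Kˣ} (hA : (A : K) = -(a 0 * a 1))
    (hB : (B : K) = -(a 0 * a 2)) :
    (∀ x : Fin 3 → K, a 0 * x 0 ^ 2 + a 1 * x 1 ^ 2 + a 2 * x 2 ^ 2 = 0 → x = 0) ↔ B ∉ Nm A := by
  constructor
  · rintro hx ⟨s, t, hst⟩
    have := hx ![s / a 0, t, 1] (by
      simp only [Matrix.cons_val_zero, Matrix.cons_val_one, Matrix.cons_val]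
      have h0 := h 0
      rw [hA, hB] at hst
      field_simp
      linear_combination -hst)
    have := congrFun this 2
    simp at this
  · intro hB' x hx
    by_contra hne
    apply hB'
    have h0 := h 0
    have h1 := h 1
    by_cases hz : x 2 = 0
    · have hy : x 1 ≠ 0 := by
        intro hy
        apply hne
        rw [hy, hz] at hx
        have hx0 : x 0 = 0 := by simpa [h0] using hx
        ext i
        fin_cases i
        exacts [hx0, hy, hz]
      have hs : a 0 * x 0 / x 1 ≠ 0 := by
        intro hs
        have hx0 : x 0 = 0 := by
          rcases div_eq_zero_iff.1 hs with h' | h'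
          · rcases mul_eq_zero.1 h' with h' | h'
            · exact absurd h' h0
            · exact h'
          · exact absurd h' hy
        rw [hx0, hz] at hx
        have : a 1 * x 1 ^ 2 = 0 := by simpa using hx
        exact (mul_ne_zero h1 (pow_ne_zero 2 hy)) this
      have hAs : A = (Units.mk0 _ hs) ^ 2 := by
        ext
        rw [hA]
        push_cast [Units.val_mk0]
        rw [div_pow, eq_div_iff (pow_ne_zero 2 hy)]
        rw [hz] at hx
        linear_combination (-(a 0)) * hx
      rw [hAs, Nm_sq]
      trivial
    · refine ⟨a 0 * x 0 / x 2, x 1 / x 2, ?_⟩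
      rw [hA, hB]
      field_simp
      linear_combination (-1) * hx

theorem final : Dio (fun a : Fin 3 → K => (∀ i, a i ≠ 0) ∧
      ∀ x : Fin 3 → K, a 0 * x 0 ^ 2 + a 1 * x 1 ^ 2 + a 2 * x 2 ^ 2 = 0 → x = 0) := by
  obtain ⟨X⟩ := exists_Aux (K := K)
  have V : ∀ i : Fin 3, PF (fun a : Fin 3 → K => a i) := PF.var
  have pA : PF (fun a : Fin 3 → K => -(a 0 * a 1)) := ((V 0).mul (V 1)).neg
  have pB : PF (fun a : Fin 3 → K => -(a 0 * a 2)) := ((V 0).mul (V 2)).neg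
  have d1 : Dio (fun a : Fin 3 → K => ∀ i ∈ (Finset.univ : Finset (Fin 3)), a i ≠ 0) :=
    Dio.biInter' _ fun i _ => Dio.ne (V i)
  have d2 : Dio (fun a : Fin 3 → K => ∃ v ∈ X.FB, NsK v (-(a 0 * a 1)) (-(a 0 * a 2))) :=
    Dio.biUnion _ fun v _ => Dio.Ns v pA pB
  have d3 := (Dio.CK X).subst (g := ![fun a : Fin 3 → K => -(a 0 * a 1), fun a => -(a 0 * a 2)])
    (fun k => by fin_cases k; exacts [pA, pB])
  refine (d1.and' (d2.or d3)).congr fun a => ?_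
  simp only [Finset.mem_univ, forall_const]
  refine and_congr_right fun h => ?_
  obtain ⟨A, hA⟩ : ∃ A : Kˣ, (A : K) = -(a 0 * a 1) :=
    ⟨Units.mk0 _ (neg_ne_zero.2 (mul_ne_zero (h 0) (h 1))), rfl⟩
  obtain ⟨B, hB⟩ : ∃ A : Kˣ, (A : K) = -(a 0 * a 2) :=
    ⟨Units.mk0 _ (neg_ne_zero.2 (mul_ne_zero (h 0) (h 2))), rfl⟩
  rw [anisotropic_iff h hA hB, X.main, X.CK_iff]
  have e : (fun k => (![fun a : Fin 3 → K => -(a 0 * a 1), fun a => -(a 0 * a 2)] : Fin 2 → _) k a)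
      = ![(A : K), (B : K)] := by
    ext k; fin_cases k
    · exact hA.symm
    · exact hB.symm
  rw [e, ← hA, ← hB]
  simp only [NsK_coe]

end
end TAD

/-- Over a number field `K`, the set of triples `(a₁, a₂, a₃) ∈ (Kˣ)³` such that the ternary
form `a₁x² + a₂y² + a₃z²` is anisotropic over `K` is diophantine over `K`. -/
theorem ternary_anisotropic_diophantine_numberField
    (K : Type*) [Field K] [NumberField K] :
    IsDiophantine {a : Fin 3 → K |
      (∀ i, a i ≠ 0) ∧
      ∀ x : Fin 3 → K, a 0 * x 0 ^ 2 + a 1 * x 1 ^ 2 + a 2 * x 2 ^ 2 = 0 → x = 0} := by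
  exact TAD.final.isDiophantine
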